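/- Let k be a number field. For every ε > 0 there is a constant depending only on k and ε such that for all coprime squarefree integral ideals q and r of O_k, the number of S3-cubic extensions K/k (up to isomorphism) with Disc(K) ≤ X that are partially ramified at every prime dividing q and totally ramified at every prime dividing r is at most O_{k,ε}(X / (|q|^{1/6 − ε} · |r|^{2 − ε})); the implied constant is independent of q and r. -/

import Mathlib

open scoped Classical NumberField

noncomputable section

variable (k : Type*) [Field k] [NumberField k]

local notation "kbar" => AlgebraicClosure k

/-- The permutation of the embeddings of `K` into `kbar` induced by an automorphism
of `kbar` over `k` (acting by post-composition). -/
def galPerm (K : IntermediateField k kbar) (σ : kbar ≃ₐ[k] kbar) :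
    Equiv.Perm (K →ₐ[k] kbar) where
  toFun f := σ.toAlgHom.comp f
  invFun f := σ.symm.toAlgHom.comp f
  left_inv f := by ext x; simp
  right_inv f := by ext x; simp

/-- The action of the absolute Galois group of `k` on the embeddings of `K`, as a
homomorphism to the permutation group of the embeddings.  Its image is isomorphic to the
Galois group of the Galois closure of `K` over `k`, viewed as a permutation group on the
embeddings of `K`. -/
def galPermHom (K : IntermediateField k kbar) :
    (kbar ≃ₐ[k] kbar) →* Equiv.Perm (K →ₐ[k] kbar) where
  toFun := galPerm k K
  map_one' := by
    refine Equiv.ext fun f => AlgHom.ext fun x => ?_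
    simp [galPerm]
  map_mul' σ τ := by
    refine Equiv.ext fun f => AlgHom.ext fun x => ?_
    simp [galPerm]

/-- `K` is an `S3`-cubic extension of `k`: it has degree `3` over `k` and the Galois group
of its Galois closure over `k` is the full symmetric group on the three embeddings of `K`
into `kbar`, i.e. the absolute Galois group of `k` surjects onto this symmetric group. -/
def IsSThreeCubic (K : IntermediateField k kbar) : Prop :=
  Module.finrank k K = 3 ∧ Function.Surjective (galPermHom k K)

/-- `Disc(K)`: the absolute norm to `ℚ` of the discriminant of `K/ℚ`
(junk value `0` if `K` is infinite-dimensional over `k`). -/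
def absDisc (K : IntermediateField k kbar) : ℕ :=
  haveI : CharZero K := (algebraMap K kbar).charZero
  if h : FiniteDimensional k K then
    haveI := h
    haveI : IsScalarTower ℚ k K := IsScalarTower.of_algebraMap_eq' (Subsingleton.elim _ _)
    haveI : FiniteDimensional ℚ K := Module.Finite.trans k K
    haveI : NumberField K := ⟨⟩
    (NumberField.discr K).natAbs
  else 0

/-- `K` is partially ramified at the prime `p` of `k`: `p 𝒪_K = P₁² P₂`
with `P₁ ≠ P₂` prime. -/
def PartiallyRamified (K : IntermediateField k kbar) (p : Ideal (𝓞 k)) : Prop :=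
  ∃ P₁ P₂ : Ideal (𝓞 K), P₁.IsPrime ∧ P₂.IsPrime ∧ P₁ ≠ P₂ ∧
    Ideal.map (algebraMap (𝓞 k) (𝓞 K)) p = P₁ ^ 2 * P₂

/-- `K` is totally ramified at the prime `p` of `k`: `p 𝒪_K = P³` with `P` prime. -/
def TotallyRamified (K : IntermediateField k kbar) (p : Ideal (𝓞 k)) : Prop :=
  ∃ P : Ideal (𝓞 K), P.IsPrime ∧
    Ideal.map (algebraMap (𝓞 k) (𝓞 K)) p = P ^ 3

/-- Two subfields of `kbar` are identified when they are isomorphic over `k`. -/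
def isoSetoid : Setoid (IntermediateField k kbar) where
  r K L := Nonempty (K ≃ₐ[k] L)
  iseqv := ⟨fun _ => ⟨AlgEquiv.refl⟩, fun ⟨e⟩ => ⟨e.symm⟩, fun ⟨e⟩ ⟨f⟩ => ⟨e.trans f⟩⟩

/-- The number of isomorphism classes of members of a given collection of extensions
of `k` inside `kbar`. -/
def countClasses (S : Set (IntermediateField k kbar)) : ℕ :=
  Nat.card (Quotient (Setoid.comap (Subtype.val : S → _) (isoSetoid k)))

theorem norm_le_abs_add_abs_conj (z : ℂ) :
    ‖z‖ ≤ |z.re + z.im| + |z.re - z.im| := by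
  have h1 := Complex.norm_le_abs_re_add_abs_im z
  have h2 : |z.re| + |z.im| ≤ |z.re + z.im| + |z.re - z.im| := by
    rcases abs_cases z.re with ⟨h, _⟩ | ⟨h, _⟩ <;> rcases abs_cases z.im with ⟨h', _⟩ | ⟨h', _⟩ <;>
    rcases abs_cases (z.re + z.im) with ⟨h2, _⟩ | ⟨h2, _⟩ <;>
    rcases abs_cases (z.re - z.im) with ⟨h3, _⟩ | ⟨h3, _⟩ <;> linarith
  linarith

/-- Points of a weighted box in a number field that are separated in the weighted
maximum norm: a packing bound. -/
theorem card_le_of_separated {F : Type*} [Field F] [NumberField F]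
    (g : (F →+* ℂ) → ℝ) (hg : ∀ φ, 0 < g φ)
    (hgc : ∀ φ, g (NumberField.ComplexEmbedding.conjugate φ) = g φ)
    {T l : ℝ} (hT0 : 0 ≤ T) (hl : 0 < l) (S : Finset F)
    (hT : ∀ x ∈ S, ∀ φ : F →+* ℂ, ‖φ x‖ ≤ T * g φ)
    (hsep : ∀ x ∈ S, ∀ y ∈ S, x ≠ y → ∃ φ : F →+* ℂ, l * g φ ≤ ‖φ (x - y)‖) :
    (S.card : ℝ) ≤ (32 * (T / l + 1)) ^ Module.finrank ℚ F := by
  set L : ℤ := ⌈8 * T / l⌉ with hL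
  have hL0 : 0 ≤ L := Int.ceil_nonneg (by positivity)
  let cell : F → (F →+* ℂ) → ℤ := fun x φ => ⌊((φ x).re + (φ x).im) * (4 / (l * g φ))⌋
  have hmem : ∀ x ∈ S, cell x ∈ Fintype.piFinset (fun _ : F →+* ℂ => Finset.Icc (-L) L) := by
    intro x hx
    rw [Fintype.mem_piFinset]
    intro φ
    have hlg : 0 < l * g φ := mul_pos hl (hg φ)
    have h1 := hT x hx φ
    have h2 := Complex.abs_re_le_norm (φ x)
    have h3 := Complex.abs_im_le_norm (φ x)
    have h4 : |((φ x).re + (φ x).im) * (4 / (l * g φ))| ≤ 8 * T / l := by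
      rw [abs_mul, abs_of_pos (show 0 < 4 / (l * g φ) by positivity)]
      have : |(φ x).re + (φ x).im| ≤ 2 * (T * g φ) := by
        refine (abs_add_le _ _).trans (by linarith)
      calc _ ≤ 2 * (T * g φ) * (4 / (l * g φ)) := by gcongr
        _ = 8 * T / l := by
          have := (hg φ).ne'
          field_simp
          ring
    have h5 : 8 * T / l ≤ L := Int.le_ceil _
    rw [abs_le] at h4
    rw [Finset.mem_Icc]
    constructor
    · apply Int.le_floor.mpr
      push_cast
      linarith
    · have := Int.floor_le (((φ x).re + (φ x).im) * (4 / (l * g φ)))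
      have : ((⌊((φ x).re + (φ x).im) * (4 / (l * g φ))⌋ : ℤ) : ℝ) ≤ (L : ℝ) := by linarith
      exact_mod_cast this
  have hinj : Set.InjOn cell S := by
    intro x hx y hy hxy
    by_contra hne
    obtain ⟨φ, hφ⟩ := hsep x hx y hy hne
    have key : ∀ φ' : F →+* ℂ, |(φ' (x - y)).re + (φ' (x - y)).im| < l * g φ' / 4 := by
      intro φ'
      have hlg : 0 < l * g φ' := mul_pos hl (hg φ')
      have h1 := Int.abs_sub_lt_one_of_floor_eq_floor (congrFun hxy φ')
      rw [← sub_mul, abs_mul, abs_of_pos (show 0 < 4 / (l * g φ') by positivity),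
        mul_div_assoc', div_lt_one hlg] at h1
      have h2 : (φ' (x - y)).re + (φ' (x - y)).im
          = (φ' x).re + (φ' x).im - ((φ' y).re + (φ' y).im) := by
        simp; ring
      rw [h2]; linarith
    have h1 := key φ
    have h2 := key (NumberField.ComplexEmbedding.conjugate φ)
    have h3 := norm_le_abs_add_abs_conj (φ (x - y))
    rw [hgc, NumberField.ComplexEmbedding.conjugate_coe_eq] at h2
    simp only [Complex.conj_re, Complex.conj_im, ← sub_eq_add_neg] at h2
    have := mul_pos hl (hg φ)
    linarith
  have hcard := Finset.card_le_card_of_injOn cell hmem hinj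
  rw [Fintype.card_piFinset, Finset.prod_const, Finset.card_univ, Int.card_Icc,
    NumberField.Embeddings.card] at hcard
  have h6 : ((L + 1 - -L).toNat : ℝ) ≤ 32 * (T / l + 1) := by
    have h7 : ((L + 1 - -L).toNat : ℤ) = 2 * L + 1 := by omega
    have h8 : ((L + 1 - -L).toNat : ℝ) = 2 * L + 1 := by exact_mod_cast h7
    have h9 : (L : ℝ) < 8 * T / l + 1 := Int.ceil_lt_add_one _
    have : 0 ≤ T / l := by positivity
    rw [h8, mul_div_assoc] at *
    linarith
  calc (S.card : ℝ) ≤ ((L + 1 - -L).toNat : ℝ) ^ Module.finrank ℚ F := by exact_mod_cast hcard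
    _ ≤ _ := by gcongr

/-- A nonzero element of an ideal has some conjugate at least as large as the corresponding
root of the norm of the ideal. -/
theorem exists_embedding_norm_ge {F : Type*} [Field F] [NumberField F]
    (q : Ideal (𝓞 F)) {x : 𝓞 F} (hx : x ∈ q) (hx0 : x ≠ 0) {l : ℝ}
    (hl : l ^ Module.finrank ℚ F ≤ Ideal.absNorm q) :
    ∃ φ : F →+* ℂ, l ≤ ‖φ (x : F)‖ := by
  by_contra! h
  have h1 : (Ideal.absNorm q : ℝ) ≤ ∏ φ : F →ₐ[ℚ] ℂ, ‖φ (x : F)‖ := by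
    rw [← norm_prod, ← Algebra.norm_eq_prod_embeddings]
    have h2 : Ideal.absNorm q ∣ (Algebra.norm ℤ x).natAbs := by
      rw [← Ideal.absNorm_span_singleton]
      exact Ideal.absNorm_dvd_absNorm_of_le ((Ideal.span_singleton_le_iff_mem q).mpr hx)
    have h3 := Nat.le_of_dvd (Int.natAbs_pos.mpr (Algebra.norm_ne_zero_iff.mpr hx0)) h2
    have h4 : (algebraMap ℚ ℂ) (Algebra.norm ℚ (x : F)) = ((Algebra.norm ℤ x : ℤ) : ℂ) := by
      rw [← Algebra.coe_norm_int]; simp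
    rw [h4, Complex.norm_intCast, ← Int.cast_abs, Int.abs_eq_natAbs]
    exact_mod_cast h3
  have h5 : ∏ φ : F →ₐ[ℚ] ℂ, ‖φ (x : F)‖ < ∏ φ : F →ₐ[ℚ] ℂ, l := by
    apply Finset.prod_lt_prod_of_nonempty
    · intro φ _
      rw [norm_pos_iff]
      simpa using hx0
    · intro φ _
      exact h φ.toRingHom
    · obtain ⟨φ⟩ : Nonempty (F →+* ℂ) := inferInstance
      exact ⟨φ.toRatAlgHom, Finset.mem_univ _⟩
  rw [Finset.prod_const, Finset.card_univ, AlgHom.card] at h5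
  linarith

theorem card_le_of_box {F : Type*} [Field F] [NumberField F]
    {q : Ideal (𝓞 F)} (hq : q ≠ ⊥) {T : ℝ} (hT : 0 ≤ T) (S : Finset (𝓞 F))
    (hS : ∀ x ∈ S, ∀ φ : F →+* ℂ, ‖φ (x : F)‖ ≤ T)
    (hd : ∀ x ∈ S, ∀ y ∈ S, x - y ∈ q) :
    (S.card : ℝ) ≤ 64 ^ Module.finrank ℚ F *
      (T ^ Module.finrank ℚ F / Ideal.absNorm q + 1) := by
  set n := Module.finrank ℚ F with hn
  have hn0 : n ≠ 0 := Module.finrank_pos.ne'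
  have hN : (0 : ℝ) < Ideal.absNorm q := by
    exact_mod_cast Nat.pos_of_ne_zero (by rwa [Ne, Ideal.absNorm_eq_zero_iff])
  set l : ℝ := (Ideal.absNorm q : ℝ) ^ ((n : ℝ)⁻¹) with hl
  have hl0 : 0 < l := Real.rpow_pos_of_pos hN _
  have hln : l ^ n = Ideal.absNorm q := by
    rw [hl, Real.rpow_inv_natCast_pow hN.le hn0]
  have h1 := card_le_of_separated (F := F) (fun _ => 1) (fun _ => one_pos) (fun _ => rfl)
    hT hl0 (S.map ⟨_, NumberField.RingOfIntegers.coe_injective⟩) (by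
      intro x hx φ
      obtain ⟨y, hy, rfl⟩ := Finset.mem_map.mp hx
      simpa using hS y hy φ) (by
      intro x hx y hy hxy
      obtain ⟨x, hx', rfl⟩ := Finset.mem_map.mp hx
      obtain ⟨y, hy', rfl⟩ := Finset.mem_map.mp hy
      obtain ⟨φ, hφ⟩ := exists_embedding_norm_ge q (hd x hx' y hy')
        (sub_ne_zero.mpr (fun h => hxy (by rw [h]))) hln.le
      exact ⟨φ, by simpa using hφ⟩)
  rw [Finset.card_map] at h1
  refine h1.trans ?_
  rw [← hn]
  have h2 : (32 * (T / l + 1)) ^ n ≤ (64 * max (T / l) 1) ^ n := by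
    refine pow_le_pow_left₀ (by positivity) ?_ n
    have := le_max_left (T / l) 1
    have := le_max_right (T / l) 1
    linarith
  refine h2.trans ?_
  rw [mul_pow, ← hln, ← div_pow]
  gcongr
  rcases max_cases (T / l) 1 with ⟨h, _⟩ | ⟨h, _⟩ <;> rw [h]
  · linarith
  · have : 0 ≤ (T / l) ^ n := by positivity
    simpa using this

theorem exists_box_card_ge (F : Type*) [Field F] [NumberField F] :
    ∃ c : ℝ, 0 < c ∧ ∀ T : ℝ, 1 ≤ T → ∃ S : Finset (𝓞 F),
      (∀ x ∈ S, ∀ φ : F →+* ℂ, ‖φ (x : F)‖ ≤ T) ∧ c * T ^ Module.finrank ℚ F ≤ S.card := by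
  let b := NumberField.RingOfIntegers.basis F
  set n := Module.finrank ℚ F with hn
  set D : ℝ := ∑ i, ∑ φ : F →+* ℂ, ‖φ (b i : F)‖ + 1 with hD
  have hD0 : 0 < D := by positivity
  refine ⟨D⁻¹ ^ n, by positivity, fun T hT => ?_⟩
  set N := ⌊T / D⌋₊ with hN
  let f : (Module.Free.ChooseBasisIndex ℤ (𝓞 F) → ℕ) → 𝓞 F := fun m => ∑ i, (m i : ℤ) • b i
  have hf : Function.Injective f := by
    intro m m' h
    have h1 := b.equivFun.symm.injective (a₁ := fun i => (m i : ℤ)) (a₂ := fun i => (m' i : ℤ))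
      (by simpa only [Module.Basis.equivFun_symm_apply] using h)
    funext i
    exact_mod_cast congrFun h1 i
  refine ⟨(Fintype.piFinset (fun _ => Finset.range (N + 1))).map ⟨f, hf⟩, ?_, ?_⟩
  · intro x hx φ
    obtain ⟨m, hm, rfl⟩ := Finset.mem_map.mp hx
    rw [Fintype.mem_piFinset] at hm
    have h1 : φ ((f m : 𝓞 F) : F) = ∑ i, (m i : ℂ) * φ (b i : F) := by
      simp [f]
    simp only [Function.Embedding.coeFn_mk]
    rw [h1]
    calc ‖∑ i, (m i : ℂ) * φ (b i : F)‖ ≤ ∑ i, ‖(m i : ℂ) * φ (b i : F)‖ := norm_sum_le _ _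
      _ ≤ ∑ i, (T / D) * ∑ φ : F →+* ℂ, ‖φ (b i : F)‖ := by
        gcongr with i
        rw [norm_mul, Complex.norm_natCast]
        gcongr
        · have h2 := Finset.mem_range_succ_iff.mp (hm i)
          exact (Nat.cast_le.mpr h2).trans (Nat.floor_le (by positivity))
        · exact Finset.single_le_sum (f := fun φ : F →+* ℂ => ‖φ (b i : F)‖)
            (fun _ _ => norm_nonneg _) (Finset.mem_univ φ)
      _ = (T / D) * (D - 1) := by rw [← Finset.mul_sum, hD]; ring
      _ ≤ T := by
        rw [div_mul_eq_mul_div, div_le_iff₀ hD0]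
        nlinarith
  · rw [Finset.card_map, Fintype.card_piFinset, Finset.prod_const, Finset.card_univ,
      Finset.card_range, ← Module.finrank_eq_card_chooseBasisIndex,
      NumberField.RingOfIntegers.rank, ← mul_pow, inv_mul_eq_div]
    push_cast
    gcongr
    exact (Nat.lt_floor_add_one _).le

open MeasureTheory in
open scoped Pointwise in
/-- **Blichfeldt's theorem**, counting form. -/
theorem measure_le_mul_of_forall_card_le {E L : Type*} [MeasurableSpace E] {μ : Measure E}
    {F s : Set E} [AddGroup L] [Countable L] [AddAction L E]
    [MeasurableConstVAdd L E] [VAddInvariantMeasure L E μ]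
    (fund : IsAddFundamentalDomain L F μ) (hs : MeasurableSet s) (B : ℕ)
    (hB : ∀ (v : E) (T : Finset L), (∀ l ∈ T, v ∈ l +ᵥ s) → T.card ≤ B) :
    μ s ≤ B * μ F := by
  have hm : ∀ l : L, MeasurableSet (l +ᵥ s) := fun l => hs.const_vadd l
  calc μ s = ∑' l : L, μ ((l +ᵥ s) ∩ F) := fund.measure_eq_tsum s
    _ = ∑' l : L, ∫⁻ x in F, (l +ᵥ s).indicator 1 x ∂μ := by
      refine tsum_congr fun l => ?_
      rw [lintegral_indicator_one (hm l), Measure.restrict_apply (hm l)]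
    _ = ∫⁻ x in F, ∑' l : L, (l +ᵥ s).indicator 1 x ∂μ := by
      rw [lintegral_tsum]
      exact fun l => (measurable_one.indicator (hm l)).aemeasurable
    _ ≤ ∫⁻ x in F, (B : ENNReal) ∂μ := by
      refine lintegral_mono fun x => ?_
      rw [ENNReal.tsum_eq_iSup_sum]
      refine iSup_le fun T => ?_
      have h1 : ∑ l ∈ T, (l +ᵥ s).indicator (1 : E → ENNReal) x
          = ((T.filter (fun l => x ∈ l +ᵥ s)).card : ENNReal) := by
        rw [Finset.card_filter]
        push_cast
        refine Finset.sum_congr rfl fun l _ => ?_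
        simp [Set.indicator_apply]
      rw [h1]
      exact_mod_cast hB x _ (fun l hl => (Finset.mem_filter.mp hl).2)
    _ = B * μ F := by simp

open MeasureTheory NumberField NumberField.mixedEmbedding Module in
open scoped Pointwise in
/-- If a box around the origin contains at most `B` points of a fractional ideal, then
the box of half its size has volume at most `B` times the covolume. -/
theorem prod_le_of_forall_card_le {E : Type*} [Field E] [NumberField E]
    (I : (FractionalIdeal (nonZeroDivisors (𝓞 E)) E)ˣ) (f : InfinitePlace E → NNReal) (B : ℕ)
    (hB : ∀ S : Finset E, (∀ z ∈ S, z ∈ (I : FractionalIdeal (nonZeroDivisors (𝓞 E)) E) ∧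
      ∀ w : InfinitePlace E, w z < 2 * f w) → S.card ≤ B) :
    ∏ w, (f w : ℝ) ^ w.mult ≤
      B * (FractionalIdeal.absNorm I.1 * Real.sqrt |(NumberField.discr E : ℝ)|) := by
  have h_fund := ZSpan.isAddFundamentalDomain' (fractionalIdealLatticeBasis E I) volume
  have : Countable (Submodule.span ℤ
      (Set.range (fractionalIdealLatticeBasis E I))).toAddSubgroup := by
    change Countable (Submodule.span ℤ (Set.range (fractionalIdealLatticeBasis E I)))
    infer_instance
  have hmeas : MeasurableSet (convexBodyLT E f) := by
    refine MeasurableSet.prod ?_ ?_ <;>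
    exact MeasurableSet.univ_pi fun w => Metric.isOpen_ball.measurableSet
  have h1 := measure_le_mul_of_forall_card_le h_fund hmeas B (by
    intro v T hT
    rcases T.eq_empty_or_nonempty with rfl | ⟨l₀, hl₀⟩
    · simp
    have h2 : ∀ l ∈ T, ∃ z : E, z ∈ (I : FractionalIdeal (nonZeroDivisors (𝓞 E)) E) ∧
        mixedEmbedding E z = (l : mixedSpace E) - l₀ := by
      intro l _
      have h3 := (l - l₀).2
      rw [Submodule.mem_toAddSubgroup, mem_span_fractionalIdealLatticeBasis] at h3
      obtain ⟨a, ha, h4⟩ := h3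
      exact ⟨a, ha, by rw [h4]; rfl⟩
    choose! z hzI hz using h2
    have hinj : Set.InjOn z T := by
      intro l hl l' hl' h
      have h3 := hz l hl
      rw [h, hz l' hl'] at h3
      exact Subtype.ext (sub_left_injective h3).symm
    rw [← Finset.card_image_of_injOn hinj]
    refine hB _ fun y hy => ?_
    obtain ⟨l, hl, rfl⟩ := Finset.mem_image.mp hy
    refine ⟨hzI l hl, ?_⟩
    have h5 : mixedEmbedding E (z l) ∈ convexBodyLT E (fun w => 2 * f w) := by
      rw [hz l hl]
      have ha := hT l hl
      have hb := hT l₀ hl₀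
      rw [Set.mem_vadd_set_iff_neg_vadd_mem] at ha hb
      have h6 : ((l : mixedSpace E) - l₀) = (-l₀ +ᵥ v) - (-l +ᵥ v) := by
        simp only [AddSubgroup.vadd_def, vadd_eq_add, AddSubgroup.coe_neg]
        abel
      rw [h6]
      generalize -l₀ +ᵥ v = p at *
      generalize -l +ᵥ v = p' at *
      simp only [Set.mem_prod, Set.mem_pi, Set.mem_univ, mem_ball_zero_iff, forall_true_left,
        Prod.fst_sub, Prod.snd_sub, Pi.sub_apply] at ha hb ⊢
      refine ⟨fun w => ?_, fun w => ?_⟩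
      · refine (norm_sub_le _ _).trans_lt ?_
        have := ha.1 w; have := hb.1 w
        push_cast
        linarith
      · refine (norm_sub_le _ _).trans_lt ?_
        have := ha.2 w; have := hb.2 w
        push_cast
        linarith
    have h6 := (convexBodyLT_mem E _).mp h5
    intro w
    simpa using h6 w)
  rw [volume_fundamentalDomain_fractionalIdealLatticeBasis, convexBodyLT_volume,
    volume_fundamentalDomain_latticeBasis] at h1
  have hfac : (1 : ENNReal) ≤ (convexBodyLTFactor E : ENNReal) := by
    exact_mod_cast one_le_convexBodyLTFactor E
  have h2 : ((∏ w, (f w) ^ w.mult : NNReal) : ENNReal) ≤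
      B * (ENNReal.ofReal (FractionalIdeal.absNorm I.1) *
        ((NNReal.sqrt ‖NumberField.discr E‖₊ : NNReal) : ENNReal)) := by
    calc _ ≤ (convexBodyLTFactor E : ENNReal) * ((∏ w, (f w) ^ w.mult : NNReal) : ENNReal) :=
          le_mul_of_one_le_left zero_le hfac
      _ ≤ _ := by push_cast at h1 ⊢; exact h1
      _ ≤ _ := by
        gcongr
        refine mul_le_of_le_one_left zero_le ?_
        exact pow_le_one₀ zero_le (by simp)
  have hN : (0 : ℝ) ≤ FractionalIdeal.absNorm I.1 := by
    exact_mod_cast FractionalIdeal.absNorm_nonneg I.1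
  rw [ENNReal.ofReal, ← ENNReal.coe_natCast, ← ENNReal.coe_mul, ← ENNReal.coe_mul,
    ENNReal.coe_le_coe, ← NNReal.coe_le_coe] at h2
  push_cast at h2
  rw [Real.coe_toNNReal _ hN] at h2
  have h7 : ‖NumberField.discr E‖ = |(NumberField.discr E : ℝ)| := Int.norm_eq_abs _
  rwa [h7] at h2

open NumberField in
theorem prod_norm_embeddings {F : Type*} [Field F] [NumberField F] (x : F) :
    ∏ φ : F →+* ℂ, ‖φ x‖ = |(Algebra.norm ℚ x : ℝ)| := by
  have h1 := congrArg norm (Algebra.norm_eq_prod_embeddings ℚ ℂ x)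
  rw [norm_prod] at h1
  have h2 : ∏ φ : F →+* ℂ, ‖φ x‖ = ∏ φ : F →ₐ[ℚ] ℂ, ‖φ x‖ :=
    Fintype.prod_equiv (RingHom.equivRatAlgHom F ℂ) _ _ (fun φ => rfl)
  rw [h2, ← h1]
  simp

open NumberField in
theorem prod_norm_embeddings_int {F : Type*} [Field F] [NumberField F] (x : 𝓞 F) :
    ∏ φ : F →+* ℂ, ‖φ (x : F)‖ = Ideal.absNorm (Ideal.span {x}) := by
  rw [prod_norm_embeddings, ← Algebra.coe_norm_int, Ideal.absNorm_span_singleton,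
    Nat.cast_natAbs]
  simp

open NumberField in
/-- Minkowski's theorem for fractional ideals with explicit constants. -/
theorem exists_ne_zero_mem_lt_of_lt_prod {E : Type*} [Field E] [NumberField E]
    (I : (FractionalIdeal (nonZeroDivisors (𝓞 E)) E)ˣ) (f : InfinitePlace E → NNReal)
    (h : FractionalIdeal.absNorm I.1 * Real.sqrt |(NumberField.discr E : ℝ)| <
      ∏ w, (f w : ℝ) ^ w.mult) :
    ∃ z : E, z ≠ 0 ∧ z ∈ (I : FractionalIdeal (nonZeroDivisors (𝓞 E)) E) ∧
      ∀ w : InfinitePlace E, w z < 2 * f w := by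
  by_contra! hc
  have h1 := prod_le_of_forall_card_le I f 1 (by
    intro S hS
    rw [Finset.card_le_one_iff_subset_singleton]
    refine ⟨0, fun z hz => Finset.mem_singleton.mpr ?_⟩
    by_contra hz0
    obtain ⟨w, hw⟩ := hc z hz0 (hS z hz).1
    exact absurd ((hS z hz).2 w) (not_lt.mpr hw))
  rw [Nat.cast_one, one_mul] at h1
  linarith

theorem exists_squarefree_mul_sq {R : Type*} [CommMonoidWithZero R]
    [UniqueFactorizationMonoid R] (a : R) (ha : a ≠ 0) :
    ∃ s m : R, Squarefree s ∧ a = s * m ^ 2 := by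
  induction a using UniqueFactorizationMonoid.induction_on_prime with
  | h₁ => exact absurd rfl ha
  | h₂ x hx => exact ⟨x, 1, hx.squarefree, by simp⟩
  | h₃ a p ha0 hp ih =>
    obtain ⟨s, m, hs, rfl⟩ := ih ha0
    by_cases hps : p ∣ s
    · obtain ⟨t, rfl⟩ := hps
      refine ⟨t, p * m, hs.squarefree_of_dvd (dvd_mul_left _ _), ?_⟩
      rw [mul_pow, pow_two p]
      simp only [mul_assoc, mul_left_comm]
    · refine ⟨p * s, m, ?_, by rw [mul_assoc]⟩
      rw [squarefree_mul_iff]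
      exact ⟨(hp.irreducible.isRelPrime_iff_not_dvd).mpr hps, hp.squarefree, hs⟩

open NumberField in
/-- Every square class of a number field contains an algebraic integer all of whose conjugates
have about the same size, with nearly squarefree ideal. -/
theorem exists_balanced (k : Type*) [Field k] [NumberField k] :
    ∃ C : ℝ, 1 ≤ C ∧ ∀ d₀ : k, d₀ ≠ 0 → ∃ (u : k) (d : 𝓞 k) (s c : Ideal (𝓞 k)),
      u ≠ 0 ∧ (d : k) = d₀ * u ^ 2 ∧ Squarefree s ∧ Ideal.span {d} = s * c ^ 2 ∧
      (Ideal.absNorm c : ℝ) ≤ C ∧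
      (∀ φ : k →+* ℂ, ‖φ (d : k)‖ ^ Module.finrank ℚ k ≤ C * Ideal.absNorm s) ∧
      (∀ φ : k →+* ℂ, Ideal.absNorm s ≤ C * ‖φ (d : k)‖ ^ Module.finrank ℚ k) := by
  set n := Module.finrank ℚ k with hn
  have hn0 : 0 < n := Module.finrank_pos
  set D : ℝ := |(NumberField.discr k : ℝ)| with hD
  have hD1 : 1 ≤ D := by
    rw [hD, ← Int.cast_abs]
    exact_mod_cast Int.one_le_abs (NumberField.discr_ne_zero k)
  set C₁ : ℝ := 4 ^ n * (4 * D) with hC₁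
  have hC₁1 : 1 ≤ C₁ := by
    have : (1 : ℝ) ≤ 4 ^ n := one_le_pow₀ (by norm_num)
    nlinarith
  refine ⟨C₁ ^ n, one_le_pow₀ hC₁1, ?_⟩
  -- reduction to integral elements
  suffices H : ∀ d₀ : 𝓞 k, d₀ ≠ 0 → ∃ (u : k) (d : 𝓞 k) (s c : Ideal (𝓞 k)),
      u ≠ 0 ∧ (d : k) = d₀ * u ^ 2 ∧ Squarefree s ∧ Ideal.span {d} = s * c ^ 2 ∧
      (Ideal.absNorm c : ℝ) ≤ C₁ ^ n ∧
      (∀ φ : k →+* ℂ, ‖φ (d : k)‖ ^ n ≤ C₁ ^ n * Ideal.absNorm s) ∧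
      (∀ φ : k →+* ℂ, Ideal.absNorm s ≤ C₁ ^ n * ‖φ (d : k)‖ ^ n) by
    intro d₀ hd₀
    obtain ⟨a, b, hb, rfl⟩ := IsFractionRing.div_surjective (A := 𝓞 k) d₀
    have hb0 : b ≠ 0 := nonZeroDivisors.ne_zero hb
    have hb0' : (algebraMap (𝓞 k) k b) ≠ 0 := by simpa using hb0
    have ha0 : a ≠ 0 := by rintro rfl; simp at hd₀
    obtain ⟨u, d, s, c, hu, hd, h⟩ := H (a * b) (mul_ne_zero ha0 hb0)
    refine ⟨algebraMap (𝓞 k) k b * u, d, s, c, mul_ne_zero hb0' hu, ?_, h⟩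
    rw [hd, RingOfIntegers.coe_eq_algebraMap, map_mul]
    field_simp
  intro d₀ hd₀
  have hd₀' : (d₀ : k) ≠ 0 := by simpa using hd₀
  obtain ⟨s, m, hs, hsm⟩ := exists_squarefree_mul_sq (Ideal.span {d₀})
    (by simpa using hd₀)
  have hm0 : m ≠ 0 := by
    rintro rfl
    apply hd₀
    simpa using hsm
  set S : ℝ := (Ideal.absNorm s : ℝ) with hS
  have hS1 : 1 ≤ S := by
    rw [hS]
    exact_mod_cast Nat.one_le_iff_ne_zero.mpr (by
      rw [Ne, Ideal.absNorm_eq_zero_iff]; exact hs.ne_zero)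
  set N : ℝ := (Ideal.absNorm m : ℝ) with hN
  have hN1 : 1 ≤ N := by
    rw [hN]
    exact_mod_cast Nat.one_le_iff_ne_zero.mpr (by
      rw [Ne, Ideal.absNorm_eq_zero_iff]; exact hm0)
  have hnorm : |(Algebra.norm ℚ (d₀ : k) : ℝ)| = S * N ^ 2 := by
    rw [← prod_norm_embeddings, prod_norm_embeddings_int, hsm, map_mul, map_pow]
    push_cast; rfl
  set T : ℝ := (Real.sqrt (4 * D * S)) ^ ((n : ℝ)⁻¹) with hT
  have hT0 : 0 ≤ T := by positivity
  have hTn : T ^ n = Real.sqrt (4 * D * S) :=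
    Real.rpow_inv_natCast_pow (Real.sqrt_nonneg _) hn0.ne'
  let f : InfinitePlace k → NNReal := fun w => ⟨T / Real.sqrt (w d₀), by positivity⟩
  have hf : ∏ w, (f w : ℝ) ^ w.mult = Real.sqrt (4 * D) / N := by
    have h1 : ∀ w : InfinitePlace k, (f w : ℝ) ^ w.mult
        = T ^ w.mult / Real.sqrt ((w d₀) ^ w.mult) := by
      intro w
      change (T / Real.sqrt (w d₀)) ^ w.mult = _
      rw [div_pow]
      congr 1
      induction w.mult with
      | zero => simp
      | succ m ih => rw [pow_succ, pow_succ, Real.sqrt_mul (by positivity), ih]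
    rw [Finset.prod_congr rfl fun w _ => h1 w, Finset.prod_div_distrib,
      Finset.prod_pow_eq_pow_sum, InfinitePlace.sum_mult_eq, ← hn, hTn,
      ← Real.sqrt_prod _ (fun w _ => by positivity), InfinitePlace.prod_eq_abs_norm,
      Rat.cast_abs, hnorm, Real.sqrt_mul (by positivity) S, Real.sqrt_mul (by positivity) (N ^ 2),
      Real.sqrt_sq (by positivity)]
    have : Real.sqrt S ≠ 0 := (Real.sqrt_pos.mpr (by linarith)).ne'
    field_simp
  have hmF : (m : FractionalIdeal (nonZeroDivisors (𝓞 k)) k) ≠ 0 := by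
    simpa using hm0
  obtain ⟨u, hu0, hu, huf⟩ := exists_ne_zero_mem_lt_of_lt_prod
    (Units.mk0 (m : FractionalIdeal (nonZeroDivisors (𝓞 k)) k)⁻¹ (inv_ne_zero hmF)) f (by
      rw [hf, Units.val_mk0, map_inv₀, FractionalIdeal.coeIdeal_absNorm]
      push_cast
      rw [inv_mul_eq_div]
      gcongr
      linarith)
  rw [Units.val_mk0] at hu
  -- the ideal of `u` is the quotient of an integral ideal by `m`
  obtain ⟨c, hc⟩ : ∃ c : Ideal (𝓞 k), (c : FractionalIdeal (nonZeroDivisors (𝓞 k)) k)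
      = FractionalIdeal.spanSingleton _ u *
        (m : FractionalIdeal (nonZeroDivisors (𝓞 k)) k) := by
    apply FractionalIdeal.le_one_iff_exists_coeIdeal.mp
    calc _ ≤ (m : FractionalIdeal (nonZeroDivisors (𝓞 k)) k)⁻¹ * m :=
          mul_le_mul_left (FractionalIdeal.spanSingleton_le_iff_mem.mpr hu) _
      _ = 1 := inv_mul_cancel₀ hmF
  have hdfrac : FractionalIdeal.spanSingleton (nonZeroDivisors (𝓞 k)) ((d₀ : k) * u ^ 2)
      = ((s * c ^ 2 : Ideal (𝓞 k)) : FractionalIdeal (nonZeroDivisors (𝓞 k)) k) := by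
    rw [← FractionalIdeal.spanSingleton_mul_spanSingleton, ← FractionalIdeal.spanSingleton_pow,
      ← FractionalIdeal.coeIdeal_span_singleton, hsm]
    simp only [FractionalIdeal.coeIdeal_mul, FractionalIdeal.coeIdeal_pow, hc]
    ring
  obtain ⟨d, hd⟩ : ∃ d : 𝓞 k, (d : k) = d₀ * u ^ 2 := by
    have h1 : (d₀ : k) * u ^ 2 ∈ (1 : FractionalIdeal (nonZeroDivisors (𝓞 k)) k) := by
      rw [← FractionalIdeal.spanSingleton_le_iff_mem, hdfrac]
      exact FractionalIdeal.coeIdeal_le_one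
    obtain ⟨d, hd⟩ := (FractionalIdeal.mem_one_iff _).mp h1
    exact ⟨d, hd⟩
  have hdid : Ideal.span {d} = s * c ^ 2 := by
    rw [← FractionalIdeal.coeIdeal_inj (K := k), ← hdfrac, FractionalIdeal.coeIdeal_span_singleton]
    exact congrArg _ hd
  have hd0 : d ≠ 0 := by
    rintro rfl
    have : (d₀ : k) * u ^ 2 ≠ 0 := by positivity
    exact this (by rw [← hd]; simp)
  have hup : ∀ φ : k →+* ℂ, ‖φ (d : k)‖ ^ n ≤ C₁ * S := by
    intro φ
    have h1 : ‖φ (d : k)‖ ≤ 4 * T ^ 2 := by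
      have h2 := huf (InfinitePlace.mk φ)
      rw [InfinitePlace.apply] at h2
      have h3 : (f (InfinitePlace.mk φ) : ℝ) = T / Real.sqrt (‖φ d₀‖) := rfl
      have h4 : 0 < ‖φ (d₀ : k)‖ := norm_pos_iff.mpr (by simpa using hd₀)
      rw [h3] at h2
      rw [hd, map_mul, map_pow, norm_mul, norm_pow]
      calc ‖φ (d₀ : k)‖ * ‖φ u‖ ^ 2 ≤ ‖φ (d₀ : k)‖ * (2 * (T / Real.sqrt (‖φ d₀‖))) ^ 2 := by
            gcongr
        _ = 4 * T ^ 2 := by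
          rw [mul_pow, div_pow, Real.sq_sqrt h4.le]
          field_simp
          ring
    calc ‖φ (d : k)‖ ^ n ≤ (4 * T ^ 2) ^ n := by gcongr
      _ = 4 ^ n * (T ^ n) ^ 2 := by rw [mul_pow, ← pow_mul, ← pow_mul, mul_comm 2 n]
      _ = C₁ * S := by rw [hTn, Real.sq_sqrt (by positivity), hC₁]; ring
  have hdn : ∏ φ : k →+* ℂ, ‖φ (d : k)‖ = S * (Ideal.absNorm c : ℝ) ^ 2 := by
    rw [prod_norm_embeddings_int, hdid, map_mul, map_pow]
    push_cast; rfl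
  have hc0 : c ≠ 0 := by
    rintro rfl
    exact hd0 (by simpa using hdid)
  have hc1 : (1 : ℝ) ≤ Ideal.absNorm c := by
    exact_mod_cast Nat.one_le_iff_ne_zero.mpr (by rwa [Ne, Ideal.absNorm_eq_zero_iff])
  have hcard : Fintype.card (k →+* ℂ) = n := NumberField.Embeddings.card k ℂ
  refine ⟨u, d, s, c, hu0, hd, hs, hdid, ?_, ?_, ?_⟩
  · have h1 : (S * (Ideal.absNorm c : ℝ) ^ 2) ^ n ≤ (C₁ * S) ^ n := by
      rw [← hdn, ← Finset.prod_pow]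
      calc _ ≤ ∏ φ : k →+* ℂ, C₁ * S :=
            Finset.prod_le_prod (fun _ _ => by positivity) (fun φ _ => hup φ)
        _ = _ := by rw [Finset.prod_const, Finset.card_univ, hcard]
    have h2 := le_of_pow_le_pow_left₀ hn0.ne' (by positivity) h1
    have h3 : (Ideal.absNorm c : ℝ) ^ 2 ≤ C₁ := by nlinarith
    calc (Ideal.absNorm c : ℝ) ≤ (Ideal.absNorm c : ℝ) ^ 2 := by nlinarith
      _ ≤ C₁ := h3
      _ ≤ C₁ ^ n := le_self_pow₀ hC₁1 hn0.ne'
  · intro φ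
    refine (hup φ).trans ?_
    gcongr
    exact le_self_pow₀ hC₁1 hn0.ne'
  · intro φ
    have h1 : S ^ n ≤ ‖φ (d : k)‖ ^ n * (C₁ * S) ^ (n - 1) := by
      calc S ^ n ≤ (S * (Ideal.absNorm c : ℝ) ^ 2) ^ n := by
            gcongr
            have : 1 ≤ (Ideal.absNorm c : ℝ) ^ 2 := one_le_pow₀ hc1
            nlinarith
        _ = ∏ φ : k →+* ℂ, ‖φ (d : k)‖ ^ n := by rw [← hdn, Finset.prod_pow]
        _ = ‖φ (d : k)‖ ^ n * ∏ ψ ∈ Finset.univ.erase φ, ‖ψ (d : k)‖ ^ n :=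
            (Finset.mul_prod_erase _ _ (Finset.mem_univ φ)).symm
        _ ≤ ‖φ (d : k)‖ ^ n * ∏ ψ ∈ Finset.univ.erase φ, (C₁ * S) := by
            gcongr with ψ _
            exact hup ψ
        _ = _ := by
            rw [Finset.prod_const, Finset.card_erase_of_mem (Finset.mem_univ _),
              Finset.card_univ, hcard]
    have h2 : S ^ n = S * S ^ (n - 1) := by
      rw [← pow_succ', Nat.sub_add_cancel hn0]
    rw [h2, mul_pow, ← mul_assoc] at h1
    have h3 := le_of_mul_le_mul_right h1 (by positivity)
    calc S ≤ ‖φ (d : k)‖ ^ n * C₁ ^ (n - 1) := h3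
      _ ≤ ‖φ (d : k)‖ ^ n * C₁ ^ n := by
        gcongr
        exact Nat.sub_le n 1
      _ = _ := mul_comm _ _

open Polynomial in
theorem aeval_derivative_mem_differentIdeal_of_aeval_eq_zero {k E : Type*} [Field k]
    [NumberField k] [Field E] [NumberField E] [Algebra k E] (x : 𝓞 E)
    (hx : Algebra.adjoin k {(x : E)} = ⊤) (f : (𝓞 k)[X]) (hf : aeval x f = 0) :
    aeval x (derivative f) ∈ differentIdeal (𝓞 k) (𝓞 E) := by
  obtain ⟨g, rfl⟩ := (minpoly.isIntegrallyClosed_dvd_iff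
    (Algebra.IsIntegral.isIntegral (R := 𝓞 k) x) f).mp hf
  rw [derivative_mul, map_add, map_mul, map_mul, minpoly.aeval, zero_mul, add_zero]
  exact Ideal.mul_mem_right _ _ (aeval_derivative_mem_differentIdeal (𝓞 k) k E x hx)

theorem adjoin_singleton_eq_top_of_finrank_two {k E : Type*} [Field k] [Field E] [Algebra k E]
    (h2 : Module.finrank k E = 2) (r : E) (hr : r ∉ Set.range (algebraMap k E)) :
    Algebra.adjoin k {r} = ⊤ := by
  have : FiniteDimensional k E := Module.finite_of_finrank_pos (by omega)
  have hintegral : IsIntegral k r := Algebra.IsIntegral.isIntegral r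
  have h1 : Module.finrank k (IntermediateField.adjoin k {r}) ∣ 2 := by
    rw [← h2]
    exact ⟨_, (Module.finrank_mul_finrank k (IntermediateField.adjoin k {r}) E).symm⟩
  rcases (Nat.dvd_prime Nat.prime_two).mp h1 with h | h
  · rw [IntermediateField.finrank_adjoin_simple_eq_one_iff] at h
    exact absurd (IntermediateField.mem_bot.mp h) hr
  · have : IntermediateField.adjoin k {r} = ⊤ :=
      IntermediateField.eq_of_le_of_finrank_eq le_top
        (by rw [h, IntermediateField.finrank_top', h2])
    rw [← IntermediateField.adjoin_simple_toSubalgebra_of_isAlgebraic hintegral.isAlgebraic, this,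
      IntermediateField.top_toSubalgebra]

theorem discr_le_of_sq_eq {k E : Type*} [Field k] [NumberField k] [Field E] [NumberField E]
    [Algebra k E] (h2 : Module.finrank k E = 2) (r : 𝓞 E) (d : 𝓞 k)
    (hr : r ^ 2 = algebraMap (𝓞 k) (𝓞 E) d) (hr' : (r : E) ∉ Set.range (algebraMap k E)) :
    (NumberField.discr E).natAbs ≤ 4 ^ Module.finrank ℚ k * Ideal.absNorm (Ideal.span {d}) *
      (NumberField.discr k).natAbs ^ 2 := by
  have hr0 : r ≠ 0 := by
    rintro rfl
    exact hr' ⟨0, by simp⟩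
  rw [NumberField.natAbs_discr_eq_absNorm_differentIdeal_mul_natAbs_discr_pow k (𝓞 k) E (𝓞 E), h2]
  refine Nat.mul_le_mul_right _ ?_
  have hm : (2 * r : 𝓞 E) ∈ differentIdeal (𝓞 k) (𝓞 E) := by
    have := aeval_derivative_mem_differentIdeal_of_aeval_eq_zero r
      (adjoin_singleton_eq_top_of_finrank_two h2 _ hr') (Polynomial.X ^ 2 - Polynomial.C d)
      (by simp [hr])
    simpa [one_add_one_eq_two, map_ofNat (algebraMap (𝓞 k) (𝓞 E)) 2] using this
  have h4 : Ideal.absNorm (Ideal.span {(2 * r : 𝓞 E)}) =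
      4 ^ Module.finrank ℚ k * Ideal.absNorm (Ideal.span {d}) := by
    have e1 : Ideal.absNorm (Ideal.span {(2 * r : 𝓞 E)}) ^ 2 =
        Ideal.absNorm (Ideal.map (algebraMap (𝓞 k) (𝓞 E)) (Ideal.span {4 * d})) := by
      rw [Ideal.map_span, Set.image_singleton, map_mul, ← hr, ← map_pow,
        Ideal.span_singleton_pow, mul_pow, map_ofNat]
      norm_num
    rw [Ideal.absNorm_algebraMap, ← IsFractionRing.finrank_eq (𝓞 k) k (𝓞 E) E, h2] at e1
    rw [(Nat.pow_left_injective (n := 2) two_ne_zero e1 : _ = _),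
      ← Ideal.span_singleton_mul_span_singleton, map_mul]
    congr 1
    have := Ideal.absNorm_span_natCast (S := 𝓞 k) 4
    rwa [NumberField.RingOfIntegers.rank] at this
  rw [← h4]
  have hne : (differentIdeal (𝓞 k) (𝓞 E)) ∣ Ideal.span {(2 * r : 𝓞 E)} := by
    rw [Ideal.dvd_iff_le, Ideal.span_singleton_le_iff_mem]
    exact hm
  exact Nat.le_of_dvd (Nat.pos_of_ne_zero (by
    rw [Ne, Ideal.absNorm_eq_zero_iff, Ideal.span_singleton_eq_bot]
    exact mul_ne_zero two_ne_zero hr0)) (map_dvd Ideal.absNorm hne)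

/-- The weight attached to `γ` by the condition `z ^ 3 / γ` integral. -/
def cubeWt {E : Type*} [Field E] (γ : E) (ψ : E →+* ℂ) : ℝ := ‖ψ γ‖ ^ ((1 : ℝ) / 3)

section cubeWt

variable {E : Type*} [Field E] {γ : E}

theorem cubeWt_pos (hγ : γ ≠ 0) (ψ : E →+* ℂ) : 0 < cubeWt γ ψ :=
  Real.rpow_pos_of_pos (norm_pos_iff.mpr ((map_ne_zero ψ).mpr hγ)) _

theorem cubeWt_pow_three (ψ : E →+* ℂ) : cubeWt γ ψ ^ 3 = ‖ψ γ‖ := by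
  rw [cubeWt, ← Real.rpow_natCast, ← Real.rpow_mul (norm_nonneg _)]
  norm_num

theorem cubeWt_conjugate (ψ : E →+* ℂ) :
    cubeWt γ (NumberField.ComplexEmbedding.conjugate ψ) = cubeWt γ ψ := by
  simp [cubeWt, NumberField.ComplexEmbedding.conjugate_coe_eq]

theorem prod_infinitePlace_cubeWt [NumberField E] (hN : |Algebra.norm ℚ γ| = 1) :
    ∏ w : NumberField.InfinitePlace E, (cubeWt γ w.embedding) ^ w.mult = 1 := by
  have h1 : (∏ w : NumberField.InfinitePlace E, (cubeWt γ w.embedding) ^ w.mult) ^ 3 = 1 := by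
    rw [← Finset.prod_pow]
    simp_rw [pow_right_comm _ _ 3, cubeWt_pow_three, NumberField.InfinitePlace.norm_embedding_eq]
    rw [NumberField.InfinitePlace.prod_eq_abs_norm, hN, Rat.cast_one]
  exact (pow_eq_one_iff_of_nonneg (Finset.prod_nonneg fun w _ =>
    pow_nonneg (Real.rpow_nonneg (norm_nonneg _) _) _) three_ne_zero).mp h1

end cubeWt

section ideal

variable {E : Type*} [Field E] [NumberField E] {γ : E}
  {I : FractionalIdeal (nonZeroDivisors (𝓞 E)) E}

open FractionalIdeal

theorem mul_mul_eq_mul_integer (hI : spanSingleton (nonZeroDivisors (𝓞 E)) γ = I ^ 3) {x y z : E}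
    (hx : x ∈ I) (hy : y ∈ I) (hz : z ∈ I) : ∃ t : 𝓞 E, x * y * z = γ * t := by
  have : x * y * z ∈ spanSingleton (nonZeroDivisors (𝓞 E)) γ := by
    rw [hI, pow_succ, pow_two]
    exact mul_mem_mul (mul_mem_mul hx hy) hz
  obtain ⟨t, ht⟩ := (mem_spanSingleton _).mp this
  exact ⟨t, by rw [← ht, Algebra.smul_def, mul_comm]⟩

theorem one_le_of_mem_of_norm_le (hI : spanSingleton (nonZeroDivisors (𝓞 E)) γ = I ^ 3)
    (hγ : γ ≠ 0) {z : E} (hz : z ∈ I) (hz0 : z ≠ 0) {T : ℝ}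
    (hT : ∀ ψ : E →+* ℂ, ‖ψ z‖ ≤ T * cubeWt γ ψ) : 1 ≤ T := by
  obtain ⟨t, ht⟩ := mul_mul_eq_mul_integer hI hz hz hz
  have ht0 : t ≠ 0 := by
    rintro rfl
    apply mul_ne_zero (mul_ne_zero hz0 hz0) hz0
    simpa using ht
  have hb : ∀ ψ : E →+* ℂ, ‖ψ t‖ ≤ T ^ 3 := by
    intro ψ
    have h1 : ‖ψ z‖ ^ 3 = ‖ψ γ‖ * ‖ψ t‖ := by
      rw [← norm_mul, ← map_mul, ← ht, map_mul, map_mul, norm_mul, norm_mul]; ring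
    have h2 := pow_le_pow_left₀ (norm_nonneg _) (hT ψ) 3
    rw [h1, mul_pow, cubeWt_pow_three, mul_comm (T ^ 3)] at h2
    exact le_of_mul_le_mul_left h2 (norm_pos_iff.mpr ((map_ne_zero ψ).mpr hγ))
  have h3 : (1 : ℝ) ≤ ∏ ψ : E →+* ℂ, ‖ψ t‖ := by
    rw [prod_norm_embeddings_int]
    exact_mod_cast Nat.one_le_iff_ne_zero.mpr (by
      rw [Ne, Ideal.absNorm_eq_zero_iff, Ideal.span_singleton_eq_bot]; exact ht0)
  have h4 : (1 : ℝ) ≤ (T ^ 3) ^ Fintype.card (E →+* ℂ) := by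
    refine h3.trans ((Finset.prod_le_prod (fun _ _ => norm_nonneg _) fun ψ _ => hb ψ).trans ?_)
    simp
  have hne : Fintype.card (E →+* ℂ) ≠ 0 := by
    rw [NumberField.Embeddings.card E ℂ]; exact Module.finrank_pos.ne'
  obtain ⟨ψ⟩ : Nonempty (E →+* ℂ) := inferInstance
  have hT3 : 0 ≤ T ^ 3 := (norm_nonneg _).trans (hb ψ)
  rw [one_le_pow_iff_of_nonneg hT3 hne] at h4
  by_contra! hlt
  rcases le_or_gt 0 T with h0 | h0
  · exact absurd h4 (not_le.mpr (pow_lt_one₀ h0 hlt three_ne_zero))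
  · have : T ^ 3 < 0 := Odd.pow_neg (by decide) h0
    linarith

theorem absNorm_eq_one_of_pow_three (hI : spanSingleton (nonZeroDivisors (𝓞 E)) γ = I ^ 3)
    (hN : |Algebra.norm ℚ γ| = 1) : absNorm I = 1 := by
  have h := congrArg absNorm hI
  rw [absNorm_span_singleton, map_pow, hN] at h
  exact (pow_eq_one_iff_of_nonneg (absNorm_nonneg _) three_ne_zero).mp h.symm

end ideal

/-- Two short vectors in the lattice of a cube root of a principal ideal of norm one, the second
one outside of the line over the base field spanned by the first one. -/
theorem exists_two_short {k E : Type*} [Field k] [NumberField k] [Field E] [NumberField E]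
    [Algebra k E] (h2 : Module.finrank k E = 2) {γ : E} (hγ : γ ≠ 0)
    (hN : |Algebra.norm ℚ γ| = 1) (I : (FractionalIdeal (nonZeroDivisors (𝓞 E)) E)ˣ)
    (hI : FractionalIdeal.spanSingleton (nonZeroDivisors (𝓞 E)) γ = I.1 ^ 3)
    (r : 𝓞 E) (hr : (r : E) ∉ Set.range (algebraMap k E)) :
    ∃ (i j : ℕ) (ω θ : E), i ≤ j ∧ ω ∈ I.1 ∧ ω ≠ 0 ∧ (∀ ψ : E →+* ℂ, ‖ψ ω‖ ≤ 2 ^ i * cubeWt γ ψ) ∧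
      θ ∈ I.1 ∧ (∀ x : k, θ ≠ algebraMap k E x * ω) ∧
      (∀ ψ : E →+* ℂ, ‖ψ θ‖ ≤ 2 ^ j * cubeWt γ ψ) ∧
      ((2 : ℝ) ^ (i + j)) ^ Module.finrank ℚ k ≤
        (2048 * (2 * Module.finrank ℚ k + 1)) ^ Module.finrank ℚ k *
          Real.sqrt |(NumberField.discr E : ℝ)| := by
  set n := Module.finrank ℚ k with hn
  have hcard : Fintype.card (E →+* ℂ) = 2 * n := by
    rw [NumberField.Embeddings.card E ℂ, ← Module.finrank_mul_finrank ℚ k E, h2, mul_comm]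
  have hbig : ∀ z : E, ∃ m : ℕ, ∀ ψ : E →+* ℂ, ‖ψ z‖ ≤ 2 ^ m * cubeWt γ ψ := by
    intro z
    have h1 : ∀ ψ : E →+* ℂ, ∃ m : ℕ, ‖ψ z‖ ≤ 2 ^ m * cubeWt γ ψ := fun ψ => by
      obtain ⟨m, hm⟩ := pow_unbounded_of_one_lt (‖ψ z‖ / cubeWt γ ψ) one_lt_two
      exact ⟨m, by rw [div_lt_iff₀ (cubeWt_pos hγ ψ)] at hm; exact hm.le⟩
    choose m hm using h1
    refine ⟨∑ ψ, m ψ, fun ψ => (hm ψ).trans ?_⟩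
    have := (cubeWt_pos hγ ψ).le
    gcongr
    · norm_num
    · exact Finset.single_le_sum (f := m) (fun _ _ => Nat.zero_le _) (Finset.mem_univ ψ)
  obtain ⟨ω₀, hω₀, hω₀0⟩ : ∃ ω₀ ∈ I.1, ω₀ ≠ 0 := by
    by_contra! hc
    apply I.ne_zero
    rw [FractionalIdeal.eq_zero_iff]
    exact hc
  have hi : ∃ i : ℕ, ∃ ω ∈ I.1, ω ≠ 0 ∧ ∀ ψ : E →+* ℂ, ‖ψ ω‖ ≤ 2 ^ i * cubeWt γ ψ := by
    obtain ⟨m, hm⟩ := hbig ω₀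
    exact ⟨m, ω₀, hω₀, hω₀0, hm⟩
  obtain ⟨ω, hω, hω0, hωb⟩ := Nat.find_spec hi
  have himin : ∀ z ∈ I.1, z ≠ 0 → ∀ T : ℝ, (∀ ψ : E →+* ℂ, ‖ψ z‖ ≤ T * cubeWt γ ψ) →
      2 ^ Nat.find hi / 2 ≤ T := by
    intro z hz hz0 T hT
    have h1 := one_le_of_mem_of_norm_le hI hγ hz hz0 hT
    rcases Nat.eq_zero_or_pos (Nat.find hi) with h0 | h0
    · rw [h0]; linarith
    · by_contra! hlt
      refine Nat.find_min hi (m := Nat.find hi - 1) (by omega) ⟨z, hz, hz0, fun ψ =>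
        (hT ψ).trans ?_⟩
      have := (cubeWt_pos hγ ψ).le
      gcongr
      rw [← Nat.sub_add_cancel h0, pow_succ] at hlt
      simpa using hlt.le
  set i := Nat.find hi with hidef
  have hj : ∃ j : ℕ, i ≤ j ∧ ∃ θ ∈ I.1, (∀ x : k, θ ≠ algebraMap k E x * ω) ∧
      ∀ ψ : E →+* ℂ, ‖ψ θ‖ ≤ 2 ^ j * cubeWt γ ψ := by
    obtain ⟨m, hm⟩ := hbig (r * ω)
    refine ⟨max i m, le_max_left _ _, r * ω, ?_, fun x hx => hr ⟨x, ?_⟩, fun ψ =>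
      (hm ψ).trans ?_⟩
    · have := Submodule.smul_mem (I.1 : Submodule (𝓞 E) E) r hω
      rwa [Algebra.smul_def] at this
    · exact (mul_right_cancel₀ hω0 hx).symm
    · have := (cubeWt_pos hγ ψ).le
      gcongr
      · norm_num
      · exact le_max_right _ _
  obtain ⟨hij, θ, hθ, hθω, hθb⟩ := Nat.find_spec hj
  have hjmin : ∀ z ∈ I.1, (∀ ψ : E →+* ℂ, ‖ψ z‖ ≤ 2 ^ Nat.find hj / 4 * cubeWt γ ψ) →
      ∃ x : k, z = algebraMap k E x * ω := by
    intro z hz hT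
    by_contra! hc
    rcases hij.eq_or_lt with h0 | h0
    · have hz0 : z ≠ 0 := fun h => hc 0 (by simp [h])
      have := himin z hz hz0 _ hT
      rw [← h0] at this
      have : (0 : ℝ) < 2 ^ i := by positivity
      linarith
    · refine Nat.find_min hj (m := Nat.find hj - 1) (by omega) ⟨by omega, z, hz, hc, fun ψ =>
        (hT ψ).trans ?_⟩
      have := (cubeWt_pos hγ ψ).le
      gcongr
      have h1 : (2 : ℝ) ^ Nat.find hj = 2 ^ (Nat.find hj - 1) * 2 := by
        rw [← pow_succ, Nat.sub_add_cancel (by omega)]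
      rw [h1]
      have : (0 : ℝ) < 2 ^ (Nat.find hj - 1) := by positivity
      linarith
  set j := Nat.find hj with hjdef
  refine ⟨i, j, ω, θ, hij, hω, hω0, hωb, hθ, hθω, hθb, ?_⟩
  -- the weight on the embeddings of `k`
  set G : (k →+* ℂ) → ℝ := fun φ =>
    ∑ ψ : E →+* ℂ with ψ.comp (algebraMap k E) = φ, ‖ψ ω‖ / cubeWt γ ψ with hG
  have hGt : ∀ ψ : E →+* ℂ, 0 < ‖ψ ω‖ / cubeWt γ ψ := fun ψ =>
    div_pos (norm_pos_iff.mpr ((map_ne_zero ψ).mpr hω0)) (cubeWt_pos hγ ψ)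
  have hGle : ∀ ψ : E →+* ℂ, ‖ψ ω‖ / cubeWt γ ψ ≤ G (ψ.comp (algebraMap k E)) := fun ψ =>
    Finset.single_le_sum (f := fun ψ : E →+* ℂ => ‖ψ ω‖ / cubeWt γ ψ)
      (fun ψ _ => (hGt ψ).le) (by simp)
  have hGpos : ∀ φ, 0 < G φ := by
    intro φ
    obtain ⟨ψ, hψ⟩ : ∃ ψ : E →+* ℂ, ψ.comp (algebraMap k E) = φ := by
      let _ := φ.toAlgebra
      exact ⟨(IsAlgClosed.lift : E →ₐ[k] ℂ).toRingHom, (IsAlgClosed.lift : E →ₐ[k] ℂ).comp_algebraMap⟩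
    rw [← hψ]
    exact (hGt ψ).trans_le (hGle ψ)
  have hGc : ∀ φ, G (NumberField.ComplexEmbedding.conjugate φ) = G φ := by
    intro φ
    refine Finset.sum_nbij' NumberField.ComplexEmbedding.conjugate
      NumberField.ComplexEmbedding.conjugate ?_ ?_ ?_ ?_ ?_
    · intro ψ hψ
      rw [Finset.mem_filter] at hψ ⊢
      refine ⟨Finset.mem_univ _, ?_⟩
      ext x
      have := congrArg star (RingHom.congr_fun hψ.2 x)
      simpa using this
    · intro ψ hψ
      rw [Finset.mem_filter] at hψ ⊢
      refine ⟨Finset.mem_univ _, ?_⟩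
      ext x
      have := congrArg star (RingHom.congr_fun hψ.2 x)
      simpa using this
    · intro ψ _; ext x; simp
    · intro ψ _; ext x; simp
    · intro ψ _
      rw [cubeWt_conjugate]
      simp
  have hB : ∀ S : Finset E, (∀ z ∈ S, z ∈ I.1 ∧ ∀ ψ : E →+* ℂ, ‖ψ z‖ ≤ 2 ^ j / 4 * cubeWt γ ψ) →
      (S.card : ℝ) ≤ (32 * (2 * n + 1) * 2 ^ (j - i)) ^ n := by
    intro S hS
    have hx : ∀ z : E, ∃ x : k, z ∈ S → z = algebraMap k E x * ω := fun z => by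
      by_cases hz : z ∈ S
      · obtain ⟨x, hx⟩ := hjmin z (hS z hz).1 (hS z hz).2
        exact ⟨x, fun _ => hx⟩
      · exact ⟨0, fun h => absurd h hz⟩
    choose X hX using hx
    have hXinj : Set.InjOn X S := fun z hz z' hz' h => by
      rw [hX z hz, hX z' hz', h]
    have h1 := card_le_of_separated (F := k) (fun φ => (G φ)⁻¹) (fun φ => inv_pos.mpr (hGpos φ))
      (fun φ => by rw [hGc]) (T := 2 * n * (2 ^ j / 4)) (l := 2 ^ i / 4) (by positivity)
      (by positivity) (S.image X) (by
        intro x hx φ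
        obtain ⟨z, hz, rfl⟩ := Finset.mem_image.mp hx
        rw [← div_eq_mul_inv, le_div_iff₀ (hGpos φ), hG]
        dsimp only
        rw [Finset.mul_sum]
        calc _ ≤ ∑ ψ : E →+* ℂ with ψ.comp (algebraMap k E) = φ, (2 : ℝ) ^ j / 4 := by
              refine Finset.sum_le_sum fun ψ hψ => ?_
              rw [← (Finset.mem_filter.mp hψ).2, ← mul_div_assoc, RingHom.comp_apply, ← norm_mul,
                ← map_mul, ← hX z hz, div_le_iff₀ (cubeWt_pos hγ ψ)]
              exact (hS z hz).2 ψ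
          _ ≤ ∑ ψ : E →+* ℂ, (2 : ℝ) ^ j / 4 :=
              Finset.sum_le_sum_of_subset_of_nonneg (Finset.filter_subset _ _)
                fun _ _ _ => by positivity
          _ = _ := by simp [hcard]) (by
        intro x hx y hy hxy
        obtain ⟨z, hz, rfl⟩ := Finset.mem_image.mp hx
        obtain ⟨z', hz', rfl⟩ := Finset.mem_image.mp hy
        have hzz : z - z' ∈ I.1 := Submodule.sub_mem (I.1 : Submodule (𝓞 E) E) (hS z hz).1 (hS z' hz').1
        have hne : z - z' ≠ 0 := sub_ne_zero.mpr fun h => hxy (by rw [h])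
        by_contra! hc
        have h3 := himin _ hzz hne (2 ^ i / 4) (by
          intro ψ
          have h4 := hc (ψ.comp (algebraMap k E))
          rw [← div_eq_mul_inv, lt_div_iff₀ (hGpos _)] at h4
          have h5 := (mul_le_mul_of_nonneg_left (hGle ψ) (norm_nonneg _)).trans h4.le
          rw [← mul_div_assoc, RingHom.comp_apply, ← norm_mul, ← map_mul, map_sub, sub_mul,
            ← hX z hz, ← hX z' hz', div_le_iff₀ (cubeWt_pos hγ ψ)] at h5
          exact h5)
        have : (0 : ℝ) < 2 ^ i := by positivity
        linarith)
    rw [Finset.card_image_of_injOn hXinj] at h1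
    refine h1.trans (pow_le_pow_left₀ (by positivity) ?_ _)
    have h6 : (2 : ℝ) ^ j = 2 ^ i * 2 ^ (j - i) := by rw [← pow_add, Nat.add_sub_cancel' hij]
    have h7 : 2 * (n : ℝ) * (2 ^ j / 4) / (2 ^ i / 4) = 2 * n * 2 ^ (j - i) := by
      rw [h6]; field_simp
    rw [h7]
    have : (1 : ℝ) ≤ 2 ^ (j - i) := one_le_pow₀ one_le_two
    nlinarith
  have hfin := prod_le_of_forall_card_le I
    (fun w => ⟨2 ^ j / 8 * cubeWt γ w.embedding, by
      have := (cubeWt_pos hγ w.embedding).le; positivity⟩)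
    ⌊(32 * (2 * n + 1) * 2 ^ (j - i) : ℝ) ^ n⌋₊ (by
      intro S hS
      refine Nat.le_floor (hB S fun z hz => ⟨(hS z hz).1, fun ψ => ?_⟩)
      have h1 := ((hS z hz).2 (NumberField.InfinitePlace.mk ψ)).le
      rw [NumberField.InfinitePlace.apply] at h1
      refine h1.trans (le_of_eq ?_)
      have h3 : cubeWt γ (NumberField.InfinitePlace.mk ψ).embedding = cubeWt γ ψ := by
        rw [cubeWt, cubeWt, NumberField.InfinitePlace.norm_embedding_eq,
          NumberField.InfinitePlace.apply]
      change 2 * (2 ^ j / 8 * cubeWt γ _) = _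
      rw [h3]; ring)
  rw [absNorm_eq_one_of_pow_three hI hN] at hfin
  have hl : ∏ w : NumberField.InfinitePlace E,
      ((2 : ℝ) ^ j / 8 * cubeWt γ w.embedding) ^ w.mult = (2 ^ j / 8) ^ (2 * n) := by
    simp_rw [mul_pow]
    rw [Finset.prod_mul_distrib, prod_infinitePlace_cubeWt hN, Finset.prod_pow_eq_pow_sum,
      NumberField.InfinitePlace.sum_mult_eq, mul_one, ← NumberField.Embeddings.card E ℂ, hcard]
  change ∏ w : NumberField.InfinitePlace E,
      ((2 : ℝ) ^ j / 8 * cubeWt γ w.embedding) ^ w.mult ≤ _ at hfin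
  rw [hl] at hfin
  have hfl : ((⌊(32 * (2 * n + 1) * 2 ^ (j - i) : ℝ) ^ n⌋₊ : ℕ) : ℝ) ≤
      (32 * (2 * n + 1) * 2 ^ (j - i) : ℝ) ^ n := Nat.floor_le (by positivity)
  have hfin2 : ((2 : ℝ) ^ j / 8) ^ (2 * n) ≤ (32 * (2 * n + 1) * 2 ^ (j - i) : ℝ) ^ n *
      Real.sqrt |(NumberField.discr E : ℝ)| := by
    refine hfin.trans ?_
    rw [Rat.cast_one, one_mul]
    gcongr
  have h6 : (2 : ℝ) ^ j = 2 ^ i * 2 ^ (j - i) := by rw [← pow_add, Nat.add_sub_cancel' hij]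
  have hp : (0 : ℝ) < (2 ^ (j - i)) ^ n := by positivity
  refine le_of_mul_le_mul_left ?_ hp
  calc ((2 : ℝ) ^ (j - i)) ^ n * (2 ^ (i + j)) ^ n = 64 ^ n * ((2 ^ j / 8) ^ (2 * n)) := by
        rw [pow_mul, ← mul_pow, ← mul_pow, pow_add, h6]
        congr 1; ring
    _ ≤ 64 ^ n * ((32 * (2 * n + 1) * 2 ^ (j - i) : ℝ) ^ n *
        Real.sqrt |(NumberField.discr E : ℝ)|) := by gcongr
    _ = _ := by
        rw [← mul_assoc, ← mul_assoc, ← mul_pow, ← mul_pow]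
        congr 2; ring

theorem exists_conj {k E : Type*} [Field k] [CharZero k] [Field E] [Algebra k E]
    (h2 : Module.finrank k E = 2) (r : E) (d : k) (hr : r ^ 2 = algebraMap k E d)
    (hr' : r ∉ Set.range (algebraMap k E)) :
    ∃ σ : E ≃ₐ[k] E, σ r = -r ∧ (∀ z, σ (σ z) = z) ∧
      ∀ z, σ z = z → z ∈ Set.range (algebraMap k E) := by
  have : FiniteDimensional k E := Module.finite_of_finrank_pos (by omega)
  have : Algebra.IsQuadraticExtension k E := ⟨h2⟩
  have : IsGalois k E := Algebra.IsQuadraticExtension.isGalois k E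
  obtain ⟨σ, hσ⟩ : ∃ σ : E ≃ₐ[k] E, σ r ≠ r := by
    by_contra! hc
    exact hr' ((IsGalois.mem_range_algebraMap_iff_fixed r).mpr hc)
  have hσr : σ r = -r := by
    have h1 : (σ r) ^ 2 = r ^ 2 := by rw [← map_pow, hr, AlgEquiv.commutes]
    exact (sq_eq_sq_iff_eq_or_eq_neg.mp h1).resolve_left hσ
  refine ⟨σ, hσr, fun z => ?_, fun z hz => ?_⟩
  · have : (σ.toAlgHom.comp σ.toAlgHom) = AlgHom.id k E := by
      refine AlgHom.ext_of_adjoin_eq_top (adjoin_singleton_eq_top_of_finrank_two h2 r hr') ?_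
      rintro _ rfl
      simp [hσr]
    exact AlgHom.congr_fun this z
  · by_contra hzr
    have : σ.toAlgHom = AlgHom.id k E := by
      refine AlgHom.ext_of_adjoin_eq_top (adjoin_singleton_eq_top_of_finrank_two h2 z hzr) ?_
      rintro _ rfl
      simpa using hz
    exact hσ (AlgHom.congr_fun this r)

/-- If `s` is squarefree and `b ^ 2 ∣ a ^ 2 * s`, then `b ∣ a`. -/
theorem dvd_of_sq_dvd_sq_mul_squarefree {R : Type*} [CommMonoidWithZero R]
    [UniqueFactorizationMonoid R] {s : R} (hs : Squarefree s) (b : R) (hb : b ≠ 0) :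
    ∀ a : R, b ^ 2 ∣ a ^ 2 * s → b ∣ a := by
  induction b using UniqueFactorizationMonoid.induction_on_prime with
  | h₁ => exact absurd rfl hb
  | h₂ x hx => exact fun a _ => hx.dvd
  | h₃ b p hb0 hp ih =>
    intro a h
    have hpa : p ∣ a := by
      by_contra hpa
      have h1 : p ^ 2 ∣ a ^ 2 * s := (pow_dvd_pow_of_dvd (dvd_mul_right p b) 2).trans h
      have h2 : ¬ p ∣ a ^ 2 := fun h => hpa (hp.dvd_of_dvd_pow h)
      have h3 : p ^ 2 ∣ s := hp.pow_dvd_of_dvd_mul_left 2 h2 h1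
      exact hp.not_isUnit (hs p (by rwa [← pow_two]))
    obtain ⟨a, rfl⟩ := hpa
    refine mul_dvd_mul_left p (ih hb0 a ?_)
    rw [mul_pow, mul_pow, mul_assoc] at h
    exact (mul_dvd_mul_iff_left (pow_ne_zero 2 hp.ne_zero)).mp h

/-- An element `v` with `v ^ 2 * d` integral becomes integral after multiplication by a bounded
integer. -/
theorem exists_integer_of_sq_mul {k : Type*} [Field k] [NumberField k] (d : 𝓞 k)
    (s c : Ideal (𝓞 k)) (hs : Squarefree s) (hd : Ideal.span {d} = s * c ^ 2) (M : ℕ)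
    (hM : Ideal.absNorm c ∣ M) (v : k) (hv : IsIntegral ℤ (v ^ 2 * d)) :
    ∃ a : 𝓞 k, (a : k) = M * v := by
  obtain ⟨N, rfl⟩ := hM
  have hMc : ((Ideal.absNorm c : ℕ) * N : 𝓞 k) ∈ c :=
    Ideal.mul_mem_right _ _ (Ideal.absNorm_mem c)
  set x : 𝓞 k := (Ideal.absNorm c : ℕ) * N with hx
  obtain ⟨a, b, hb, hab⟩ := IsFractionRing.div_surjective (A := 𝓞 k) ((x : k) * v)
  have hb0 : b ≠ 0 := nonZeroDivisors.ne_zero hb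
  have hb0' : algebraMap (𝓞 k) k b ≠ 0 := by simpa using hb0
  have key : Ideal.span {b} ^ 2 ∣ Ideal.span {a} ^ 2 * s := by
    rw [Ideal.dvd_iff_le, Ideal.span_singleton_pow, Ideal.span_singleton_pow]
    intro y hy
    obtain ⟨y, hys, rfl⟩ := Ideal.mem_span_singleton_mul.mp hy
    have h1 : x ^ 2 * y ∈ Ideal.span {d} := by
      rw [hd, mul_comm s]; exact Ideal.mul_mem_mul (Ideal.pow_mem_pow hMc 2) hys
    obtain ⟨z, hz⟩ := Ideal.mem_span_singleton.mp h1
    obtain ⟨w, hw⟩ : ∃ w : 𝓞 k, algebraMap (𝓞 k) k w = v ^ 2 * algebraMap (𝓞 k) k d :=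
      ⟨⟨_, hv⟩, rfl⟩
    rw [Ideal.mem_span_singleton]
    refine ⟨w * z, FaithfulSMul.algebraMap_injective (𝓞 k) k ?_⟩
    have hz' := congrArg (algebraMap (𝓞 k) k) hz
    rw [div_eq_iff hb0'] at hab
    have hab' : algebraMap (𝓞 k) k a = algebraMap (𝓞 k) k x * v * algebraMap (𝓞 k) k b := hab
    simp only [map_mul, map_pow] at hz' ⊢
    rw [hw, hab']
    linear_combination (v ^ 2 * (algebraMap (𝓞 k) k b) ^ 2) * hz'
  have h1 : Ideal.span {b} ∣ Ideal.span {a} :=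
    dvd_of_sq_dvd_sq_mul_squarefree hs _ (by simpa using hb0) _ key
  rw [Ideal.dvd_iff_le, Ideal.span_singleton_le_span_singleton] at h1
  obtain ⟨t, rfl⟩ := h1
  refine ⟨t, ?_⟩
  rw [map_mul, mul_div_cancel_left₀ _ hb0'] at hab
  rw [NumberField.RingOfIntegers.coe_eq_algebraMap, hab, hx]
  simp

section quadruple

variable {k E : Type*} [Field k] [NumberField k] [Field E] [NumberField E] [Algebra k E]
  (σ : E ≃ₐ[k] E)

theorem norm_le_of_eq_add_conj {a : k} {z : E} (ha : algebraMap k E a = z + σ z) {B : ℝ}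
    (hB : ∀ ψ : E →+* ℂ, ‖ψ z‖ ≤ B) (φ : k →+* ℂ) : ‖φ a‖ ≤ 2 * B := by
  obtain ⟨ψ, rfl⟩ : ∃ ψ : E →+* ℂ, ψ.comp (algebraMap k E) = φ := by
    let _ := φ.toAlgebra
    exact ⟨(IsAlgClosed.lift : E →ₐ[k] ℂ).toRingHom,
      (IsAlgClosed.lift : E →ₐ[k] ℂ).comp_algebraMap⟩
  rw [RingHom.comp_apply, ha, map_add, two_mul]
  exact (norm_add_le _ _).trans (add_le_add (hB ψ) (hB (ψ.comp σ.toAlgHom.toRingHom)))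

theorem exists_integer_eq_add_conj
    (r : 𝓞 E) (d : 𝓞 k) (hr : (r : E) ^ 2 = algebraMap k E d)
    (hr0 : (r : E) ≠ 0) (hσr : σ r = -r) (hσσ : ∀ z, σ (σ z) = z)
    (hσ : ∀ z, σ z = z → z ∈ Set.range (algebraMap k E))
    (s c : Ideal (𝓞 k)) (hs : Squarefree s) (hd : Ideal.span {d} = s * c ^ 2) (M : ℕ)
    (hM : Ideal.absNorm c ∣ M)
    (t : E) (ht : IsIntegral ℤ t) :
    ∃ a : 𝓞 k, algebraMap k E a = M * t / r + σ (M * t / r) := by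
  obtain ⟨v, hv⟩ := hσ ((t - σ t) / r) (by
    rw [map_div₀, map_sub, hσσ, hσr]
    field_simp
    ring)
  obtain ⟨a, ha⟩ := exists_integer_of_sq_mul d s c hs hd M hM v (by
    rw [← isIntegral_algebraMap_iff (FaithfulSMul.algebraMap_injective k E), map_mul, map_pow, hv,
      ← hr, ← mul_pow, div_mul_cancel₀ _ hr0]
    exact (ht.sub (map_isIntegral_int σ ht)).pow 2)
  refine ⟨a, ?_⟩
  rw [ha, map_mul, hv, map_div₀, map_mul, hσr]
  simp only [map_natCast]
  field_simp
  ring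

/-- The integral binary cubic form attached to a pair of elements of a fractional ideal `I` with
`I ^ 3 = (γ)`, for `γ` of relative norm one. -/
theorem exists_quadruple
    (r : 𝓞 E) (d : 𝓞 k) (hr : (r : E) ^ 2 = algebraMap k E d)
    (hr0 : (r : E) ≠ 0) (hσr : σ r = -r) (hσσ : ∀ z, σ (σ z) = z)
    (hσ : ∀ z, σ z = z → z ∈ Set.range (algebraMap k E))
    (s c : Ideal (𝓞 k)) (hs : Squarefree s) (hd : Ideal.span {d} = s * c ^ 2) (M : ℕ)
    (hM : Ideal.absNorm c ∣ M)
    (hM0 : M ≠ 0) {γ : E} (hγ : γ * σ γ = 1)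
    (hcube : ∀ z : E, γ ≠ z ^ 3) {I : FractionalIdeal (nonZeroDivisors (𝓞 E)) E}
    (hI : FractionalIdeal.spanSingleton (nonZeroDivisors (𝓞 E)) γ = I ^ 3) {ω θ : E}
    (hω : ω ∈ I) (hω0 : ω ≠ 0) (hθ : θ ∈ I) {A B R : ℝ} (hR0 : 0 < R)
    (hA : ∀ ψ : E →+* ℂ, ‖ψ ω‖ ≤ A * cubeWt γ ψ) (hB : ∀ ψ : E →+* ℂ, ‖ψ θ‖ ≤ B * cubeWt γ ψ)
    (hR : ∀ ψ : E →+* ℂ, R ≤ ‖ψ r‖) (β ρ : E) (hβ : β = M * ω ^ 3 / (γ * r)) (hρ : ρ = θ / ω) :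
    ∃ a b c' e : 𝓞 k, algebraMap k E a = β + σ β ∧ algebraMap k E b = β * ρ + σ (β * ρ) ∧
      algebraMap k E c' = β * ρ ^ 2 + σ (β * ρ ^ 2) ∧
      algebraMap k E e = β * ρ ^ 3 + σ (β * ρ ^ 3) ∧
      (∀ φ : k →+* ℂ, ‖φ a‖ ≤ 2 * (M * A ^ 3 / R)) ∧
      (∀ φ : k →+* ℂ, ‖φ b‖ ≤ 2 * (M * (A ^ 2 * B) / R)) ∧
      (∀ φ : k →+* ℂ, ‖φ c'‖ ≤ 2 * (M * (A * B ^ 2) / R)) ∧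
      (∀ φ : k →+* ℂ, ‖φ e‖ ≤ 2 * (M * B ^ 3 / R)) ∧ a ≠ 0 ∧
      ∀ p : Ideal (𝓞 k), p.IsPrime → s ≤ p → (M : 𝓞 k) ∉ p →
        a ^ 2 * e ^ 2 - 6 * a * b * c' * e + 4 * b ^ 3 * e + 4 * a * c' ^ 3
          - 3 * b ^ 2 * c' ^ 2 ∈ p := by
  have hγ0 : γ ≠ 0 := left_ne_zero_of_mul_eq_one hγ
  have hσγ : σ γ = γ⁻¹ := eq_inv_of_mul_eq_one_right hγ
  have hbd : ∀ {t x y z : E} {X Y Z : ℝ}, x * y * z = γ * t →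
      (∀ ψ : E →+* ℂ, ‖ψ x‖ ≤ X * cubeWt γ ψ) → (∀ ψ : E →+* ℂ, ‖ψ y‖ ≤ Y * cubeWt γ ψ) →
      (∀ ψ : E →+* ℂ, ‖ψ z‖ ≤ Z * cubeWt γ ψ) → ∀ ψ : E →+* ℂ,
      ‖ψ (M * t / r)‖ ≤ M * (X * Y * Z) / R := by
    intro t x y z X Y Z ht hX hY hZ ψ
    have hg := cubeWt_pos hγ0 ψ
    have hX0 : 0 ≤ X * cubeWt γ ψ := (norm_nonneg _).trans (hX ψ)
    have hY0 : 0 ≤ Y * cubeWt γ ψ := (norm_nonneg _).trans (hY ψ)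
    have h1 : ‖ψ γ‖ * ‖ψ t‖ ≤ ‖ψ γ‖ * (X * Y * Z) := by
      rw [← norm_mul, ← map_mul, ← ht, map_mul, map_mul, norm_mul, norm_mul,
        ← cubeWt_pow_three (γ := γ)]
      calc _ ≤ (X * cubeWt γ ψ) * (Y * cubeWt γ ψ) * (Z * cubeWt γ ψ) := by
            gcongr
            · exact hX ψ
            · exact hY ψ
            · exact hZ ψ
        _ = _ := by ring
    have h2 := le_of_mul_le_mul_left h1 (norm_pos_iff.mpr ((map_ne_zero ψ).mpr hγ0))
    rw [map_div₀, map_mul, norm_div, norm_mul, map_natCast, Complex.norm_natCast]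
    have h3 := (norm_nonneg _).trans h2
    gcongr
    exact hR ψ
  obtain ⟨t₀, ht₀⟩ := mul_mul_eq_mul_integer hI hω hω hω
  obtain ⟨t₁, ht₁⟩ := mul_mul_eq_mul_integer hI hω hω hθ
  obtain ⟨t₂, ht₂⟩ := mul_mul_eq_mul_integer hI hω hθ hθ
  obtain ⟨t₃, ht₃⟩ := mul_mul_eq_mul_integer hI hθ hθ hθ
  have hi := exists_integer_eq_add_conj σ r d hr hr0 hσr hσσ hσ s c hs hd M hM
  obtain ⟨a, ha⟩ := hi t₀ t₀.isIntegral_coe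
  obtain ⟨b, hb⟩ := hi t₁ t₁.isIntegral_coe
  obtain ⟨c', hc'⟩ := hi t₂ t₂.isIntegral_coe
  obtain ⟨e, he⟩ := hi t₃ t₃.isIntegral_coe
  have e₀ : β = M * t₀ / r := by
    rw [hβ, div_eq_div_iff (mul_ne_zero hγ0 hr0) hr0]
    linear_combination (M * r : E) * ht₀
  have e₁ : β * ρ = M * t₁ / r := by
    rw [hβ, hρ]; field_simp; linear_combination ht₁
  have e₂ : β * ρ ^ 2 = M * t₂ / r := by
    rw [hβ, hρ]; field_simp; linear_combination ht₂
  have e₃ : β * ρ ^ 3 = M * t₃ / r := by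
    rw [hβ, hρ]; field_simp; linear_combination ht₃
  have hd0 : algebraMap k E d ≠ 0 := by rw [← hr]; exact pow_ne_zero 2 hr0
  refine ⟨a, b, c', e, by rw [e₀, ha], by rw [e₁, hb], by rw [e₂, hc'], by rw [e₃, he],
    fun φ => ?_, fun φ => ?_, fun φ => ?_, fun φ => ?_, ?_, ?_⟩
  · refine (norm_le_of_eq_add_conj σ ha (hbd ht₀ hA hA hA) φ).trans_eq (by ring)
  · refine (norm_le_of_eq_add_conj σ hb (hbd ht₁ hA hA hB) φ).trans_eq (by ring)
  · refine (norm_le_of_eq_add_conj σ hc' (hbd ht₂ hA hB hB) φ).trans_eq (by ring)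
  · refine (norm_le_of_eq_add_conj σ he (hbd ht₃ hB hB hB) φ).trans_eq (by ring)
  · rintro rfl
    have hM' : (M : E) ≠ 0 := Nat.cast_ne_zero.mpr hM0
    have h1 : σ t₀ = t₀ := by
      have : (M : E) * t₀ / r + -(M * σ t₀ / r) = 0 := by
        have := ha.symm
        simpa [hσr, div_neg] using this
      field_simp at this
      apply mul_left_cancel₀ hM'
      linear_combination -this
    have h2 : (t₀ : E) * t₀ = (ω * σ ω) ^ 3 := by
      nth_rewrite 2 [← h1]
      have h3 := congrArg σ ht₀
      simp only [map_mul, hσγ] at h3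
      have h4 : σ t₀ = γ * (σ ω * σ ω * σ ω) := by rw [h3]; field_simp
      have h5 : (t₀ : E) = γ⁻¹ * (ω * ω * ω) := by rw [ht₀]; field_simp
      rw [h4, h5]
      field_simp
    have hN : ω * σ ω ≠ 0 := mul_ne_zero hω0 ((map_ne_zero σ).mpr hω0)
    have ht0 : (t₀ : E) ≠ 0 := by
      intro h
      rw [h, mul_zero] at ht₀
      exact mul_ne_zero (mul_ne_zero hω0 hω0) hω0 ht₀
    apply hcube (ω / (t₀ / (ω * σ ω)))
    rw [div_pow, div_pow, ← h2]
    field_simp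
    linear_combination -ht₀
  · intro p hp hsp hMp
    have hy : IsIntegral ℤ (θ * σ ω) := by
      refine IsIntegral.of_pow (n := 3) (by norm_num) ?_
      have : (θ * σ ω) ^ 3 = t₃ * σ t₀ := by
        have h3 := congrArg σ ht₀
        simp only [map_mul, hσγ] at h3
        have h4 : σ t₀ = γ * (σ ω * σ ω * σ ω) := by rw [h3]; field_simp
        rw [h4]
        linear_combination (σ ω) ^ 3 * ht₃
      rw [this]
      exact t₃.isIntegral_coe.mul (map_isIntegral_int σ t₀.isIntegral_coe)
    obtain ⟨v, hv⟩ := hi _ hy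
    set G := a ^ 2 * e ^ 2 - 6 * a * b * c' * e + 4 * b ^ 3 * e + 4 * a * c' ^ 3
          - 3 * b ^ 2 * c' ^ 2 with hG
    have hσω0 : σ ω ≠ 0 := (map_ne_zero σ).mpr hω0
    have hGv : (M : 𝓞 k) ^ 2 * G = d * v ^ 6 := by
      apply FaithfulSMul.algebraMap_injective (𝓞 k) k
      apply FaithfulSMul.algebraMap_injective k E
      have h1 : algebraMap k E (algebraMap (𝓞 k) k G) = (β * σ β) ^ 2 * (ρ - σ ρ) ^ 6 := by
        rw [hG]
        simp only [map_sub, map_add, map_mul, map_pow, map_ofNat]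
        rw [ha, hb, hc', he, ← e₀, ← e₁, ← e₂, ← e₃]
        simp only [map_mul, map_pow]
        ring
      have h2 : β * σ β * algebraMap k E d = -(M ^ 2 * (ω * σ ω) ^ 3) := by
        rw [hβ, ← hr]
        simp only [map_div₀, map_mul, map_pow, hσγ, hσr, map_natCast]
        field_simp
      have h3 : (ρ - σ ρ) * (ω * σ ω) = θ * σ ω - σ θ * ω := by
        rw [hρ, map_div₀]; field_simp
      have h4 : algebraMap k E v * r = M * (θ * σ ω - σ θ * ω) := by
        rw [hv]
        simp only [map_div₀, map_mul, hσr, map_natCast, hσσ]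
        field_simp
        ring
      simp only [map_mul, map_pow, map_natCast]
      rw [h1]
      apply mul_left_cancel₀ (pow_ne_zero 2 hd0)
      have h5 : (algebraMap k E v * r) ^ 6 = algebraMap k E v ^ 6 * algebraMap k E d ^ 3 := by
        rw [← hr]; ring
      calc _ = (M : E) ^ 2 * (β * σ β * algebraMap k E d) ^ 2 * (ρ - σ ρ) ^ 6 := by ring
        _ = (M * ((ρ - σ ρ) * (ω * σ ω))) ^ 6 := by rw [h2]; ring
        _ = _ := by
          rw [h3, ← h4, h5]
          change _ = algebraMap k E d ^ 2 * (algebraMap k E d * algebraMap k E v ^ 6)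
          ring
    have hdp : d ∈ p := by
      have : Ideal.span {d} ≤ p := by rw [hd]; exact Ideal.mul_le_left.trans hsp
      rwa [Ideal.span_singleton_le_iff_mem] at this
    have h6 : (M : 𝓞 k) ^ 2 * G ∈ p := by rw [hGv]; exact Ideal.mul_mem_right _ _ hdp
    exact (hp.mem_or_mem h6).resolve_left fun h => hMp (hp.mem_of_pow_mem 2 h)

end quadruple

section

universe u v

/-- To a norm one element which is the cube of an ideal but not a cube, one attaches a family of
integral binary cubic forms. -/
theorem exists_form (k : Type u) [Field k] [NumberField k] (C₁ : ℝ) (hC₁ : 1 ≤ C₁) (M : ℕ)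
    (hM0 : M ≠ 0) : ∃ C : ℝ, 1 ≤ C ∧ ∀ (E : Type v) [Field E] [NumberField E] [Algebra k E],
    Module.finrank k E = 2 → ∀ (r : 𝓞 E) (d : 𝓞 k), (r : E) ^ 2 = algebraMap k E d →
    (r : E) ∉ Set.range (algebraMap k E) → ∀ (s c : Ideal (𝓞 k)), Squarefree s →
    Ideal.span {d} = s * c ^ 2 → (Ideal.absNorm c : ℝ) ≤ C₁ → Ideal.absNorm c ∣ M →
    (∀ φ : k →+* ℂ, Ideal.absNorm s ≤ C₁ * ‖φ (d : k)‖ ^ Module.finrank ℚ k) →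
    ∀ (γ : E) (x y : k), γ = algebraMap k E x + algebraMap k E y * r → x ^ 2 - y ^ 2 * d = 1 →
    (∀ z : E, γ ≠ z ^ 3) → ∀ I : (FractionalIdeal (nonZeroDivisors (𝓞 E)) E)ˣ,
    FractionalIdeal.spanSingleton (nonZeroDivisors (𝓞 E)) γ = I.1 ^ 3 →
    ∃ (i j : ℕ) (ω θ : E), i ≤ j ∧ ω ≠ 0 ∧ (∀ x : k, θ ≠ algebraMap k E x * ω) ∧
      ((2 : ℝ) ^ (i + j)) ^ Module.finrank ℚ k ≤ C * Real.sqrt (Ideal.absNorm s) ∧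
      ∀ m : 𝓞 k, (∀ φ : k →+* ℂ, ‖φ m‖ ≤ 2 ^ (j - i)) →
      ∃ (a b c' e : 𝓞 k) (β β' ρ ρ' : E), β = M * ω ^ 3 / (γ * r) ∧
      ρ = θ / ω + algebraMap k E m ∧ ρ ≠ ρ' ∧ β ≠ 0 ∧ β' ≠ 0 ∧
      algebraMap k E a = β + β' ∧ algebraMap k E b = β * ρ + β' * ρ' ∧
      algebraMap k E c' = β * ρ ^ 2 + β' * ρ' ^ 2 ∧
      algebraMap k E e = β * ρ ^ 3 + β' * ρ' ^ 3 ∧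
      (∀ φ : k →+* ℂ, ‖φ a‖ ≤ C * (2 ^ (2 * i) / 2 ^ j)) ∧
      (∀ φ : k →+* ℂ, ‖φ b‖ ≤ C * 2 ^ i) ∧ (∀ φ : k →+* ℂ, ‖φ c'‖ ≤ C * 2 ^ j) ∧
      (∀ φ : k →+* ℂ, ‖φ e‖ ≤ C * (2 ^ (2 * j) / 2 ^ i)) ∧ a ≠ 0 ∧
      ∀ p : Ideal (𝓞 k), p.IsPrime → s ≤ p → (M : 𝓞 k) ∉ p →
        a ^ 2 * e ^ 2 - 6 * a * b * c' * e + 4 * b ^ 3 * e + 4 * a * c' ^ 3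
          - 3 * b ^ 2 * c' ^ 2 ∈ p := by
  set n := Module.finrank ℚ k with hn
  have hn0 : n ≠ 0 := Module.finrank_pos.ne'
  set D : ℝ := ((NumberField.discr k).natAbs : ℝ) with hD
  have hD1 : 1 ≤ D := by
    rw [hD]
    exact_mod_cast Int.natAbs_pos.mpr (NumberField.discr_ne_zero k)
  set C₃ : ℝ := (2048 * (2 * n + 1)) ^ n * (2 ^ n * C₁ * D) with hC₃
  have hC₃1 : 1 ≤ C₃ := by
    have h1 : (1 : ℝ) ≤ (2048 * (2 * n + 1)) ^ n := one_le_pow₀ (by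
      have : (0 : ℝ) ≤ n := Nat.cast_nonneg n
      linarith)
    have h2 : (1 : ℝ) ≤ 2 ^ n := one_le_pow₀ one_le_two
    exact one_le_mul_of_one_le_of_one_le h1
      (one_le_mul_of_one_le_of_one_le (one_le_mul_of_one_le_of_one_le h2 hC₁) hD1)
  set C₄ : ℝ := C₃ * C₁ with hC₄
  have hC₄1 : 1 ≤ C₄ := one_le_mul_of_one_le_of_one_le hC₃1 hC₁
  have hM1 : (1 : ℝ) ≤ M := by exact_mod_cast Nat.one_le_iff_ne_zero.mpr hM0
  refine ⟨16 * (M * C₄), by nlinarith, ?_⟩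
  intro E _ _ _ h2 r d hr hr' s c hs hd hcN hcM hlow γ x y hγ hxy hcube I hI
  have hr0 : (r : E) ≠ 0 := fun h => hr' ⟨0, by simp [h]⟩
  obtain ⟨σ, hσr, hσσ, hσ⟩ := exists_conj h2 (r : E) d hr hr'
  have hσk : ∀ x : k, σ (algebraMap k E x) = algebraMap k E x := σ.commutes
  have hγσ : γ * σ γ = 1 := by
    rw [hγ, map_add, map_mul, hσk, hσk, hσr]
    have := congrArg (algebraMap k E) hxy
    simp only [map_sub, map_mul, map_pow, map_one] at this
    rw [← hr] at this
    linear_combination this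
  have hγ0 : γ ≠ 0 := left_ne_zero_of_mul_eq_one hγσ
  have hN : |Algebra.norm ℚ γ| = 1 := by
    have h1 : Algebra.norm ℚ (σ γ) = Algebra.norm ℚ γ :=
      Algebra.norm_eq_of_algEquiv (σ.restrictScalars ℚ) γ
    have h3 : Algebra.norm ℚ γ ^ 2 = 1 := by
      rw [pow_two]; nth_rewrite 2 [← h1]; rw [← map_mul, hγσ, map_one]
    rw [← abs_one, ← sq_eq_sq_iff_abs_eq_abs, h3, one_pow]
  obtain ⟨i, j, ω, θ, hij, hω, hω0, hωb, hθ, hθω, hθb, hsize⟩ :=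
    exists_two_short h2 hγ0 hN I hI r hr'
  rw [← hn] at hsize
  set S : ℝ := (Ideal.absNorm s : ℝ) with hS
  have hr2 : r ^ 2 = algebraMap (𝓞 k) (𝓞 E) d := by
    apply NumberField.RingOfIntegers.coe_injective
    rw [map_pow]
    exact hr
  have hdisc : Real.sqrt |(NumberField.discr E : ℝ)| ≤ 2 ^ n * C₁ * D * Real.sqrt S := by
    have h1 : |(NumberField.discr E : ℝ)| ≤ 4 ^ n * (S * C₁ ^ 2) * D ^ 2 := by
      have h3 := discr_le_of_sq_eq h2 r d hr2 hr'
      have h4 : |(NumberField.discr E : ℝ)| = ((NumberField.discr E).natAbs : ℝ) := by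
        rw [Nat.cast_natAbs, Int.cast_abs]
      rw [h4]
      refine (Nat.cast_le (α := ℝ).mpr h3).trans ?_
      rw [hd, map_mul, map_pow]
      push_cast
      rw [← hn, ← hS]
      have hD' : |(NumberField.discr k : ℝ)| ≤ D := by rw [hD, Nat.cast_natAbs, Int.cast_abs]
      gcongr
    refine (Real.sqrt_le_sqrt h1).trans (le_of_eq ?_)
    rw [show (4 : ℝ) ^ n * (S * C₁ ^ 2) * D ^ 2 = (2 ^ n * C₁ * D) ^ 2 * S by
      rw [show (4 : ℝ) = 2 ^ 2 by norm_num, ← pow_mul]; ring,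
      Real.sqrt_mul (by positivity), Real.sqrt_sq (by positivity)]
  have hsize' : ((2 : ℝ) ^ (i + j)) ^ n ≤ C₃ * Real.sqrt S := by
    refine hsize.trans ?_
    rw [hC₃, mul_assoc ((2048 * (2 * (n : ℝ) + 1)) ^ n)]
    gcongr
  have hM' : (1 : ℝ) ≤ 16 * M := by linarith
  refine ⟨i, j, ω, θ, hij, hω0, hθω, hsize'.trans ?_, ?_⟩
  · gcongr
    nlinarith
  have hR : ∀ ψ : E →+* ℂ, 2 ^ (i + j) / C₄ ≤ ‖ψ r‖ := by
    intro ψ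
    rw [div_le_iff₀ (by positivity)]
    refine le_of_pow_le_pow_left₀ hn0 (by positivity) (hsize'.trans ?_)
    have h3 : ‖ψ r‖ ^ 2 = ‖(ψ.comp (algebraMap k E)) d‖ := by
      rw [RingHom.comp_apply, ← hr, map_pow, norm_pow]
    have h4 := hlow (ψ.comp (algebraMap k E))
    rw [← h3, ← pow_mul, mul_comm 2, pow_mul] at h4
    have h5 : Real.sqrt S ≤ C₁ * ‖ψ r‖ ^ n := by
      rw [Real.sqrt_le_left (by positivity), mul_pow]
      refine h4.trans ?_
      gcongr
      exact le_self_pow₀ hC₁ two_ne_zero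
    calc C₃ * Real.sqrt S ≤ C₃ * (C₁ * ‖ψ r‖ ^ n) := by gcongr
      _ = C₄ * ‖ψ r‖ ^ n := by rw [hC₄]; ring
      _ ≤ C₄ ^ n * ‖ψ r‖ ^ n := by gcongr; exact le_self_pow₀ hC₄1 hn0
      _ = _ := (mul_pow _ _ _).symm.trans (by rw [mul_comm])
  intro m hm
  have hmω : θ + algebraMap k E m * ω ∈ I.1 := by
    refine Submodule.add_mem (I.1 : Submodule (𝓞 E) E) hθ ?_
    have := Submodule.smul_mem (I.1 : Submodule (𝓞 E) E) (algebraMap (𝓞 k) (𝓞 E) m) hω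
    rw [Algebra.smul_def] at this
    exact this
  have hθb' : ∀ ψ : E →+* ℂ, ‖ψ (θ + algebraMap k E m * ω)‖ ≤ 2 ^ (j + 1) * cubeWt γ ψ := by
    intro ψ
    rw [map_add, map_mul]
    refine (norm_add_le _ _).trans ?_
    rw [norm_mul]
    have h3 := hm (ψ.comp (algebraMap k E))
    rw [RingHom.comp_apply] at h3
    calc _ ≤ 2 ^ j * cubeWt γ ψ + 2 ^ (j - i) * (2 ^ i * cubeWt γ ψ) := by
          gcongr
          · exact hθb ψ
          · exact hωb ψ
      _ = _ := by
        rw [← mul_assoc, ← pow_add, Nat.sub_add_cancel hij]; ring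
  obtain ⟨a, b, c', e, ha, hb, hc', he, ha', hb', hc'', he', ha0, hG⟩ :=
    exists_quadruple σ r d hr hr0 hσr hσσ hσ s c hs hd M hcM hM0 hγσ hcube hI hω hω0 hmω
      (R := 2 ^ (i + j) / C₄) (by positivity) hωb hθb' hR _ _ rfl rfl
  have hρ : (θ + algebraMap k E m * ω) / ω = θ / ω + algebraMap k E m := by field_simp
  have hMr : (M : E) * ω ^ 3 / (γ * r) ≠ 0 := div_ne_zero
    (mul_ne_zero (Nat.cast_ne_zero.mpr hM0) (pow_ne_zero 3 hω0)) (mul_ne_zero hγ0 hr0)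
  refine ⟨a, b, c', e, _, σ (M * ω ^ 3 / (γ * r)), _,
    σ ((θ + algebraMap k E m * ω) / ω), rfl, hρ, ?_, hMr, (map_ne_zero σ).mpr hMr, ha,
    by rw [hb, map_mul], by rw [hc', map_mul, map_pow], by rw [he, map_mul, map_pow],
    fun φ => (ha' φ).trans ?_, fun φ => (hb' φ).trans ?_, fun φ => (hc'' φ).trans ?_,
    fun φ => (he' φ).trans ?_, ha0, hG⟩
  · intro h
    obtain ⟨t, ht⟩ := hσ _ h.symm
    apply hθω (t - m)
    rw [map_sub, ht]
    field_simp
    ring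
  · have : 2 * (M * ((2 : ℝ) ^ i) ^ 3 / (2 ^ (i + j) / C₄)) = 2 * (M * C₄) * (2 ^ (2 * i) / 2 ^ j) := by
      rw [pow_add]; field_simp; ring
    rw [this]
    gcongr
    norm_num
  · have : 2 * (M * (((2 : ℝ) ^ i) ^ 2 * 2 ^ (j + 1)) / (2 ^ (i + j) / C₄)) =
        4 * (M * C₄) * 2 ^ i := by
      rw [pow_add, pow_add]; field_simp; ring
    rw [this]
    gcongr
    norm_num
  · have : 2 * (M * ((2 : ℝ) ^ i * (2 ^ (j + 1)) ^ 2) / (2 ^ (i + j) / C₄)) =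
        8 * (M * C₄) * 2 ^ j := by
      rw [pow_add, pow_add]; field_simp; ring
    rw [this]
    gcongr
    norm_num
  · have : 2 * (M * ((2 : ℝ) ^ (j + 1)) ^ 3 / (2 ^ (i + j) / C₄)) =
        16 * (M * C₄) * (2 ^ (2 * j) / 2 ^ i) := by
      rw [pow_add, pow_add]; field_simp; ring
    rw [this]

end

theorem card_le_two_pow_mul {R : Type*} [CommRing R] (B : ℕ) (V : Finset (Ideal R)) :
    ∀ F : Finset R, (∀ p ∈ V, (F.image (Ideal.Quotient.mk p)).card ≤ 2) →
    (∀ F' ⊆ F, (∀ p ∈ V, ∀ x ∈ F', ∀ y ∈ F', x - y ∈ p) → F'.card ≤ B) →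
    F.card ≤ 2 ^ V.card * B := by
  induction V using Finset.induction_on with
  | empty => exact fun F _ h => by simpa using h F subset_rfl (by simp)
  | insert p V hp ih =>
    intro F h1 h2
    have h3 : ∀ t ∈ F.image (Ideal.Quotient.mk p),
        (F.filter fun x => Ideal.Quotient.mk p x = t).card ≤ 2 ^ V.card * B := by
      intro t _
      refine ih _ (fun q hq => (Finset.card_le_card (Finset.image_subset_image
        (Finset.filter_subset _ _))).trans (h1 q (Finset.mem_insert_of_mem hq))) ?_
      intro F' hF' hd
      refine h2 F' (hF'.trans (Finset.filter_subset _ _)) fun q hq x hx y hy => ?_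
      rcases Finset.mem_insert.mp hq with rfl | hq
      · rw [← Ideal.Quotient.mk_eq_mk_iff_sub_mem, (Finset.mem_filter.mp (hF' hx)).2,
          (Finset.mem_filter.mp (hF' hy)).2]
      · exact hd q hq x hx y hy
    have h4 := Finset.card_le_mul_card_image (f := Ideal.Quotient.mk p) F _ h3
    rw [Finset.card_insert_of_notMem hp, pow_succ]
    calc F.card ≤ 2 ^ V.card * B * (F.image (Ideal.Quotient.mk p)).card := h4
      _ ≤ 2 ^ V.card * B * 2 := Nat.mul_le_mul_left _ (h1 p (Finset.mem_insert_self _ _))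
      _ = _ := by ring

/-- A quadratic polynomial has at most two roots modulo a prime ideal. -/
theorem card_image_mk_le_two {R : Type*} [CommRing R] {p : Ideal R} [p.IsPrime] {a b c : R}
    (ha : a ∉ p) (F : Finset R) (hF : ∀ x ∈ F, a * x ^ 2 + b * x + c ∈ p) :
    (F.image (Ideal.Quotient.mk p)).card ≤ 2 := by
  set f : Polynomial (R ⧸ p) := Polynomial.C (Ideal.Quotient.mk p a) * Polynomial.X ^ 2 +
    Polynomial.C (Ideal.Quotient.mk p b) * Polynomial.X + Polynomial.C (Ideal.Quotient.mk p c)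
    with hf
  have ha' : Ideal.Quotient.mk p a ≠ 0 := fun h => ha (Ideal.Quotient.eq_zero_iff_mem.mp h)
  have hf0 : f ≠ 0 := by
    intro h
    have := Polynomial.degree_quadratic (b := Ideal.Quotient.mk p b)
      (c := Ideal.Quotient.mk p c) ha'
    rw [← hf, h] at this
    simp at this
  have h1 : F.image (Ideal.Quotient.mk p) ⊆ f.roots.toFinset := by
    intro t ht
    obtain ⟨x, hx, rfl⟩ := Finset.mem_image.mp ht
    rw [Multiset.mem_toFinset, Polynomial.mem_roots hf0, Polynomial.IsRoot.def]
    have := Ideal.Quotient.eq_zero_iff_mem.mpr (hF x hx)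
    simpa [hf] using this
  calc _ ≤ f.roots.toFinset.card := Finset.card_le_card h1
    _ ≤ f.roots.card := Multiset.toFinset_card_le _
    _ ≤ f.natDegree := Polynomial.card_roots' f
    _ ≤ 2 := Polynomial.natDegree_quadratic_le

theorem prod_le_of_forall_mem {R : Type*} [CommRing R] [IsDedekindDomain R] (V : Finset (Ideal R))
    (hV : ∀ p ∈ V, p.IsPrime ∧ p ≠ ⊥) {x : R} (hx : ∀ p ∈ V, x ∈ p) : x ∈ ∏ p ∈ V, p := by
  have h : ∏ p ∈ V, p ∣ Ideal.span {x} :=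
    Finset.prod_primes_dvd _ (fun p hp => Ideal.prime_of_isPrime (hV p hp).2 (hV p hp).1)
      fun p hp => by
        rw [Ideal.dvd_iff_le, Ideal.span_singleton_le_iff_mem]
        exact hx p hp
  rwa [Ideal.dvd_iff_le, Ideal.span_singleton_le_iff_mem] at h

section count

variable {k : Type*} [Field k] [NumberField k]

local notation "nn" => Module.finrank ℚ k

theorem one_le_absNorm_prod (V : Finset (Ideal (𝓞 k))) (hV : ∀ p ∈ V, p.IsPrime ∧ p ≠ ⊥) :
    (1 : ℝ) ≤ Ideal.absNorm (∏ p ∈ V, p) := by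
  have : ∏ p ∈ V, p ≠ ⊥ := Finset.prod_ne_zero_iff.mpr fun p hp => (hV p hp).2
  exact_mod_cast Nat.one_le_iff_ne_zero.mpr (by rwa [Ne, Ideal.absNorm_eq_zero_iff])

theorem card_le_of_box_one {X : ℝ} (hX : 1 ≤ X) (S : Finset (𝓞 k))
    (hS : ∀ x ∈ S, ∀ φ : k →+* ℂ, ‖φ x‖ ≤ X) : (S.card : ℝ) ≤ 2 * 64 ^ nn * X ^ nn := by
  have h := card_le_of_box (q := (⊤ : Ideal (𝓞 k))) top_ne_bot (by linarith) S hS (by simp)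
  rw [Ideal.absNorm_top, Nat.cast_one, div_one] at h
  have h1 : 1 ≤ X ^ nn := one_le_pow₀ hX
  have h2 : (0 : ℝ) < 64 ^ nn := by positivity
  nlinarith

/-- Nonzero elements of an ideal in a box. -/
theorem card_nonzero_le_of_box {X : ℝ} (hX : 0 ≤ X) (q : Ideal (𝓞 k)) (hq : q ≠ ⊥)
    (S : Finset (𝓞 k)) (hS : ∀ x ∈ S, ∀ φ : k →+* ℂ, ‖φ x‖ ≤ X) (hq' : ∀ x ∈ S, x ∈ q)
    (h0 : ∀ x ∈ S, x ≠ 0) : (S.card : ℝ) ≤ 2 * 64 ^ nn * (X ^ nn / Ideal.absNorm q) := by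
  rcases S.eq_empty_or_nonempty with rfl | ⟨x, hx⟩
  · simp only [Finset.card_empty, Nat.cast_zero]; positivity
  have h := card_le_of_box hq hX S hS fun x hx y hy => q.sub_mem (hq' x hx) (hq' y hy)
  have hq0 : (0 : ℝ) < Ideal.absNorm q := by
    exact_mod_cast Nat.pos_of_ne_zero (by rwa [Ne, Ideal.absNorm_eq_zero_iff])
  have h1 : (Ideal.absNorm q : ℝ) ≤ X ^ nn := by
    have h2 : Ideal.absNorm q ≤ Ideal.absNorm (Ideal.span {x}) :=
      Nat.le_of_dvd (Nat.pos_of_ne_zero (by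
        rw [Ne, Ideal.absNorm_eq_zero_iff, Ideal.span_singleton_eq_bot]; exact h0 x hx))
        (map_dvd Ideal.absNorm (by
          rw [Ideal.dvd_iff_le, Ideal.span_singleton_le_iff_mem]; exact hq' x hx))
    refine (Nat.cast_le (α := ℝ).mpr h2).trans ?_
    rw [← prod_norm_embeddings_int]
    refine (Finset.prod_le_prod (fun _ _ => norm_nonneg _) fun φ _ => hS x hx φ).trans_eq ?_
    rw [Finset.prod_const, Finset.card_univ, NumberField.Embeddings.card k ℂ]
  have h3 : 1 ≤ X ^ nn / Ideal.absNorm q := (one_le_div hq0).mpr h1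
  have h4 : (0 : ℝ) < 64 ^ nn := by positivity
  nlinarith

/-- The number of integral binary cubic forms in a box with discriminant divisible by given
primes. -/
theorem card_quadruples_le (P : Finset (Ideal (𝓞 k))) (hP : ∀ p ∈ P, p.IsPrime ∧ p ≠ ⊥)
    {Xa Xb Xc Xe : ℝ} (ha : 0 ≤ Xa) (hb : 1 ≤ Xb) (hc : 1 ≤ Xc) (he : 0 ≤ Xe)
    (Q : Finset (𝓞 k × 𝓞 k × 𝓞 k × 𝓞 k))
    (hQa : ∀ t ∈ Q, ∀ φ : k →+* ℂ, ‖φ t.1‖ ≤ Xa) (hQb : ∀ t ∈ Q, ∀ φ : k →+* ℂ, ‖φ t.2.1‖ ≤ Xb)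
    (hQc : ∀ t ∈ Q, ∀ φ : k →+* ℂ, ‖φ t.2.2.1‖ ≤ Xc)
    (hQe : ∀ t ∈ Q, ∀ φ : k →+* ℂ, ‖φ t.2.2.2‖ ≤ Xe) (hQ0 : ∀ t ∈ Q, t.1 ≠ 0)
    (hQ : ∀ t ∈ Q, ∀ p ∈ P, t.1 ^ 2 * t.2.2.2 ^ 2 - 6 * t.1 * t.2.1 * t.2.2.1 * t.2.2.2
      + 4 * t.2.1 ^ 3 * t.2.2.2 + 4 * t.1 * t.2.2.1 ^ 3 - 3 * t.2.1 ^ 2 * t.2.2.1 ^ 2 ∈ p) :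
    (Q.card : ℝ) ≤ 8 * (64 ^ nn) ^ 4 * 4 ^ P.card * (Xa ^ nn * Xb ^ nn * Xc ^ nn) *
      (Xe ^ nn / Ideal.absNorm (∏ p ∈ P, p) + 1) := by
  set A := Q.image fun t => t.1 with hA
  set B := Q.image fun t => t.2.1 with hB
  set C := Q.image fun t => t.2.2.1 with hC
  set U : 𝓞 k → Finset (Ideal (𝓞 k)) := fun a => P.filter fun p => a ∈ p with hU
  set f : Finset (Ideal (𝓞 k)) → ℝ := fun V =>
    64 ^ nn * (Xe ^ nn / Ideal.absNorm (∏ p ∈ P \ V, p) + 1) with hf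
  have hf0 : ∀ V, 0 ≤ f V := fun V => by rw [hf]; positivity
  have hfib : ∀ t ∈ Q.image (fun t => (t.1, t.2.1, t.2.2.1)),
      ((Q.filter fun u => (u.1, u.2.1, u.2.2.1) = t).card : ℝ) ≤ 2 ^ P.card * f (U t.1) := by
    rintro ⟨a, b, c⟩ _
    set F := (Q.filter fun u => (u.1, u.2.1, u.2.2.1) = (a, b, c)).image fun t => t.2.2.2 with hF
    have hFQ : ∀ x ∈ F, (a, b, c, x) ∈ Q := by
      intro x hx
      obtain ⟨⟨a', b', c', e'⟩, ht, rfl⟩ := Finset.mem_image.mp hx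
      obtain ⟨htQ, h⟩ := Finset.mem_filter.mp ht
      simp only [Prod.mk.injEq] at h
      obtain ⟨rfl, rfl, rfl⟩ := h
      exact htQ
    have hcard : (Q.filter fun u => (u.1, u.2.1, u.2.2.1) = (a, b, c)).card = F.card := by
      rw [hF, Finset.card_image_of_injOn]
      rintro ⟨a₁, b₁, c₁, e₁⟩ h₁ ⟨a₂, b₂, c₂, e₂⟩ h₂ h
      have h₁ := (Finset.mem_filter.mp h₁).2
      have h₂ := (Finset.mem_filter.mp h₂).2
      simp only [Prod.mk.injEq] at h₁ h₂ h ⊢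
      exact ⟨h₁.1.trans h₂.1.symm, h₁.2.1.trans h₂.2.1.symm, h₁.2.2.trans h₂.2.2.symm, h⟩
    rw [hcard]
    have hV : ∀ p ∈ P \ U a, p.IsPrime ∧ p ≠ ⊥ := fun p hp => hP p (Finset.mem_sdiff.mp hp).1
    have h1 := card_le_two_pow_mul ⌊f (U a)⌋₊ (P \ U a) F (by
      intro p hp
      have := (hV p hp).1
      have hap : a ∉ p := fun h => (Finset.mem_sdiff.mp hp).2
        (Finset.mem_filter.mpr ⟨(Finset.mem_sdiff.mp hp).1, h⟩)
      refine card_image_mk_le_two (a := a ^ 2) (b := 4 * b ^ 3 - 6 * a * b * c)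
        (c := 4 * a * c ^ 3 - 3 * b ^ 2 * c ^ 2) (fun h => hap (this.mem_of_pow_mem 2 h)) F ?_
      intro x hx
      have := hQ _ (hFQ x hx) p (Finset.mem_sdiff.mp hp).1
      convert this using 1
      ring) (by
      intro F' hF' hd
      refine Nat.le_floor ?_
      refine card_le_of_box ?_ he F' (fun x hx φ => hQe _ (hFQ x (hF' hx)) φ) ?_
      · exact Finset.prod_ne_zero_iff.mpr fun p hp => (hV p hp).2
      · intro x hx y hy
        exact prod_le_of_forall_mem _ hV fun p hp => hd p hp x hx y hy)
    have h2 : (F.card : ℝ) ≤ 2 ^ (P \ U a).card * (⌊f (U a)⌋₊ : ℕ) := by exact_mod_cast h1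
    refine h2.trans ?_
    gcongr
    · norm_num
    · exact Finset.sdiff_subset
    · exact Nat.floor_le (hf0 _)
  have hsum : (Q.card : ℝ) ≤ ∑ t ∈ A ×ˢ (B ×ˢ C), 2 ^ P.card * f (U t.1) := by
    have h1 := Finset.card_eq_sum_card_image (fun t : 𝓞 k × 𝓞 k × 𝓞 k × 𝓞 k =>
      (t.1, t.2.1, t.2.2.1)) Q
    rw [h1, Nat.cast_sum]
    refine (Finset.sum_le_sum hfib).trans ?_
    refine Finset.sum_le_sum_of_subset_of_nonneg ?_ fun _ _ _ => mul_nonneg (by positivity) (hf0 _)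
    intro t ht
    obtain ⟨u, hu, rfl⟩ := Finset.mem_image.mp ht
    simp only [Finset.mem_product]
    exact ⟨Finset.mem_image_of_mem _ hu, Finset.mem_image_of_mem (fun t => t.2.1) hu,
      Finset.mem_image_of_mem (fun t => t.2.2.1) hu⟩
  have hBc : (B.card : ℝ) ≤ 2 * 64 ^ nn * Xb ^ nn := by
    refine card_le_of_box_one hb B fun x hx φ => ?_
    obtain ⟨t, ht, rfl⟩ := Finset.mem_image.mp hx
    exact hQb t ht φ
  have hCc : (C.card : ℝ) ≤ 2 * 64 ^ nn * Xc ^ nn := by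
    refine card_le_of_box_one hc C fun x hx φ => ?_
    obtain ⟨t, ht, rfl⟩ := Finset.mem_image.mp hx
    exact hQc t ht φ
  have hAsum : ∑ a ∈ A, f (U a) ≤ 2 ^ P.card * (2 * (64 ^ nn) ^ 2 * Xa ^ nn *
      (Xe ^ nn / Ideal.absNorm (∏ p ∈ P, p) + 1)) := by
    have h1 : ∑ a ∈ A, f (U a) = ∑ V ∈ P.powerset, ((A.filter fun a => U a = V).card : ℝ) * f V := by
      rw [← Finset.sum_fiberwise_of_maps_to (s := A) (t := P.powerset) (g := U)
        (fun a _ => Finset.mem_powerset.mpr (Finset.filter_subset _ _))]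
      refine Finset.sum_congr rfl fun V _ => ?_
      rw [← nsmul_eq_mul, ← Finset.sum_const]
      exact Finset.sum_congr rfl fun a ha => by rw [(Finset.mem_filter.mp ha).2]
    rw [h1]
    have h2 : ∀ V ∈ P.powerset, ((A.filter fun a => U a = V).card : ℝ) * f V ≤
        2 * (64 ^ nn) ^ 2 * Xa ^ nn * (Xe ^ nn / Ideal.absNorm (∏ p ∈ P, p) + 1) := by
      intro V hV
      have hVP := Finset.mem_powerset.mp hV
      have hV1 : ∀ p ∈ V, p.IsPrime ∧ p ≠ ⊥ := fun p hp => hP p (hVP hp)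
      have h3 := card_nonzero_le_of_box ha (∏ p ∈ V, p)
        (Finset.prod_ne_zero_iff.mpr fun p hp => (hV1 p hp).2) (A.filter fun a => U a = V)
        (by
          intro x hx φ
          obtain ⟨t, ht, rfl⟩ := Finset.mem_image.mp (Finset.mem_filter.mp hx).1
          exact hQa t ht φ)
        (by
          intro x hx
          refine prod_le_of_forall_mem _ hV1 fun p hp => ?_
          rw [← (Finset.mem_filter.mp hx).2] at hp
          exact (Finset.mem_filter.mp hp).2)
        (by
          intro x hx
          obtain ⟨t, ht, rfl⟩ := Finset.mem_image.mp (Finset.mem_filter.mp hx).1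
          exact hQ0 t ht)
      have hg := one_le_absNorm_prod V hV1
      have hg' := one_le_absNorm_prod (P \ V) fun p hp => hP p (Finset.mem_sdiff.mp hp).1
      have hgg : (Ideal.absNorm (∏ p ∈ P, p) : ℝ) =
          Ideal.absNorm (∏ p ∈ P \ V, p) * Ideal.absNorm (∏ p ∈ V, p) := by
        rw [← Finset.prod_sdiff hVP, map_mul, Nat.cast_mul]
      rw [hgg]
      set g : ℝ := ((Ideal.absNorm (∏ p ∈ V, p) : ℕ) : ℝ)
      set g' : ℝ := ((Ideal.absNorm (∏ p ∈ P \ V, p) : ℕ) : ℝ)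
      calc _ ≤ 2 * 64 ^ nn * (Xa ^ nn / g) * f V := by
            have := hf0 V
            gcongr
        _ = 2 * (64 ^ nn) ^ 2 * Xa ^ nn * (Xe ^ nn / (g' * g) + 1 / g) := by
            rw [show f V = 64 ^ nn * (Xe ^ nn / g' + 1) from rfl]; field_simp
        _ ≤ _ := by
            gcongr
            rw [div_le_one (by linarith)]
            exact hg
    refine (Finset.sum_le_sum h2).trans ?_
    rw [Finset.sum_const, Finset.card_powerset, nsmul_eq_mul]
    push_cast
    exact le_rfl
  rw [Finset.sum_product] at hsum
  simp only [Finset.sum_const, nsmul_eq_mul] at hsum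
  rw [← Finset.mul_sum, ← Finset.mul_sum, Finset.card_product, Nat.cast_mul] at hsum
  refine hsum.trans ?_
  have hA0 : 0 ≤ ∑ a ∈ A, f (U a) := Finset.sum_nonneg fun a _ => hf0 _
  calc _ ≤ (2 * 64 ^ nn * Xb ^ nn) * (2 * 64 ^ nn * Xc ^ nn) * (2 ^ P.card *
        (2 ^ P.card * (2 * (64 ^ nn) ^ 2 * Xa ^ nn *
          (Xe ^ nn / Ideal.absNorm (∏ p ∈ P, p) + 1)))) := by gcongr
    _ = _ := by
      rw [show (4 : ℝ) ^ P.card = 2 ^ P.card * 2 ^ P.card by rw [← mul_pow]; norm_num]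
      ring

end count

section

open IntermediateField

theorem numberField_of_finiteDimensional (k K : Type*) [Field k] [NumberField k] [Field K]
    [Algebra k K] [FiniteDimensional k K] : NumberField K := by
  have : CharZero K := charZero_of_injective_algebraMap (algebraMap k K).injective
  have : IsScalarTower ℚ k K := IsScalarTower.of_algebraMap_eq' (Subsingleton.elim _ _)
  have : FiniteDimensional ℚ K := Module.Finite.trans k K
  exact ⟨⟩

theorem finrank_adjoin_sqrt {k Ω : Type*} [Field k] [Field Ω] [Algebra k Ω] {r : Ω} {d : k} (hr : r ^ 2 = algebraMap k Ω d)
    (hr' : r ∉ Set.range (algebraMap k Ω)) : Module.finrank k k⟮r⟯ = 2 := by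
  have hirr : Irreducible (Polynomial.X ^ 2 - Polynomial.C d) := by
    refine Polynomial.irreducible_of_degree_le_three_of_not_isRoot ?_ ?_
    · rw [Polynomial.natDegree_X_pow_sub_C]; decide
    · intro z hz
      simp only [Polynomial.IsRoot, Polynomial.eval_sub, Polynomial.eval_pow, Polynomial.eval_X,
        Polynomial.eval_C, sub_eq_zero] at hz
      rw [← hz, map_pow, sq_eq_sq_iff_eq_or_eq_neg] at hr
      rcases hr with h | h
      · exact hr' ⟨z, h.symm⟩
      · exact hr' ⟨-z, by rw [map_neg, h]⟩
  have hm : minpoly k r = Polynomial.X ^ 2 - Polynomial.C d :=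
    (minpoly.eq_of_irreducible_of_monic hirr (by simp [hr])
      (Polynomial.monic_X_pow_sub_C _ two_ne_zero)).symm
  have hintegral : IsIntegral k r := ⟨Polynomial.X ^ 2 - Polynomial.C d,
    Polynomial.monic_X_pow_sub_C _ two_ne_zero, by simp [hr]⟩
  rw [adjoin.finrank hintegral, hm, Polynomial.natDegree_X_pow_sub_C]

section closure

universe u v

variable {k : Type u} [Field k] [NumberField k] {Ω : Type v} [Field Ω] [Algebra k Ω]

/-- The data attached to an element of norm one `x + y * r` in the quadratic extension generated
by `r`, the square root of `d`. -/
structure IsFormDatum (C₁ : ℝ) (M : ℕ) (r : Ω) (d : 𝓞 k) (s c : Ideal (𝓞 k)) (x y : k) :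
    Prop where
  sq_eq : r ^ 2 = algebraMap k Ω d
  notMem : r ∉ Set.range (algebraMap k Ω)
  squarefree : Squarefree s
  span_eq : Ideal.span {d} = s * c ^ 2
  norm_le : (Ideal.absNorm c : ℝ) ≤ C₁
  norm_dvd : Ideal.absNorm c ∣ M
  bound : ∀ φ : k →+* ℂ, Ideal.absNorm s ≤ C₁ * ‖φ (d : k)‖ ^ Module.finrank ℚ k
  norm_one : x ^ 2 - y ^ 2 * d = 1
  not_cube : ∀ z ∈ k⟮r⟯, algebraMap k Ω x + algebraMap k Ω y * r ≠ z ^ 3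
  ideal_cube : ∀ [NumberField k⟮r⟯], ∃ g : k⟮r⟯, (g : Ω) = algebraMap k Ω x + algebraMap k Ω y * r ∧
    ∃ I : (FractionalIdeal (nonZeroDivisors (𝓞 k⟮r⟯)) k⟮r⟯)ˣ,
      FractionalIdeal.spanSingleton (nonZeroDivisors (𝓞 k⟮r⟯)) g = I.1 ^ 3

theorem exists_form_of_isFormDatum (k : Type u) [Field k] [NumberField k] (Ω : Type v) [Field Ω]
    [Algebra k Ω] (C₁ : ℝ) (hC₁ : 1 ≤ C₁) (M : ℕ) (hM0 : M ≠ 0) : ∃ C : ℝ, 1 ≤ C ∧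
    ∀ (r : Ω) (d : 𝓞 k) (s c : Ideal (𝓞 k)) (x y : k), IsFormDatum C₁ M r d s c x y →
    ∃ (i j : ℕ) (ω ρ : Ω), i ≤ j ∧ ω ∈ k⟮r⟯ ∧ ω ≠ 0 ∧ ρ ∈ k⟮r⟯ ∧ ρ ∉ Set.range (algebraMap k Ω) ∧
      ((2 : ℝ) ^ (i + j)) ^ Module.finrank ℚ k ≤ C * Real.sqrt (Ideal.absNorm s) ∧
      ∀ m : 𝓞 k, (∀ φ : k →+* ℂ, ‖φ m‖ ≤ 2 ^ (j - i)) →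
      ∃ (a b c' e : 𝓞 k) (β β' ρ₁ ρ' : Ω),
      β = M * ω ^ 3 / ((algebraMap k Ω x + algebraMap k Ω y * r) * r) ∧
      ρ₁ = ρ + algebraMap k Ω m ∧ ρ₁ ≠ ρ' ∧ β ≠ 0 ∧ β' ≠ 0 ∧
      algebraMap k Ω a = β + β' ∧ algebraMap k Ω b = β * ρ₁ + β' * ρ' ∧
      algebraMap k Ω c' = β * ρ₁ ^ 2 + β' * ρ' ^ 2 ∧
      algebraMap k Ω e = β * ρ₁ ^ 3 + β' * ρ' ^ 3 ∧
      (∀ φ : k →+* ℂ, ‖φ a‖ ≤ C * (2 ^ (2 * i) / 2 ^ j)) ∧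
      (∀ φ : k →+* ℂ, ‖φ b‖ ≤ C * 2 ^ i) ∧ (∀ φ : k →+* ℂ, ‖φ c'‖ ≤ C * 2 ^ j) ∧
      (∀ φ : k →+* ℂ, ‖φ e‖ ≤ C * (2 ^ (2 * j) / 2 ^ i)) ∧ a ≠ 0 ∧
      ∀ p : Ideal (𝓞 k), p.IsPrime → s ≤ p → (M : 𝓞 k) ∉ p →
        a ^ 2 * e ^ 2 - 6 * a * b * c' * e + 4 * b ^ 3 * e + 4 * a * c' ^ 3
          - 3 * b ^ 2 * c' ^ 2 ∈ p := by
  obtain ⟨C, hC, h⟩ := exists_form.{u, v} k C₁ hC₁ M hM0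
  refine ⟨C, hC, ?_⟩
  intro r d s c x y D
  have h2 := finrank_adjoin_sqrt D.sq_eq D.notMem
  have : FiniteDimensional k k⟮r⟯ := Module.finite_of_finrank_pos (by omega)
  have : NumberField k⟮r⟯ := numberField_of_finiteDimensional k _
  set g₀ : k⟮r⟯ := AdjoinSimple.gen k r with hg₀
  have hg₀r : (g₀ : Ω) = r := AdjoinSimple.coe_gen k r
  have hg2 : g₀ ^ 2 = algebraMap k k⟮r⟯ d := by
    apply Subtype.ext
    simpa [hg₀r] using D.sq_eq
  have hintegral : IsIntegral ℤ g₀ := by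
    refine IsIntegral.of_pow (n := 2) two_pos ?_
    rw [hg2]
    exact (NumberField.RingOfIntegers.isIntegral_coe d).algebraMap
  set R : 𝓞 k⟮r⟯ := ⟨g₀, hintegral⟩ with hR
  have hnm : g₀ ∉ Set.range (algebraMap k k⟮r⟯) := by
    rintro ⟨z, hz⟩
    exact D.notMem ⟨z, by rw [← hg₀r, ← hz]; rfl⟩
  obtain ⟨g, hg, I, hI⟩ := D.ideal_cube
  have hgeq : g = algebraMap k k⟮r⟯ x + algebraMap k k⟮r⟯ y * R := by
    apply Subtype.ext
    rw [hg]
    change _ = algebraMap k Ω x + algebraMap k Ω y * (g₀ : Ω)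
    rw [hg₀r]
  obtain ⟨i, j, ω, θ, hij, hω0, hθ, hsz, hm⟩ := h k⟮r⟯ h2 R d hg2 hnm s c D.squarefree D.span_eq
    D.norm_le D.norm_dvd D.bound g x y hgeq D.norm_one (fun z hz => D.not_cube z z.2 (by
      rw [← hg, hz]; rfl)) I hI
  refine ⟨i, j, (ω : k⟮r⟯), ((θ / ω : k⟮r⟯) : Ω), hij, ω.2, ?_, (θ / ω).2, ?_, hsz, ?_⟩
  · exact fun h => hω0 (Subtype.ext h)
  · rintro ⟨z, hz⟩
    refine hθ z ?_
    have : algebraMap k k⟮r⟯ z = θ / ω := Subtype.ext hz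
    rw [this, div_mul_cancel₀ _ hω0]
  · intro m hmb
    obtain ⟨a, b, c', e, β, β', ρ, ρ', hβ, hρ, hne, hβ0, hβ'0, ha, hb, hc, he, hrest⟩ := hm m hmb
    refine ⟨a, b, c', e, β, β', ρ, ρ', ?_, ?_, ?_, ?_, ?_, ?_, ?_, ?_, ?_, hrest⟩
    · rw [hβ, ← hg]
      change (M : Ω) * (ω : Ω) ^ 3 / ((g : Ω) * (g₀ : Ω)) = _
      rw [hg₀r]
    · rw [hρ]; rfl
    · exact fun h => hne (Subtype.ext h)
    · exact fun h => hβ0 (Subtype.ext h)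
    · exact fun h => hβ'0 (Subtype.ext h)
    · exact congrArg (Subtype.val) ha
    · exact congrArg (Subtype.val) hb
    · exact congrArg (Subtype.val) hc
    · exact congrArg (Subtype.val) he

end closure

theorem eq_or_eq_of_moments_eq {F : Type*} [Field F] {β β' ρ ρ' b b' t t' : F} (hρ : ρ ≠ ρ')
    (hβ : β ≠ 0) (hβ' : β' ≠ 0) (h0 : β + β' = b + b') (h1 : β * ρ + β' * ρ' = b * t + b' * t')
    (h2 : β * ρ ^ 2 + β' * ρ' ^ 2 = b * t ^ 2 + b' * t' ^ 2)
    (h3 : β * ρ ^ 3 + β' * ρ' ^ 3 = b * t ^ 3 + b' * t' ^ 3) :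
    (ρ = t ∧ β = b) ∨ (ρ = t' ∧ β = b') := by
  have hd := sub_ne_zero.mpr hρ
  have e1 : β * ((ρ - t) * (ρ - t')) * (ρ - ρ') = 0 := by
    linear_combination h3 - (t + t' + ρ') * h2 + (t * t' + ρ' * (t + t')) * h1 - ρ' * t * t' * h0
  have e2 : β' * ((ρ' - t) * (ρ' - t')) * (ρ - ρ') = 0 := by
    linear_combination -h3 + (t + t' + ρ) * h2 - (t * t' + ρ * (t + t')) * h1 + ρ * t * t' * h0
  have f1 : ρ = t ∨ ρ = t' := by simpa [hβ, hd, sub_eq_zero] using e1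
  have f2 : ρ' = t ∨ ρ' = t' := by simpa [hβ', hd, sub_eq_zero] using e2
  rcases f1 with rfl | rfl
  · have : ρ' = t' := f2.resolve_left (fun h => hρ h.symm)
    subst this
    refine Or.inl ⟨rfl, ?_⟩
    exact mul_right_cancel₀ hd (by linear_combination h1 - ρ' * h0)
  · have : ρ' = t := f2.resolve_right (fun h => hρ h.symm)
    subst this
    refine Or.inr ⟨rfl, ?_⟩
    exact mul_right_cancel₀ hd (by linear_combination h1 - ρ' * h0)

end

section

open IntermediateField

theorem sum_half_pow_mul_le (T : Finset (ℕ × ℕ)) :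
    ∑ p ∈ T, ((1 : ℝ) / 2) ^ p.1 * (1 / 2) ^ p.2 ≤ 4 := by
  have h1 : ∀ N : ℕ, ∑ i ∈ Finset.range N, ((1 : ℝ) / 2) ^ i ≤ 2 := fun N =>
    sum_geometric_two_le N
  set N := (T.sup fun p => p.1 + p.2) + 1 with hN
  have hT : T ⊆ Finset.range N ×ˢ Finset.range N := by
    intro p hp
    have := Finset.le_sup (f := fun p : ℕ × ℕ => p.1 + p.2) hp
    rw [Finset.mem_product, Finset.mem_range, Finset.mem_range]
    omega
  calc _ ≤ ∑ p ∈ Finset.range N ×ˢ Finset.range N, ((1 : ℝ) / 2) ^ p.1 * (1 / 2) ^ p.2 :=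
        Finset.sum_le_sum_of_subset_of_nonneg hT fun _ _ _ => by positivity
    _ = (∑ i ∈ Finset.range N, ((1 : ℝ) / 2) ^ i) * ∑ i ∈ Finset.range N, ((1 : ℝ) / 2) ^ i := by
        rw [Finset.sum_product, Finset.sum_mul_sum]
    _ ≤ 2 * 2 := by
        have := h1 N
        gcongr
    _ = 4 := by norm_num

/-- A pair of weighted nodes is determined up to order by its first four moments. -/
theorem card_le_two_mul_card_image_moments {A R Ω : Type*} [CommRing R] [Field Ω] [Algebra R Ω]
    (W : Finset A) (a b c e : A → R) (β β' ρ ρ' : A → Ω)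
    (hρ : ∀ u ∈ W, ρ u ≠ ρ' u) (hβ : ∀ u ∈ W, β u ≠ 0) (hβ' : ∀ u ∈ W, β' u ≠ 0)
    (ha : ∀ u ∈ W, algebraMap R Ω (a u) = β u + β' u)
    (hb : ∀ u ∈ W, algebraMap R Ω (b u) = β u * ρ u + β' u * ρ' u)
    (hc : ∀ u ∈ W, algebraMap R Ω (c u) = β u * ρ u ^ 2 + β' u * ρ' u ^ 2)
    (he : ∀ u ∈ W, algebraMap R Ω (e u) = β u * ρ u ^ 3 + β' u * ρ' u ^ 3)
    (hinj : ∀ u ∈ W, ∀ v ∈ W, ρ u = ρ v → β u = β v → u = v) :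
    W.card ≤ 2 * (W.image fun u => (a u, b u, c u, e u)).card := by
  refine Finset.card_le_mul_card_image W 2 fun t ht => ?_
  obtain ⟨v, hv, rfl⟩ := Finset.mem_image.mp ht
  rw [← Finset.card_image_of_injOn (f := fun u => (ρ u, β u))]
  · refine (Finset.card_le_card (t := {(ρ v, β v), (ρ' v, β' v)}) ?_).trans Finset.card_le_two
    intro p hp
    obtain ⟨u, hu, rfl⟩ := Finset.mem_image.mp hp
    obtain ⟨hu, h⟩ := Finset.mem_filter.mp hu
    simp only [Prod.mk.injEq] at h
    have := eq_or_eq_of_moments_eq (hρ u hu) (hβ u hu) (hβ' u hu)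
      (b := β v) (b' := β' v) (t := ρ v) (t' := ρ' v)
      (by rw [← ha u hu, ← ha v hv, h.1]) (by rw [← hb u hu, ← hb v hv, h.2.1])
      (by rw [← hc u hu, ← hc v hv, h.2.2.1]) (by rw [← he u hu, ← he v hv, h.2.2.2])
    simpa using this
  · intro u hu v hv h
    simp only [Prod.mk.injEq] at h
    exact hinj u (Finset.mem_filter.mp hu).1 v (Finset.mem_filter.mp hv).1 h.1 h.2

theorem mem_adjoin_of_mem_of_finrank_two {k Ω : Type*} [Field k] [Field Ω] [Algebra k Ω]
    {E : IntermediateField k Ω} (hE : Module.finrank k E = 2) {z : Ω} (hz : z ∈ E)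
    (hz' : z ∉ Set.range (algebraMap k Ω)) : k⟮z⟯ = E := by
  have : FiniteDimensional k E := Module.finite_of_finrank_pos (by omega)
  have hle : k⟮z⟯ ≤ E := by
    rw [adjoin_simple_le_iff]; exact hz
  refine eq_of_le_of_finrank_le hle ?_
  rw [hE]
  have : FiniteDimensional k k⟮z⟯ := FiniteDimensional.of_injective (inclusion hle).toLinearMap
    (inclusion_injective hle)
  by_contra! hlt
  have h1 : Module.finrank k k⟮z⟯ = 1 := by
    have := Module.finrank_pos (R := k) (M := k⟮z⟯)
    omega
  rw [IntermediateField.finrank_eq_one_iff, adjoin_simple_eq_bot_iff, mem_bot] at h1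
  exact hz' h1

theorem eq_mul_div_pow_three {F : Type*} [Field F] {M r g h a b : F} (hM : M ≠ 0) (hr : r ≠ 0)
    (hg : g ≠ 0) (hh : h ≠ 0) (hb : b ≠ 0) (H : M * a ^ 3 / (g * r) = M * b ^ 3 / (h * r)) :
    g = h * (a / b) ^ 3 := by
  field_simp at H ⊢
  linear_combination -H

section main

universe u v w

set_option maxHeartbeats 1000000 in
theorem card_le_of_isFormDatum (k : Type u) [Field k] [NumberField k] (Ω : Type v) [Field Ω]
    [Algebra k Ω] (C₁ : ℝ) (hC₁ : 1 ≤ C₁) (M : ℕ) (hM0 : M ≠ 0) : ∃ C : ℝ, 1 ≤ C ∧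
    ∀ {ι : Type w} (S : Finset ι) (r : ι → Ω) (d : ι → 𝓞 k) (s c : ι → Ideal (𝓞 k)) (x y : ι → k)
      (Y : ℝ) (P : Finset (Ideal (𝓞 k))), 0 ≤ Y →
    (∀ t ∈ S, IsFormDatum C₁ M (r t) (d t) (s t) (c t) (x t) (y t)) →
    (∀ t ∈ S, (Ideal.absNorm (s t) : ℝ) ≤ Y) →
    (∀ p ∈ P, p.IsPrime ∧ p ≠ ⊥ ∧ (M : 𝓞 k) ∉ p) → (∀ t ∈ S, ∀ p ∈ P, s t ≤ p) →
    (∀ t ∈ S, ∀ u ∈ S, k⟮r t⟯ = k⟮r u⟯ → r t = r u) →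
    (∀ t ∈ S, ∀ u ∈ S, r t = r u → ∀ z ∈ k⟮r t⟯,
      algebraMap k Ω (x t) + algebraMap k Ω (y t) * r t =
        (algebraMap k Ω (x u) + algebraMap k Ω (y u) * r u) * z ^ 3 → t = u) →
    (S.card : ℝ) ≤ C * 4 ^ P.card *
      (Y / Ideal.absNorm (∏ p ∈ P, p) + Y ^ ((3 : ℝ) / 4)) := by
  obtain ⟨C, hC, hform⟩ := exists_form_of_isFormDatum k Ω C₁ hC₁ M hM0
  obtain ⟨c₀, hc₀, hbox⟩ := exists_box_card_ge k
  set K : ℝ := 16 * (64 ^ Module.finrank ℚ k) ^ 4 * (C ^ Module.finrank ℚ k) ^ 4 / c₀ with hK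
  have hC0 : 0 < C := by linarith
  have hK0 : 0 < K := by positivity
  have hn : 1 ≤ Module.finrank ℚ k := Module.finrank_pos
  refine ⟨max 1 (4 * K * C ^ 2), le_max_left _ _, ?_⟩
  intro ι S r d s c x y Y P hY hS hSY hP hSP hsep1 hsep2
  set g : ℝ := ((Ideal.absNorm (∏ p ∈ P, p) : ℕ) : ℝ) with hg
  have hg1 : 1 ≤ g := one_le_absNorm_prod P fun p hp => ⟨(hP p hp).1, (hP p hp).2.1⟩
  have h := fun t (ht : t ∈ S) => hform _ _ _ _ _ _ (hS t ht)
  choose! i j ω ρ hij hω hω0 hρ hρk hsz hm using h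
  obtain ⟨X, hX⟩ : ∃ X : ℝ, X = 2 ^ Module.finrank ℚ k := ⟨_, rfl⟩
  have hX2 : 2 ≤ X := by
    rw [hX]
    calc (2 : ℝ) = 2 ^ 1 := by norm_num
      _ ≤ _ := pow_le_pow_right₀ (by norm_num) hn
  have hX0 : 0 < X := by linarith
  have hX1 : 1 ≤ X := by linarith
  have hpiece : ∀ I J : ℕ, I ≤ J → ((S.filter fun t => (i t, j t) = (I, J)).card : ℝ) ≤
      K * 4 ^ P.card * (X ^ (3 * I + J) / g + X ^ (4 * I) / X ^ J) := by
    intro I J hIJ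
    set S' := S.filter fun t => (i t, j t) = (I, J) with hS'
    have hS'S : ∀ t ∈ S', t ∈ S ∧ i t = I ∧ j t = J := by
      intro t ht
      have := Finset.mem_filter.mp ht
      simpa using this
    obtain ⟨Z, hZ, hZc⟩ := hbox (2 ^ (J - I)) (one_le_pow₀ (by norm_num))
    set W := S' ×ˢ Z with hW
    have hWm : ∀ u : ι × 𝓞 k, u ∈ W → u.1 ∈ S ∧ i u.1 = I ∧ j u.1 = J ∧
        ∀ φ : k →+* ℂ, ‖φ u.2‖ ≤ 2 ^ (J - I) := by
      intro u hu
      obtain ⟨h1, h2⟩ := Finset.mem_product.mp hu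
      obtain ⟨h3, h4, h5⟩ := hS'S _ h1
      exact ⟨h3, h4, h5, hZ _ h2⟩
    have hm' := fun (u : ι × 𝓞 k) (hu : u ∈ W) => hm u.1 (hWm u hu).1 u.2 (by
      rw [(hWm u hu).2.1, (hWm u hu).2.2.1]; exact (hWm u hu).2.2.2)
    choose! a b c' e β β' ρ₁ ρ' hβ hρ₁ hne hβ0 hβ'0 ha hb hc he hna hnb hnc hne' ha0 hF using hm'
    set Q := W.image fun u => (a u, b u, c' u, e u) with hQ
    have h1 : W.card ≤ 2 * Q.card := by
      refine card_le_two_mul_card_image_moments W a b c' e β β' ρ₁ ρ' hne hβ0 hβ'0 ha hb hc he ?_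
      intro u hu v hv huv hβuv
      have hadj : ∀ u ∈ W, k⟮ρ₁ u⟯ = k⟮r u.1⟯ := by
        intro u hu
        have hu1 := (hWm u hu).1
        refine mem_adjoin_of_mem_of_finrank_two
          (finrank_adjoin_sqrt (hS _ hu1).sq_eq (hS _ hu1).notMem) ?_ ?_
        · rw [hρ₁ u hu]
          exact add_mem (hρ _ hu1) (IntermediateField.algebraMap_mem _ _)
        · rintro ⟨z, hz⟩
          refine hρk _ hu1 ⟨z - u.2, ?_⟩
          rw [map_sub, hz, hρ₁ u hu]
          ring
      have hu1 := (hWm u hu).1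
      have hv1 := (hWm v hv).1
      have hr : r u.1 = r v.1 := hsep1 _ hu1 _ hv1 (by rw [← hadj u hu, ← hadj v hv, huv])
      have hβu := hβ u hu
      have hβv := hβ v hv
      have hM : (M : Ω) ≠ 0 := fun h => hβ0 u hu (by rw [hβu, h]; simp)
      have hru : r u.1 ≠ 0 := fun h => hβ0 u hu (by rw [hβu, h]; simp)
      have hγu : algebraMap k Ω (x u.1) + algebraMap k Ω (y u.1) * r u.1 ≠ 0 :=
        fun h => hβ0 u hu (by rw [hβu, h]; simp)
      have hγv : algebraMap k Ω (x v.1) + algebraMap k Ω (y v.1) * r v.1 ≠ 0 :=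
        fun h => hβ0 v hv (by rw [hβv, h]; simp)
      have huv1 : u.1 = v.1 := by
        refine hsep2 _ hu1 _ hv1 hr (ω u.1 / ω v.1)
          (div_mem (hω _ hu1) (by rw [hr]; exact hω _ hv1)) ?_
        rw [hβu, hβv] at hβuv
        have hωv := hω0 _ hv1
        rw [hr] at hβuv hru hγu ⊢
        exact eq_mul_div_pow_three hM hru hγu hγv hωv hβuv
      refine Prod.ext huv1 ?_
      rw [hρ₁ u hu, hρ₁ v hv, huv1, add_right_inj] at huv
      exact FaithfulSMul.algebraMap_injective (𝓞 k) k ((algebraMap k Ω).injective huv)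
    have hQm : ∀ t ∈ Q, ∃ u ∈ W, (a u, b u, c' u, e u) = t := fun t ht => Finset.mem_image.mp ht
    have hpow1 : ∀ m : ℕ, (1 : ℝ) ≤ 2 ^ m := fun m => one_le_pow₀ one_le_two
    have h2 := card_quadruples_le (k := k) P (fun p hp => ⟨(hP p hp).1, (hP p hp).2.1⟩)
      (Xa := C * (2 ^ (2 * I) / 2 ^ J)) (Xb := C * 2 ^ I) (Xc := C * 2 ^ J)
      (Xe := C * (2 ^ (2 * J) / 2 ^ I)) (by positivity)
      (one_le_mul_of_one_le_of_one_le hC (hpow1 _)) (one_le_mul_of_one_le_of_one_le hC (hpow1 _))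
      (by positivity) Q
      (by
        intro t ht φ
        obtain ⟨u, hu, rfl⟩ := hQm t ht
        have := hna u hu φ
        rwa [(hWm u hu).2.1, (hWm u hu).2.2.1] at this)
      (by
        intro t ht φ
        obtain ⟨u, hu, rfl⟩ := hQm t ht
        have := hnb u hu φ
        rwa [(hWm u hu).2.1] at this)
      (by
        intro t ht φ
        obtain ⟨u, hu, rfl⟩ := hQm t ht
        have := hnc u hu φ
        rwa [(hWm u hu).2.2.1] at this)
      (by
        intro t ht φ
        obtain ⟨u, hu, rfl⟩ := hQm t ht
        have := hne' u hu φ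
        rwa [(hWm u hu).2.1, (hWm u hu).2.2.1] at this)
      (by
        intro t ht
        obtain ⟨u, hu, rfl⟩ := hQm t ht
        exact ha0 u hu)
      (by
        intro t ht p hp
        obtain ⟨u, hu, rfl⟩ := hQm t ht
        exact hF u hu p (hP p hp).1 (hSP _ (hWm u hu).1 p hp) (hP p hp).2.2)
    have h3 : (W.card : ℝ) ≤ 2 * Q.card := by exact_mod_cast h1
    rw [hW, Finset.card_product, Nat.cast_mul] at h3
    have hpw : ∀ m : ℕ, ((2 : ℝ) ^ m) ^ Module.finrank ℚ k = X ^ m := fun m => by rw [hX]; ring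
    rw [hpw] at hZc
    have h4 : (S'.card : ℝ) * (c₀ * X ^ (J - I)) ≤ 2 * (8 * (64 ^ Module.finrank ℚ k) ^ 4 * 4 ^ P.card *
        ((C * (2 ^ (2 * I) / 2 ^ J)) ^ Module.finrank ℚ k * (C * 2 ^ I) ^ Module.finrank ℚ k * (C * 2 ^ J) ^ Module.finrank ℚ k) *
        ((C * (2 ^ (2 * J) / 2 ^ I)) ^ Module.finrank ℚ k / g + 1)) := by
      calc _ ≤ (S'.card : ℝ) * Z.card := by gcongr
        _ ≤ 2 * Q.card := h3
        _ ≤ _ := by gcongr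
    have e1 : (C * (2 ^ (2 * I) / 2 ^ J)) ^ Module.finrank ℚ k = C ^ Module.finrank ℚ k * ((X ^ I) ^ 2 / X ^ J) := by
      rw [(mul_pow _ _ _), div_pow, hpw, hpw, ← pow_mul, mul_comm 2 I]
    have e2 : (C * (2 ^ (2 * J) / 2 ^ I)) ^ Module.finrank ℚ k = C ^ Module.finrank ℚ k * ((X ^ J) ^ 2 / X ^ I) := by
      rw [(mul_pow _ _ _), div_pow, hpw, hpw, ← pow_mul, mul_comm 2 J]
    have e3 : ∀ m : ℕ, (C * 2 ^ m) ^ Module.finrank ℚ k = C ^ Module.finrank ℚ k * X ^ m := fun m => by rw [(mul_pow _ _ _), hpw]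
    have e4 : X ^ (J - I) = X ^ J / X ^ I := by
      rw [eq_div_iff (by positivity), ← pow_add, Nat.sub_add_cancel hIJ]
    have e5 : X ^ (3 * I + J) = (X ^ I) ^ 3 * X ^ J := by rw [pow_add, mul_comm 3 I, pow_mul]
    have e6 : X ^ (4 * I) = (X ^ I) ^ 4 := by rw [mul_comm 4 I, pow_mul]
    rw [e1, e2, e3, e3, e4] at h4
    rw [e5, e6]
    have hA : 0 < X ^ I := by positivity
    have hB : 0 < X ^ J := by positivity
    set A := X ^ I
    set B := X ^ J
    set D := C ^ Module.finrank ℚ k with hD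
    have hD1 : 1 ≤ D := one_le_pow₀ hC
    have h5 : (S'.card : ℝ) * (c₀ * (B / A)) ≤ 2 * (8 * (64 ^ Module.finrank ℚ k) ^ 4 * 4 ^ P.card *
        (D * (A ^ 2 / B) * (D * A) * (D * B)) * (D * (B ^ 2 / A) / g + D)) :=
      h4.trans (by gcongr)
    have h6 : (S'.card : ℝ) * (c₀ * (B / A)) ≤
        (K * 4 ^ P.card * (A ^ 3 * B / g + A ^ 4 / B)) * (c₀ * (B / A)) := by
      refine h5.trans (le_of_eq ?_)
      rw [hK]
      field_simp
      ring
    exact le_of_mul_le_mul_right h6 (by positivity)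
  rcases S.eq_empty_or_nonempty with rfl | hne
  · simp only [Finset.card_empty, Nat.cast_zero]
    positivity
  obtain ⟨t₀, ht₀, hL⟩ := Finset.exists_max_image S (fun t => i t + j t) hne
  set L := i t₀ + j t₀ with hLdef
  set V : ℝ := C * Real.sqrt Y with hV
  have hV0 : 0 ≤ V := by positivity
  have hLV : X ^ L ≤ V := by
    have h1 : X ^ L = (2 ^ (i t₀ + j t₀)) ^ Module.finrank ℚ k := by rw [hX]; ring
    rw [h1]
    refine (hsz t₀ ht₀).trans ?_
    rw [hV]
    gcongr
    exact hSY t₀ ht₀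
  have hV2 : V ^ 2 = C ^ 2 * Y := by rw [hV, mul_pow, Real.sq_sqrt hY]
  have hV3 : V ^ 3 ≤ (C ^ 2 * Y ^ ((3 : ℝ) / 4)) ^ 2 := by
    have h1 : Real.sqrt Y ^ 3 = (Y ^ ((3 : ℝ) / 4)) ^ 2 := by
      rw [Real.sqrt_eq_rpow, ← Real.rpow_natCast, ← Real.rpow_natCast, ← Real.rpow_mul hY,
        ← Real.rpow_mul hY]
      norm_num
    rw [hV, mul_pow, mul_pow, h1]
    gcongr
    rw [← pow_mul]
    exact pow_le_pow_right₀ hC (by norm_num)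
  have hY34 : 0 ≤ Y ^ ((3 : ℝ) / 4) := Real.rpow_nonneg hY _
  have hterm : ∀ p ∈ S.image (fun t => (i t, j t)),
      ((S.filter fun t => (i t, j t) = p).card : ℝ) ≤ K * C ^ 2 * 4 ^ P.card *
        (Y / g + Y ^ ((3 : ℝ) / 4)) *
          ((1 / 2) ^ (p.2 - p.1) * (1 / 2) ^ (L - (p.1 + p.2))) := by
    intro p hp
    obtain ⟨t, ht, rfl⟩ := Finset.mem_image.mp hp
    have h1 := hpiece _ _ (hij t ht)
    have h2 := hL t ht
    have h3 := hij t ht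
    simp only at h2 ⊢
    set I := i t
    set J := j t
    set T := J - I with hT
    set U := L - (I + J) with hU
    have hTU : (0 : ℝ) < 2 ^ T * 2 ^ U := by positivity
    have hle2 : ∀ m : ℕ, (2 : ℝ) ^ m ≤ X ^ m := fun m => pow_le_pow_left₀ (by norm_num) hX2 m
    have k1 : X ^ (3 * I + J) * (2 ^ T * 2 ^ U) ≤ C ^ 2 * Y := by
      calc _ ≤ X ^ (3 * I + J) * (X ^ T * X ^ (2 * U)) := by
            have h4 : (2 : ℝ) ^ U ≤ X ^ (2 * U) :=
              (hle2 U).trans (pow_le_pow_right₀ hX1 (by omega))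
            have := hle2 T
            gcongr
        _ = (X ^ L) ^ 2 := by
            rw [← pow_add, ← pow_add, ← pow_mul]
            congr 1
            omega
        _ ≤ V ^ 2 := by gcongr
        _ = _ := hV2
    have k2 : X ^ (4 * I) / X ^ J * (2 ^ T * 2 ^ U) ≤ C ^ 2 * Y ^ ((3 : ℝ) / 4) := by
      refine le_of_sq_le_sq ?_ (by positivity)
      refine le_trans ?_ hV3
      calc _ ≤ (X ^ (4 * I) / X ^ J * (X ^ T * X ^ U)) ^ 2 := by
            have := hle2 T
            have := hle2 U
            gcongr
        _ = X ^ (2 * (4 * I + T + U)) / X ^ (2 * J) := by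
            rw [pow_mul' _ 2, pow_mul' _ 2, ← div_pow, pow_add, pow_add]
            congr 1
            ring
        _ ≤ (X ^ L) ^ 3 := by
            rw [div_le_iff₀ (by positivity), ← pow_mul, ← pow_add]
            exact pow_le_pow_right₀ hX1 (by omega)
        _ ≤ V ^ 3 := by gcongr
    have k3 : ((1 : ℝ) / 2) ^ T * (1 / 2) ^ U = 1 / (2 ^ T * 2 ^ U) := by
      rw [div_pow, div_pow, one_pow, one_pow]
      field_simp
    rw [k3, mul_one_div, le_div_iff₀ hTU]
    calc _ ≤ K * 4 ^ P.card * (X ^ (3 * I + J) / g + X ^ (4 * I) / X ^ J) * (2 ^ T * 2 ^ U) := by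
          gcongr
      _ = K * 4 ^ P.card * (X ^ (3 * I + J) * (2 ^ T * 2 ^ U) / g +
            X ^ (4 * I) / X ^ J * (2 ^ T * 2 ^ U)) := by ring
      _ ≤ K * 4 ^ P.card * (C ^ 2 * Y / g + C ^ 2 * Y ^ ((3 : ℝ) / 4)) := by gcongr
      _ = _ := by ring
  have hcard : (S.card : ℝ) = ∑ p ∈ S.image (fun t => (i t, j t)),
      ((S.filter fun t => (i t, j t) = p).card : ℝ) := by
    rw [Finset.card_eq_sum_card_image (fun t => (i t, j t)) S, Nat.cast_sum]
  have hgeo : ∑ p ∈ S.image (fun t => (i t, j t)),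
      ((1 : ℝ) / 2) ^ (p.2 - p.1) * (1 / 2) ^ (L - (p.1 + p.2)) ≤ 4 := by
    rw [← Finset.sum_image (s := S.image (fun t => (i t, j t)))
      (f := fun p : ℕ × ℕ => ((1 : ℝ) / 2) ^ p.1 * (1 / 2) ^ p.2)
      (g := fun p => (p.2 - p.1, L - (p.1 + p.2)))]
    · exact sum_half_pow_mul_le _
    · intro p hp q hq hpq
      obtain ⟨t, ht, rfl⟩ := Finset.mem_image.mp hp
      obtain ⟨u, hu, rfl⟩ := Finset.mem_image.mp hq
      simp only [Prod.mk.injEq] at hpq ⊢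
      have h1 := hL t ht
      have h2 := hL u hu
      have h3 := hij t ht
      have h4 := hij u hu
      omega
  rw [hcard]
  refine (Finset.sum_le_sum hterm).trans ?_
  rw [← Finset.mul_sum]
  calc _ ≤ K * C ^ 2 * 4 ^ P.card * (Y / g + Y ^ ((3 : ℝ) / 4)) * 4 := by gcongr
    _ = 4 * K * C ^ 2 * 4 ^ P.card * (Y / g + Y ^ ((3 : ℝ) / 4)) := by ring
    _ ≤ _ := by
      gcongr
      exact le_max_right _ _

end main

end

/-- There are boundedly many classes modulo cubes of elements generating the cube of an ideal. -/
theorem card_le_of_ideal_cube (k : Type*) [Field k] [NumberField k] : ∃ C : ℝ, 1 ≤ C ∧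
    ∀ S : Finset k, (∀ γ ∈ S, γ ≠ 0 ∧ ∃ I : (FractionalIdeal (nonZeroDivisors (𝓞 k)) k)ˣ,
      FractionalIdeal.spanSingleton (nonZeroDivisors (𝓞 k)) γ = I.1 ^ 3) →
    (∀ γ ∈ S, ∀ γ' ∈ S, ∀ z, γ = γ' * z ^ 3 → γ = γ') → (S.card : ℝ) ≤ C := by
  set T : ℝ := Real.sqrt |(NumberField.discr k : ℝ)| + 1 with hT
  have hT1 : 1 ≤ T := by rw [hT]; linarith [Real.sqrt_nonneg |(NumberField.discr k : ℝ)|]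
  have hn : Module.finrank ℚ k ≠ 0 := Module.finrank_pos.ne'
  refine ⟨2 * 64 ^ Module.finrank ℚ k * (8 * T ^ 3) ^ Module.finrank ℚ k, ?_, ?_⟩
  · have h1 : (1 : ℝ) ≤ 64 ^ Module.finrank ℚ k := one_le_pow₀ (by norm_num)
    have h2 : 1 ≤ T ^ 3 := one_le_pow₀ hT1
    have h3 : (1 : ℝ) ≤ (8 * T ^ 3) ^ Module.finrank ℚ k := one_le_pow₀ (by linarith)
    nlinarith
  intro S hS hsep
  have key : ∀ γ ∈ S, ∃ (t : 𝓞 k) (ω : k), ω ≠ 0 ∧ ω ^ 3 = γ * t ∧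
      ∀ φ : k →+* ℂ, ‖φ t‖ ≤ 8 * T ^ 3 := by
    intro γ hγ
    obtain ⟨hγ0, I, hI⟩ := hS γ hγ
    have hIpos : (0 : ℝ) < FractionalIdeal.absNorm I.1 := by
      have h0 : FractionalIdeal.absNorm I.1 ≠ 0 := by
        rw [Ne, FractionalIdeal.absNorm_eq_zero_iff]
        exact I.ne_zero
      exact_mod_cast lt_of_le_of_ne (FractionalIdeal.absNorm_nonneg _) h0.symm
    have hprod : ∏ w : NumberField.InfinitePlace k, cubeWt γ w.embedding ^ w.mult =
        FractionalIdeal.absNorm I.1 := by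
      rw [← pow_left_inj₀ (Finset.prod_nonneg fun w _ => pow_nonneg (cubeWt_pos hγ0 _).le _)
        hIpos.le three_ne_zero, ← Finset.prod_pow]
      simp_rw [pow_right_comm _ _ 3, cubeWt_pow_three, NumberField.InfinitePlace.norm_embedding_eq]
      rw [NumberField.InfinitePlace.prod_eq_abs_norm, ← FractionalIdeal.absNorm_span_singleton
        (𝓞 k), hI, map_pow, Rat.cast_pow]
    obtain ⟨ω, hω0, hωI, hω⟩ := exists_ne_zero_mem_lt_of_lt_prod I
      (fun w => ⟨T * cubeWt γ w.embedding, mul_nonneg (by linarith) (cubeWt_pos hγ0 _).le⟩) (by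
        change _ < ∏ w : NumberField.InfinitePlace k, (T * cubeWt γ w.embedding) ^ w.mult
        simp only [mul_pow, Finset.prod_mul_distrib, Finset.prod_pow_eq_pow_sum]
        rw [hprod, NumberField.InfinitePlace.sum_mult_eq, mul_comm]
        refine mul_lt_mul_of_pos_right ?_ hIpos
        calc _ < T := by rw [hT]; linarith
          _ = T ^ 1 := (pow_one _).symm
          _ ≤ _ := pow_le_pow_right₀ hT1 (Nat.one_le_iff_ne_zero.mpr hn))
    obtain ⟨t, ht⟩ := mul_mul_eq_mul_integer hI hωI hωI hωI
    refine ⟨t, ω, hω0, by rw [← ht]; ring, fun φ => ?_⟩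
    have h1 : NumberField.InfinitePlace.mk φ ω <
      2 * (T * cubeWt γ (NumberField.InfinitePlace.mk φ).embedding) :=
      hω (NumberField.InfinitePlace.mk φ)
    have h2 : cubeWt γ (NumberField.InfinitePlace.mk φ).embedding = cubeWt γ φ := by
      rw [cubeWt, cubeWt, NumberField.InfinitePlace.norm_embedding_eq,
        NumberField.InfinitePlace.apply]
    rw [h2, NumberField.InfinitePlace.apply] at h1
    have h3 : ‖φ ω‖ ^ 3 ≤ (2 * (T * cubeWt γ φ)) ^ 3 :=
      pow_le_pow_left₀ (norm_nonneg _) h1.le 3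
    rw [← norm_pow, ← map_pow, show ω ^ 3 = γ * t by rw [← ht]; ring, map_mul, norm_mul,
      mul_pow, mul_pow, cubeWt_pow_three] at h3
    have h4 : 0 < ‖φ γ‖ := norm_pos_iff.mpr ((map_ne_zero φ).mpr hγ0)
    refine le_of_mul_le_mul_left (h3.trans (le_of_eq ?_)) h4
    ring
  choose! t ω hω0 hω hb using key
  have hinj : Set.InjOn t S := by
    intro γ hγ γ' hγ' h
    refine hsep γ hγ γ' hγ' (ω γ / ω γ') ?_
    have h1 := hω γ hγ
    have h2 := hω γ' hγ'
    have ht0 : (t γ' : k) ≠ 0 := fun h0 => by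
      rw [h0, mul_zero] at h2
      exact hω0 γ' hγ' (pow_eq_zero_iff three_ne_zero |>.mp h2)
    have hγ0 := (hS γ' hγ').1
    rw [div_pow, h1, h2, h]
    field_simp
  rw [← Finset.card_image_of_injOn hinj]
  refine card_le_of_box_one (k := k) ?_ _ ?_
  · have h2 : 1 ≤ T ^ 3 := one_le_pow₀ hT1
    linarith
  · intro x hx φ
    obtain ⟨γ, hγ, rfl⟩ := Finset.mem_image.mp hx
    exact hb γ hγ φ

open IsDedekindDomain in
/-- The order of vanishing of an element of a number field at a prime. -/
def vord {K : Type*} [Field K] [NumberField K] (v : HeightOneSpectrum (𝓞 K)) (x : K) : ℤ :=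
  -(WithZero.log (v.valuation K x))

section VOrd
open IsDedekindDomain

variable {K : Type*} [Field K] [NumberField K] (v : HeightOneSpectrum (𝓞 K))

theorem vord_one : vord v (1 : K) = 0 := by simp [vord]

theorem vord_mul {x y : K} (hx : x ≠ 0) (hy : y ≠ 0) : vord v (x * y) = vord v x + vord v y := by
  have h1 : v.valuation K x ≠ 0 := (Valuation.ne_zero_iff _).2 hx
  have h2 : v.valuation K y ≠ 0 := (Valuation.ne_zero_iff _).2 hy
  rw [vord, vord, vord, map_mul, WithZero.log_mul h1 h2]; ring

theorem vord_pow (x : K) (n : ℕ) : vord v (x ^ n) = n * vord v x := by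
  rw [vord, vord, map_pow, WithZero.log_pow]; simp

theorem vord_inv (x : K) : vord v x⁻¹ = -vord v x := by
  rw [vord, vord, map_inv₀, WithZero.log_inv]

theorem vord_div {x y : K} (hx : x ≠ 0) (hy : y ≠ 0) : vord v (x / y) = vord v x - vord v y := by
  rw [div_eq_mul_inv, vord_mul v hx (inv_ne_zero hy), vord_inv]; ring

theorem vord_neg (x : K) : vord v (-x) = vord v x := by
  rw [vord, vord, Valuation.map_neg]

theorem vord_nonneg_iff {x : K} (hx : x ≠ 0) : 0 ≤ vord v x ↔ v.valuation K x ≤ 1 := by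
  have h1 : v.valuation K x ≠ 0 := (Valuation.ne_zero_iff _).2 hx
  rw [vord, ← WithZero.log_le_log h1 one_ne_zero, WithZero.log_one]
  constructor <;> intro h <;> linarith

theorem vord_pos_iff {x : K} (hx : x ≠ 0) : 0 < vord v x ↔ v.valuation K x < 1 := by
  have h1 : v.valuation K x ≠ 0 := (Valuation.ne_zero_iff _).2 hx
  rw [vord, ← WithZero.log_lt_log h1 one_ne_zero, WithZero.log_one]
  constructor <;> intro h <;> linarith

theorem vord_int_nonneg (x : 𝓞 K) : 0 ≤ vord v (x : K) := by
  by_cases hx : (x : K) = 0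
  · rw [hx]; simp [vord]
  exact (vord_nonneg_iff v hx).2 (v.valuation_le_one x)

theorem vord_int_pos_iff {x : 𝓞 K} (hx : x ≠ 0) : 0 < vord v (x : K) ↔ x ∈ v.asIdeal := by
  have hx' : (x : K) ≠ 0 := by simpa using hx
  rw [vord_pos_iff v hx']
  exact v.valuation_lt_one_iff_mem x

theorem vord_int_eq_zero {x : 𝓞 K} (hx : x ∉ v.asIdeal) : vord v (x : K) = 0 := by
  have h0 : x ≠ 0 := by rintro rfl; exact hx (zero_mem _)
  have := vord_int_nonneg v x
  have h2 := mt (vord_int_pos_iff v h0).1 hx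
  omega

theorem exists_vord_eq (n : ℤ) : ∃ x : K, x ≠ 0 ∧ vord v x = n := by
  obtain ⟨x, hx⟩ := v.valuation_surjective K (WithZero.exp (-n))
  refine ⟨x, ?_, by rw [vord, hx]; simp⟩
  rintro rfl
  rw [map_zero] at hx
  exact WithZero.exp_ne_zero hx.symm

theorem exists_mul_eq_integer_of_vord_nonneg {x : K} (hx : x ≠ 0) (h : 0 ≤ vord v x) :
    ∃ (c : 𝓞 K), c ∉ v.asIdeal ∧ ∃ y : 𝓞 K, (c : K) * x = y := by
  obtain ⟨n, d, h⟩ := v.exists_primeCompl_mul_eq_of_integer x ((vord_nonneg_iff v hx).1 h)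
  exact ⟨d.1, d.2, n, by rw [mul_comm]; exact h⟩

end VOrd

section Tower
open IsDedekindDomain

variable {k K : Type*} [Field k] [NumberField k] [Field K] [NumberField K] [Algebra k K]

theorem exists_primeAbove (K : Type*) [Field K] [NumberField K] [Algebra k K]
    (v : HeightOneSpectrum (𝓞 k)) :
    ∃ w : HeightOneSpectrum (𝓞 K), w.asIdeal.LiesOver v.asIdeal := by
  haveI := v.isMaximal
  obtain ⟨P, hP, hPv⟩ := Ideal.exists_maximal_ideal_liesOver_of_isIntegral v.asIdeal (S := 𝓞 K)
  exact ⟨⟨P, hP.isPrime, Ideal.ne_bot_of_liesOver_of_ne_bot v.ne_bot P⟩, hPv⟩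

theorem exists_primeBelow (k : Type*) {K : Type*} [Field k] [NumberField k] [Field K]
    [NumberField K] [Algebra k K] (w : HeightOneSpectrum (𝓞 K)) :
    ∃ v : HeightOneSpectrum (𝓞 k), w.asIdeal.LiesOver v.asIdeal := by
  haveI := w.isPrime
  refine ⟨⟨w.asIdeal.under (𝓞 k), inferInstance, ?_⟩, inferInstance⟩
  exact mt Ideal.eq_bot_of_comap_eq_bot w.ne_bot

/-- Ramification index. -/
def ramIdx (v : HeightOneSpectrum (𝓞 k)) (w : HeightOneSpectrum (𝓞 K)) : ℕ :=
  v.asIdeal.ramificationIdx' w.asIdeal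

theorem vord_algebraMap (v : HeightOneSpectrum (𝓞 k)) (w : HeightOneSpectrum (𝓞 K))
    [w.asIdeal.LiesOver v.asIdeal] (x : k) :
    vord w (algebraMap k K x) = ramIdx v w * vord v x := by
  rw [vord, vord, ← HeightOneSpectrum.valuation_liesOver K v w x, WithZero.log_pow, ramIdx]
  simp

theorem ramIdx_pos (v : HeightOneSpectrum (𝓞 k)) (w : HeightOneSpectrum (𝓞 K))
    [w.asIdeal.LiesOver v.asIdeal] : 0 < ramIdx v w := by
  haveI := w.isPrime
  exact Nat.pos_of_ne_zero
    (Ideal.IsDedekindDomain.ramificationIdx'_ne_zero_of_liesOver w.asIdeal v.ne_bot)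

theorem ramIdx_le_finrank (v : HeightOneSpectrum (𝓞 k)) (w : HeightOneSpectrum (𝓞 K))
    [w.asIdeal.LiesOver v.asIdeal] : ramIdx v w ≤ Module.finrank k K := by
  haveI := w.isPrime
  haveI := v.isMaximal
  have h := Ideal.sum_ramification_inertia (𝓞 K) k K (p := v.asIdeal) v.ne_bot
  have hP : w.asIdeal ∈ IsDedekindDomain.primesOverFinset v.asIdeal (𝓞 K) :=
    (IsDedekindDomain.mem_primesOverFinset_iff v.ne_bot _).mpr ⟨w.isPrime, ‹_›⟩
  rw [← h, ← Finset.add_sum_erase _ _ hP]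
  refine le_trans (Nat.le_mul_of_pos_right _ ?_) (Nat.le_add_right _ _)
  exact Nat.pos_iff_ne_zero.mpr <| Ideal.inertiaDeg'_ne_zero v.asIdeal w.asIdeal

theorem ramIdx_tower {M : Type*} [Field M] [NumberField M] [Algebra k M] [Algebra K M]
    [IsScalarTower k K M] (v : HeightOneSpectrum (𝓞 k)) (w : HeightOneSpectrum (𝓞 K))
    (u : HeightOneSpectrum (𝓞 M)) [w.asIdeal.LiesOver v.asIdeal] [u.asIdeal.LiesOver w.asIdeal] :
    ramIdx v u = ramIdx v w * ramIdx w u := by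
  haveI := u.isPrime
  exact Ideal.ramificationIdx'_algebra_tower' v.asIdeal w.asIdeal u.asIdeal

theorem asIdeal_pow_ramIdx_dvd (v : HeightOneSpectrum (𝓞 k)) (w : HeightOneSpectrum (𝓞 K)) :
    w.asIdeal ^ ramIdx v w ∣ v.asIdeal.map (algebraMap (𝓞 k) (𝓞 K)) :=
  Ideal.dvd_iff_le.2 Ideal.le_pow_ramificationIdx'

theorem liesOver_of_map_le {v : HeightOneSpectrum (𝓞 k)} {P : Ideal (𝓞 K)} (hP : P.IsPrime)
    (h : v.asIdeal.map (algebraMap (𝓞 k) (𝓞 K)) ≤ P) : P.LiesOver v.asIdeal := by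
  have := v.isMaximal
  refine ⟨(this.eq_of_le (Ideal.IsPrime.comap _ |>.ne_top) (Ideal.map_le_iff_le_comap.1 h))⟩

theorem ramIdx_eq_three_of_map_eq {v : HeightOneSpectrum (𝓞 k)} {P : Ideal (𝓞 K)}
    (hP : P.IsPrime) (h : v.asIdeal.map (algebraMap (𝓞 k) (𝓞 K)) = P ^ 3)
    (w : HeightOneSpectrum (𝓞 K)) [hw : w.asIdeal.LiesOver v.asIdeal] : ramIdx v w = 3 := by
  have hm := Ideal.map_ne_bot_of_ne_bot (S := 𝓞 K) v.ne_bot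
  have hP0 : P ≠ ⊥ := by rintro rfl; exact hm (h.trans (Ideal.bot_pow three_ne_zero))
  have hwP : w.asIdeal = P := by
    have h1 : P ^ 3 ≤ w.asIdeal := by
      rw [← h, Ideal.map_le_iff_le_comap]; exact hw.over.le
    have h2 : P ≤ w.asIdeal := w.isPrime.le_of_pow_le h1
    exact ((hP.isMaximal hP0).eq_of_le w.isPrime.ne_top h2).symm
  refine Ideal.ramificationIdx'_spec (by rw [h, hwP]) ?_
  rw [h, hwP]
  exact (Ideal.pow_succ_lt_pow hP0 3).not_ge

theorem exists_ramIdx_eq_two_of_map_eq {v : HeightOneSpectrum (𝓞 k)} {P Q : Ideal (𝓞 K)}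
    (hP : P.IsPrime) (hQ : Q.IsPrime) (hPQ : P ≠ Q)
    (h : v.asIdeal.map (algebraMap (𝓞 k) (𝓞 K)) = P ^ 2 * Q) :
    ∃ w : HeightOneSpectrum (𝓞 K), w.asIdeal.LiesOver v.asIdeal ∧ ramIdx v w = 2 := by
  have hm := Ideal.map_ne_bot_of_ne_bot (S := 𝓞 K) v.ne_bot
  have hP0 : P ≠ ⊥ := by rintro rfl; exact hm (h.trans (by rw [Ideal.bot_pow two_ne_zero, Ideal.bot_mul]))
  have hQ0 : Q ≠ ⊥ := by rintro rfl; exact hm (h.trans (Ideal.mul_bot _))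
  refine ⟨⟨P, hP, hP0⟩, liesOver_of_map_le hP ?_, ?_⟩
  · rw [h, pow_two, mul_assoc]; exact Ideal.mul_le_left
  refine Ideal.ramificationIdx'_spec (by rw [h]; exact Ideal.mul_le_left) ?_
  rw [h]
  intro hle
  have h1 : P ^ 2 * P ∣ P ^ 2 * Q := by rw [← pow_succ]; exact Ideal.dvd_iff_le.2 hle
  have h2 : Q ≤ P := Ideal.dvd_iff_le.1 ((mul_dvd_mul_iff_left (pow_ne_zero 2 hP0)).1 h1)
  exact hPQ ((hQ.isMaximal hQ0).eq_of_le hP.ne_top h2).symm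

theorem absNorm_le_of_liesOver (v : HeightOneSpectrum (𝓞 k)) (w : HeightOneSpectrum (𝓞 K))
    [w.asIdeal.LiesOver v.asIdeal] : Ideal.absNorm v.asIdeal ≤ Ideal.absNorm w.asIdeal := by
  haveI := v.isMaximal
  haveI := w.isPrime
  rw [Ideal.absNorm_eq_pow_inertiaDeg'_of_liesOver w.asIdeal v.asIdeal v.isPrime v.ne_bot]
  exact Nat.le_self_pow (Ideal.inertiaDeg'_ne_zero v.asIdeal w.asIdeal) _

theorem map_eq_pow_three_of_ramIdx_eq (h3 : Module.finrank k K = 3)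
    (v : HeightOneSpectrum (𝓞 k)) (w : HeightOneSpectrum (𝓞 K))
    [w.asIdeal.LiesOver v.asIdeal] (h : ramIdx v w = 3) :
    v.asIdeal.map (algebraMap (𝓞 k) (𝓞 K)) = w.asIdeal ^ 3 := by
  obtain ⟨I, hI⟩ := asIdeal_pow_ramIdx_dvd v w
  rw [h] at hI
  have hN : Ideal.absNorm (v.asIdeal.map (algebraMap (𝓞 k) (𝓞 K))) = Ideal.absNorm v.asIdeal ^ 3 := by
    rw [Ideal.absNorm_algebraMap, ← h3, IsFractionRing.finrank_eq (𝓞 k) k (𝓞 K) K]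
  have h1 := absNorm_le_of_liesOver v w
  have h0 : 0 < Ideal.absNorm v.asIdeal :=
    Nat.pos_of_ne_zero (by rw [Ne, Ideal.absNorm_eq_zero_iff]; exact v.ne_bot)
  rw [hI, map_mul, map_pow] at hN
  have h2 : Ideal.absNorm v.asIdeal ^ 3 ≤ Ideal.absNorm w.asIdeal ^ 3 := Nat.pow_le_pow_left h1 3
  have h4 : 0 < Ideal.absNorm v.asIdeal ^ 3 := by positivity
  have h5 : Ideal.absNorm I = 1 := by
    have : Ideal.absNorm I ≠ 0 := by
      intro h6; rw [h6, mul_zero] at hN; omega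
    by_contra h7
    have h8 : 2 ≤ Ideal.absNorm I := by omega
    nlinarith
  rw [Ideal.absNorm_eq_one_iff] at h5
  rw [hI, h5, Ideal.mul_top]

end Tower

section Ramification
open IsDedekindDomain

theorem ramIdx_eq_one_of_pow_eq {F L : Type*} [Field F] [NumberField F] [Field L] [NumberField L]
    [Algebra F L] (v : HeightOneSpectrum (𝓞 F)) (w : HeightOneSpectrum (𝓞 L))
    [hw : w.asIdeal.LiesOver v.asIdeal] {m : ℕ} (hm0 : m ≠ 0) (hm : ((m : ℕ) : 𝓞 F) ∉ v.asIdeal)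
    {y : L} (hy : Algebra.adjoin F {y} = ⊤) {a : F} (ha : a ≠ 0)
    (hya : y ^ m = algebraMap F L a) (hdvd : (m : ℤ) ∣ vord v a) : ramIdx v w = 1 := by
  obtain ⟨j, hj⟩ := hdvd
  obtain ⟨b, hb0, hb⟩ := exists_vord_eq v j
  have ha' : a / b ^ m ≠ 0 := div_ne_zero ha (pow_ne_zero _ hb0)
  have ha'v : vord v (a / b ^ m) = 0 := by
    rw [vord_div v ha (pow_ne_zero _ hb0), vord_pow, hb, hj]; ring
  obtain ⟨c, hc, α, hα⟩ := exists_mul_eq_integer_of_vord_nonneg v ha' ha'v.ge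
  have hc0 : (c : F) ≠ 0 := by
    intro h; apply hc; rw [show c = 0 by simpa using h]; exact zero_mem _
  have hα' : α ∉ v.asIdeal := by
    have hα0 : α ≠ 0 := by
      rintro rfl
      exact mul_ne_zero hc0 ha' (by simpa using hα)
    rw [← vord_int_pos_iff v hα0, ← hα, vord_mul v hc0 ha', vord_int_eq_zero v hc, ha'v]
    simp
  obtain ⟨m', rfl⟩ : ∃ m', m = m' + 1 := ⟨m - 1, by omega⟩
  set β : 𝓞 F := c ^ m' * α with hβ
  have hβ' : β ∉ v.asIdeal := by
    intro h
    rcases v.isPrime.mem_or_mem h with h | h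
    · exact hc (v.isPrime.mem_of_pow_mem _ h)
    · exact hα' h
  set y₀ : L := algebraMap F L (c / b) * y with hy₀
  have hy₀m : y₀ ^ (m' + 1) = algebraMap F L (β : F) := by
    rw [hy₀, mul_pow, hya, ← map_pow, ← map_mul]
    congr 1
    have : (β : F) = c ^ m' * α := by rw [hβ]; push_cast; ring
    rw [this, ← hα, div_pow]
    field_simp
    ring
  have hintegral : IsIntegral ℤ y₀ := by
    refine IsIntegral.of_pow (Nat.succ_pos m') ?_
    rw [hy₀m]
    exact (NumberField.RingOfIntegers.isIntegral_coe β).map (algebraMap F L).toIntAlgHom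
  obtain ⟨Y, hY⟩ : ∃ Y : 𝓞 L, (Y : L) = y₀ := ⟨⟨y₀, hintegral⟩, rfl⟩
  have hYm : Y ^ (m' + 1) = algebraMap (𝓞 F) (𝓞 L) β := by
    apply NumberField.RingOfIntegers.ext
    have : ((Y ^ (m' + 1) : 𝓞 L) : L) = (Y : L) ^ (m' + 1) := by push_cast; rfl
    rw [this, hY, hy₀m]
    rfl
  have hadj : Algebra.adjoin F {(Y : L)} = ⊤ := by
    rw [eq_top_iff, ← hy, hY]
    refine Algebra.adjoin_le (Set.singleton_subset_iff.2 ?_)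
    have : y = algebraMap F L (b / c) * y₀ := by
      rw [hy₀, ← mul_assoc, ← map_mul, show b / (c : F) * (c / b) = 1 by field_simp, map_one,
        one_mul]
    change y ∈ Algebra.adjoin F {y₀}
    nth_rewrite 1 [this]
    exact mul_mem (Subalgebra.algebraMap_mem _ _) (Algebra.subset_adjoin rfl)
  have hdiff := aeval_derivative_mem_differentIdeal_of_aeval_eq_zero Y hadj
    (Polynomial.X ^ (m' + 1) - Polynomial.C β) (by simp [hYm])
  by_contra hne
  have h1 := ramIdx_pos v w
  have h2 : 2 ≤ ramIdx v w := by omega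
  haveI := v.isMaximal
  have h3 := pow_sub_one_dvd_differentIdeal (A := 𝓞 F) (p := v.asIdeal) w.asIdeal _ v.ne_bot
    (asIdeal_pow_ramIdx_dvd v w)
  have h4 : differentIdeal (𝓞 F) (𝓞 L) ≤ w.asIdeal :=
    (Ideal.dvd_iff_le.1 h3).trans (Ideal.pow_le_self (by omega))
  have h5 := h4 hdiff
  have h6 : (algebraMap (𝓞 F) (𝓞 L) ((m' + 1 : ℕ) : 𝓞 F)) * Y ^ m' ∈ w.asIdeal := by
    simpa using h5
  have hiff : ∀ z : 𝓞 F, algebraMap (𝓞 F) (𝓞 L) z ∈ w.asIdeal → z ∈ v.asIdeal := by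
    intro z hz; rw [hw.over]; exact hz
  rcases w.isPrime.mem_or_mem h6 with h | h
  · exact hm (hiff _ h)
  · apply hβ'
    apply hiff
    rw [← hYm, pow_succ]
    exact Ideal.mul_mem_right _ _ h

variable {k K E M : Type*} [Field k] [NumberField k] [Field K] [NumberField K] [Field E]
  [NumberField E] [Field M] [NumberField M] [Algebra k K] [Algebra k E] [Algebra k M]
  [Algebra K M] [Algebra E M] [IsScalarTower k K M] [IsScalarTower k E M]

theorem three_dvd_ramIdx_of_pow_three_eq (v : HeightOneSpectrum (𝓞 E)) (w : HeightOneSpectrum (𝓞 M))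
    [w.asIdeal.LiesOver v.asIdeal] {δ : E} {u : M} (hu : u ^ 3 = algebraMap E M δ)
    (hδ : ¬ (3 : ℤ) ∣ vord v δ) : 3 ∣ ramIdx v w := by
  have h1 := vord_algebraMap v w δ
  rw [← hu, vord_pow] at h1
  have h2 : (3 : ℤ) ∣ ramIdx v w * vord v δ := ⟨_, h1.symm⟩
  rcases Int.prime_three.dvd_mul.1 h2 with h | h
  · exact_mod_cast h
  · exact absurd h hδ

theorem exists_ramIdx_eq_three (hK : Module.finrank k K = 3) (hM : Module.finrank K M ≤ 2)
    (p : HeightOneSpectrum (𝓞 k)) (v : HeightOneSpectrum (𝓞 E)) [v.asIdeal.LiesOver p.asIdeal]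
    {δ : E} {u : M} (hu : u ^ 3 = algebraMap E M δ) (hδ : ¬ (3 : ℤ) ∣ vord v δ) :
    ∃ w : HeightOneSpectrum (𝓞 K), w.asIdeal.LiesOver p.asIdeal ∧ ramIdx p w = 3 := by
  obtain ⟨Q, hQ⟩ := exists_primeAbove M v
  obtain ⟨w, hw⟩ := exists_primeBelow K Q
  haveI : Q.asIdeal.LiesOver p.asIdeal := Ideal.LiesOver.trans _ v.asIdeal _
  haveI : w.asIdeal.LiesOver p.asIdeal := Ideal.LiesOver.tower_bot Q.asIdeal _ _
  refine ⟨w, this, ?_⟩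
  have h1 := three_dvd_ramIdx_of_pow_three_eq v Q hu hδ
  have h2 := ramIdx_tower p v Q
  have h3 := ramIdx_tower p w Q
  have h4 := (ramIdx_le_finrank w Q).trans hM
  have h5 := ramIdx_le_finrank p w
  have h6 := ramIdx_pos w Q
  have h7 := ramIdx_pos p w
  rw [hK] at h5
  have h8 : 3 ∣ ramIdx p w * ramIdx w Q := by rw [← h3, h2]; exact dvd_mul_of_dvd_right h1 _
  rcases (Nat.prime_three.dvd_mul).1 h8 with h | h
  · exact le_antisymm h5 (Nat.le_of_dvd h7 h)
  · have := Nat.le_of_dvd h6 h; omega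

theorem not_two_dvd_vord_of_ramIdx_eq_two (p : HeightOneSpectrum (𝓞 k))
    (h2 : (2 : 𝓞 k) ∉ p.asIdeal) (h3 : (3 : 𝓞 k) ∉ p.asIdeal)
    (w : HeightOneSpectrum (𝓞 K)) [w.asIdeal.LiesOver p.asIdeal] (hw : ramIdx p w = 2)
    {d : k} (hd : d ≠ 0) {r : E} (hr : r ^ 2 = algebraMap k E d) (hE : Algebra.adjoin k {r} = ⊤)
    {δ : E} (hδ : δ ≠ 0) {u : M} (hu : u ^ 3 = algebraMap E M δ) (hM : Algebra.adjoin E {u} = ⊤)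
    (hM3 : Module.finrank E M ≤ 3) : ¬ (2 : ℤ) ∣ vord p d := by
  intro hdvd
  obtain ⟨Q, hQ⟩ := exists_primeAbove M w
  obtain ⟨v, hv⟩ := exists_primeBelow E Q
  haveI : Q.asIdeal.LiesOver p.asIdeal := Ideal.LiesOver.trans _ w.asIdeal _
  haveI hvp : v.asIdeal.LiesOver p.asIdeal := Ideal.LiesOver.tower_bot Q.asIdeal _ _
  have e1 : ramIdx p v = 1 :=
    ramIdx_eq_one_of_pow_eq p v two_ne_zero (by exact_mod_cast h2) hE hd hr (by exact_mod_cast hdvd)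
  have t1 := ramIdx_tower p v Q
  have t2 := ramIdx_tower p w Q
  rw [e1, one_mul] at t1
  rw [hw, t1] at t2
  have h4 := (ramIdx_le_finrank v Q).trans hM3
  have h5 := ramIdx_pos v Q
  by_cases h : (3 : ℤ) ∣ vord v δ
  · have : ramIdx v Q = 1 := by
      refine ramIdx_eq_one_of_pow_eq v Q three_ne_zero ?_ hM hδ hu (by exact_mod_cast h)
      intro h'
      apply h3
      rw [hvp.over]
      change algebraMap (𝓞 k) (𝓞 E) 3 ∈ v.asIdeal
      rw [map_ofNat]
      exact_mod_cast h'
    omega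
  · have := three_dvd_ramIdx_of_pow_three_eq v Q hu h
    obtain ⟨j, hj⟩ := this
    omega

theorem intTrace_mem_of_mem_map (p : HeightOneSpectrum (𝓞 k)) {x : 𝓞 K}
    (hx : x ∈ p.asIdeal.map (algebraMap (𝓞 k) (𝓞 K))) :
    Algebra.intTrace (𝓞 k) (𝓞 K) x ∈ p.asIdeal := by
  haveI := p.isMaximal
  rw [← Ideal.Quotient.eq_zero_iff_mem, ← Algebra.trace_quotient_eq_of_isDedekindDomain,
    Ideal.Quotient.eq_zero_iff_mem.2 hx, map_zero]

theorem prod_absNorm_pow_le_discr (S : Finset (HeightOneSpectrum (𝓞 k)))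
    (n : HeightOneSpectrum (𝓞 k) → ℕ)
    (hS : ∀ v ∈ S, ∃ w : HeightOneSpectrum (𝓞 K), w.asIdeal.LiesOver v.asIdeal ∧ n v < ramIdx v w) :
    ∏ v ∈ S, Ideal.absNorm v.asIdeal ^ n v ≤ (NumberField.discr K).natAbs := by
  have hne : ∀ v : HeightOneSpectrum (𝓞 k), ∃ w : HeightOneSpectrum (𝓞 K),
      w.asIdeal.LiesOver v.asIdeal ∧ (v ∈ S → n v < ramIdx v w) := by
    intro v
    by_cases hv : v ∈ S
    · obtain ⟨w, h1, h2⟩ := hS v hv; exact ⟨w, h1, fun _ => h2⟩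
    · obtain ⟨w, h1⟩ := exists_primeAbove K v; exact ⟨w, h1, fun h => absurd h hv⟩
  choose f hf hfS using hne
  have hinj : ∀ v v', f v = f v' → v = v' := by
    intro v v' h
    ext1
    rw [(hf v).over, (hf v').over, h]
  have hdvd : ∏ v ∈ S, (f v).asIdeal ^ n v ∣ differentIdeal (𝓞 k) (𝓞 K) := by
    refine Finset.prod_dvd_of_coprime ?_ ?_
    · intro v _ v' _ hvv'
      refine IsCoprime.pow ?_
      refine Ideal.isCoprime_iff_sup_eq.2 ?_
      haveI := (f v).isMaximal
      haveI := (f v').isMaximal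
      refine Ideal.IsMaximal.coprime_of_ne ‹_› ‹_› ?_
      intro h
      exact hvv' (hinj _ _ (HeightOneSpectrum.ext h))
    · intro v hv
      haveI := v.isMaximal
      refine dvd_trans (pow_dvd_pow _ ?_) (pow_sub_one_dvd_differentIdeal (A := 𝓞 k)
        (p := v.asIdeal) (f v).asIdeal _ v.ne_bot (asIdeal_pow_ramIdx_dvd v (f v)))
      have := hfS v hv
      omega
  have h1 := NumberField.natAbs_discr_eq_absNorm_differentIdeal_mul_natAbs_discr_pow k (𝓞 k) K (𝓞 K)
  have h2 : (∏ v ∈ S, Ideal.absNorm v.asIdeal ^ n v) ≤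
      Ideal.absNorm (∏ v ∈ S, (f v).asIdeal ^ n v) := by
    rw [map_prod]
    refine Finset.prod_le_prod' fun v _ => ?_
    rw [map_pow]
    haveI := hf v
    exact Nat.pow_le_pow_left (absNorm_le_of_liesOver v (f v)) _
  refine h2.trans (Nat.le_of_dvd (Int.natAbs_pos.2 (NumberField.discr_ne_zero K)) ?_)
  rw [h1]
  exact (map_dvd Ideal.absNorm hdvd).mul_right _

/-- Trace zero solutions of `w³ - 3w = 2s` are ramified of even index above the primes dividing
`s - 1` to an odd power. -/
theorem exists_two_dvd_ramIdx_of_odd (hK : Module.finrank k K = 3) (p : HeightOneSpectrum (𝓞 k))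
    (h2 : (2 : 𝓞 k) ∉ p.asIdeal) (h3 : (3 : 𝓞 k) ∉ p.asIdeal) {s : k} {w : K}
    (hw : w ^ 3 - 3 * w = 2 * algebraMap k K s) (htr : Algebra.trace k K w = 0)
    (hs : s = 0 ∨ 0 ≤ vord p s) (hs1 : Odd (vord p (s - 1))) (hs1' : 0 ≤ vord p (s - 1)) :
    ∃ P : HeightOneSpectrum (𝓞 K), P.asIdeal.LiesOver p.asIdeal ∧ 2 ∣ ramIdx p P := by
  obtain ⟨c, hc, σ, hσ⟩ : ∃ c : 𝓞 k, c ∉ p.asIdeal ∧ ∃ y : 𝓞 k, (c : k) * s = y := by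
    rcases eq_or_ne s 0 with rfl | hs0
    · exact ⟨1, p.isPrime.one_notMem, 0, by simp⟩
    · exact exists_mul_eq_integer_of_vord_nonneg p hs0 (hs.resolve_left hs0)
  have hc0 : c ≠ 0 := by rintro rfl; exact hc (zero_mem _)
  have hc0' : (c : k) ≠ 0 := by simpa using hc0
  have h2' : ((2 : 𝓞 k) : k) = 2 := map_ofNat (algebraMap (𝓞 k) k) 2
  have h3' : ((3 : 𝓞 k) : k) = 3 := map_ofNat (algebraMap (𝓞 k) k) 3
  have h3K : ((3 : 𝓞 K) : K) = 3 := map_ofNat (algebraMap (𝓞 K) K) 3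
  set κ : 𝓞 k := 2 * c ^ 2 * (σ - c) with hκ
  have hκ' : (κ : k) = 2 * c ^ 3 * (s - 1) := by
    have : (κ : k) = 2 * c ^ 2 * (σ - c) := by rw [hκ]; push_cast [h2']; ring
    rw [this, ← hσ]; ring
  have hs10 : s - 1 ≠ 0 := by
    intro h; rw [h] at hs1; simp [vord] at hs1
  have hκv : vord p (κ : k) = vord p (s - 1) := by
    rw [hκ', vord_mul p (mul_ne_zero two_ne_zero (pow_ne_zero 3 hc0')) hs10,
      vord_mul p two_ne_zero (pow_ne_zero 3 hc0'), vord_pow,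
      vord_int_eq_zero p hc, ← h2', vord_int_eq_zero p h2]
    ring
  have hκ0 : κ ≠ 0 := by
    intro h
    have : (κ : k) = 0 := by rw [h]; rfl
    rw [hκ'] at this
    exact mul_ne_zero (mul_ne_zero two_ne_zero (pow_ne_zero 3 hc0')) hs10 this
  have hκp : κ ∈ p.asIdeal := by
    rw [← vord_int_pos_iff p hκ0, hκv]
    rcases hs1 with ⟨j, hj⟩
    omega
  let C : 𝓞 K := algebraMap (𝓞 k) (𝓞 K) c
  have hC : (C : K) = algebraMap k K c := rfl
  have hintegral : IsIntegral (𝓞 k) ((C : K) * w) := by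
    refine ⟨Polynomial.X ^ 3 - Polynomial.C (3 * c ^ 2) * Polynomial.X
      - Polynomial.C (2 * c ^ 2 * σ), by monicity!, ?_⟩
    have e1 : algebraMap (𝓞 k) K (3 * c ^ 2) = 3 * (C : K) ^ 2 := by
      rw [map_mul, map_pow, map_ofNat]; rfl
    have e2 : algebraMap (𝓞 k) K (2 * c ^ 2 * σ) = 2 * (C : K) ^ 3 * algebraMap k K s := by
      have : algebraMap (𝓞 k) K σ = (C : K) * algebraMap k K s := by
        rw [hC, ← map_mul, hσ]; rfl
      rw [map_mul, map_mul, map_pow, map_ofNat, this]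
      change 2 * (C : K) ^ 2 * _ = _
      ring
    simp only [Polynomial.eval₂_sub, Polynomial.eval₂_mul, Polynomial.eval₂_pow,
      Polynomial.eval₂_X, Polynomial.eval₂_C, e1, e2]
    linear_combination (C : K) ^ 3 * hw
  obtain ⟨Y, hY⟩ : ∃ Y : 𝓞 K, (Y : K) = (C : K) * w :=
    ⟨⟨(C : K) * w, isIntegral_trans _ hintegral⟩, rfl⟩
  have hT : (Y + C) ^ 2 * (Y + C - 3 * C) = algebraMap (𝓞 k) (𝓞 K) κ := by
    apply NumberField.RingOfIntegers.ext
    have e1 : (((Y + C) ^ 2 * (Y + C - 3 * C) : 𝓞 K) : K)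
        = ((Y : K) + C) ^ 2 * ((Y : K) + C - 3 * C) := by push_cast [h3K]; ring
    have e2 : ((algebraMap (𝓞 k) (𝓞 K) κ : 𝓞 K) : K) = 2 * (C : K) ^ 3 * (algebraMap k K s - 1) := by
      change algebraMap k K (κ : k) = _
      rw [hκ', map_mul, map_mul, map_pow, map_sub, map_one, map_ofNat, hC]
    rw [e1, e2, hY]
    linear_combination (C : K) ^ 3 * hw
  obtain ⟨T, hTd⟩ : ∃ T, T = Y + C := ⟨_, rfl⟩
  rw [← hTd] at hT
  by_cases hex : ∃ P : HeightOneSpectrum (𝓞 K), P.asIdeal.LiesOver p.asIdeal ∧ T ∈ P.asIdeal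
  · obtain ⟨P, hP, hTP⟩ := hex
    refine ⟨P, hP, ?_⟩
    have hiff : ∀ z : 𝓞 k, algebraMap (𝓞 k) (𝓞 K) z ∈ P.asIdeal → z ∈ p.asIdeal := by
      intro z hz; rw [hP.over]; exact hz
    have h3C : T - 3 * C ∉ P.asIdeal := by
      intro h
      have h4 : algebraMap (𝓞 k) (𝓞 K) (3 * c) ∈ P.asIdeal := by
        have := sub_mem hTP h
        rw [map_mul, map_ofNat]
        simpa using this
      rcases p.isPrime.mem_or_mem (hiff _ h4) with h | h
      · exact h3 h
      · exact hc h
    have hκK : algebraMap k K (κ : k) ≠ 0 := by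
      rw [map_ne_zero]; simpa using hκ0
    have e1 : algebraMap k K (κ : k) = (T : K) ^ 2 * ((T - 3 * C : 𝓞 K) : K) := by
      have := congrArg (algebraMap (𝓞 K) K) hT
      rw [map_mul, map_pow] at this
      exact this.symm
    have hv := vord_algebraMap p P (κ : k)
    rw [e1] at hκK
    rw [e1, vord_mul P (left_ne_zero_of_mul hκK) (right_ne_zero_of_mul hκK), vord_pow,
      vord_int_eq_zero P h3C, hκv] at hv
    have h5 : (2 : ℤ) ∣ ramIdx p P * vord p (s - 1) := ⟨vord P (T : K), by rw [← hv]; simp⟩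
    rcases Int.prime_two.dvd_mul.1 h5 with h | h
    · exact_mod_cast h
    · exact absurd hs1 (by rw [Int.not_odd_iff_even]; exact even_iff_two_dvd.2 h)
  · exfalso
    have htop : Ideal.span {T} ⊔ p.asIdeal.map (algebraMap (𝓞 k) (𝓞 K)) = ⊤ := by
      by_contra hne
      obtain ⟨P, hP, hle⟩ := Ideal.exists_le_maximal _ hne
      have hle2 := le_sup_right.trans hle
      have hlies := liesOver_of_map_le hP.isPrime hle2
      refine hex ⟨⟨P, hP.isPrime, Ideal.ne_bot_of_liesOver_of_ne_bot p.ne_bot P⟩, hlies, ?_⟩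
      exact (le_sup_left.trans hle) (Ideal.mem_span_singleton_self T)
    have h1 : (1 : 𝓞 K) ∈ Ideal.span {T} ⊔ p.asIdeal.map (algebraMap (𝓞 k) (𝓞 K)) := by
      rw [htop]; trivial
    obtain ⟨a, ha, b, hb, hab⟩ := Submodule.mem_sup.1 h1
    obtain ⟨a', rfl⟩ := Ideal.mem_span_singleton'.1 ha
    have hκm : T ^ 2 * (T - 3 * C) ∈ p.asIdeal.map (algebraMap (𝓞 k) (𝓞 K)) := by
      rw [hT]; exact Ideal.mem_map_of_mem _ hκp
    have hmem : T - 3 * C ∈ p.asIdeal.map (algebraMap (𝓞 k) (𝓞 K)) := by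
      have : T - 3 * C = a' ^ 2 * (T ^ 2 * (T - 3 * C)) + b * ((2 - b) * (T - 3 * C)) := by
        linear_combination (-(a' * T) - 1 + b) * (T - 3 * C) * hab
      rw [this]
      exact add_mem (Ideal.mul_mem_left _ _ hκm) (Ideal.mul_mem_right _ _ hb)
    have htrace := intTrace_mem_of_mem_map p hmem
    have hval : Algebra.intTrace (𝓞 k) (𝓞 K) (T - 3 * C) = -(2 * (3 * c)) := by
      apply NumberField.RingOfIntegers.ext
      have e0 : ((Algebra.intTrace (𝓞 k) (𝓞 K) (T - 3 * C) : 𝓞 k) : k) =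
          Algebra.trace k K ((T - 3 * C : 𝓞 K) : K) := Algebra.algebraMap_intTrace _
      have e1 : ((T - 3 * C : 𝓞 K) : K) = (c : k) • w - algebraMap k K (2 * c) := by
        have : ((T - 3 * C : 𝓞 K) : K) = (Y : K) - 2 * C := by rw [hTd]; push_cast [h3K]; ring
        rw [this, hY, hC, Algebra.smul_def, map_mul, map_ofNat]
      rw [e0, e1, map_sub, map_smul, htr, Algebra.trace_algebraMap, hK]
      push_cast [h2', h3']
      simp
      ring
    rw [hval, neg_mem_iff] at htrace
    rcases p.isPrime.mem_or_mem htrace with h | h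
    · exact h2 h
    rcases p.isPrime.mem_or_mem h with h | h
    · exact h3 h
    · exact hc h

theorem vord_nonneg_of_odd_sq_sub_one {F : Type*} [Field F] [NumberField F]
    (p : HeightOneSpectrum (𝓞 F)) {s : F} (h : Odd (vord p (s ^ 2 - 1))) (hs : s ≠ 0) :
    0 ≤ vord p s := by
  rw [vord_nonneg_iff p hs]
  by_contra hlt
  push Not at hlt
  have h1 : p.valuation F (s ^ 2 - 1) = p.valuation F (s ^ 2) := by
    refine (p.valuation F).map_sub_eq_of_lt_left ?_
    rw [map_one, map_pow]
    exact one_lt_pow₀ hlt two_ne_zero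
  have h2 : vord p (s ^ 2 - 1) = 2 * vord p s := by
    rw [vord, h1, ← vord, vord_pow]; rfl
  rw [h2] at h
  exact absurd h (by rw [Int.not_odd_iff_even]; exact even_two_mul _)

theorem vord_sub_nonneg {F : Type*} [Field F] [NumberField F]
    (p : HeightOneSpectrum (𝓞 F)) {x y : F} (hx : x = 0 ∨ 0 ≤ vord p x) (hy : y = 0 ∨ 0 ≤ vord p y) :
    0 ≤ vord p (x - y) := by
  have key : ∀ z : F, (z = 0 ∨ 0 ≤ vord p z) → p.valuation F z ≤ 1 := by
    intro z hz
    rcases eq_or_ne z 0 with rfl | h0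
    · simp
    · exact (vord_nonneg_iff p h0).1 (hz.resolve_left h0)
  rcases eq_or_ne (x - y) 0 with h0 | h0
  · rw [h0]; simp [vord]
  rw [vord_nonneg_iff p h0]
  exact (p.valuation F).map_sub_le (key x hx) (key y hy)

theorem exists_two_dvd_ramIdx (hK : Module.finrank k K = 3) (p : HeightOneSpectrum (𝓞 k))
    (h2 : (2 : 𝓞 k) ∉ p.asIdeal) (h3 : (3 : 𝓞 k) ∉ p.asIdeal) {s : k} {w : K}
    (hw : w ^ 3 - 3 * w = 2 * algebraMap k K s) (htr : Algebra.trace k K w = 0)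
    (hodd : Odd (vord p (s ^ 2 - 1))) :
    ∃ P : HeightOneSpectrum (𝓞 K), P.asIdeal.LiesOver p.asIdeal ∧ 2 ∣ ramIdx p P := by
  have hs : s = 0 ∨ 0 ≤ vord p s := or_iff_not_imp_left.2 (vord_nonneg_of_odd_sq_sub_one p hodd)
  have hs' : -s = 0 ∨ 0 ≤ vord p (-s) := by rwa [neg_eq_zero, vord_neg]
  have h1 : (1 : k) = 0 ∨ 0 ≤ vord p (1 : k) := Or.inr (vord_one p).ge
  have hne : s ^ 2 - 1 ≠ 0 := by
    intro h; rw [h] at hodd; simp [vord] at hodd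
  have hfac : s ^ 2 - 1 = -((s - 1) * (-s - 1)) := by ring
  rw [hfac, neg_ne_zero] at hne
  rw [hfac, vord_neg, vord_mul p (left_ne_zero_of_mul hne) (right_ne_zero_of_mul hne),
    Int.odd_add] at hodd
  by_cases ho : Odd (vord p (s - 1))
  · exact exists_two_dvd_ramIdx_of_odd hK p h2 h3 hw htr hs ho (vord_sub_nonneg p hs h1)
  · refine exists_two_dvd_ramIdx_of_odd hK p h2 h3 (w := -w) (s := -s) ?_ (by simp [htr]) hs' ?_
      (vord_sub_nonneg p hs' h1)
    · rw [map_neg]; linear_combination -hw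
    · rw [← Int.not_even_iff_odd]; exact fun h => ho (hodd.2 h)

end Ramification

section CubicForm
open IntermediateField Polynomial

variable {k K : Type*} [Field k] [Field K] [Algebra k K]

theorem adjoin_eq_top_of_finrank_three (h3 : Module.finrank k K = 3) {x : K}
    (hx : x ∉ Set.range (algebraMap k K)) : k⟮x⟯ = ⊤ := by
  haveI := IntermediateField.isSimpleOrder_of_finrank_prime k K (by rw [h3]; exact Nat.prime_three)
  refine (eq_bot_or_eq_top _).resolve_left fun h => hx ?_
  have := mem_adjoin_simple_self k x
  rwa [h, mem_bot] at this

theorem natDegree_minpoly_of_finrank_three (h3 : Module.finrank k K = 3) {x : K}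
    (hx : x ∉ Set.range (algebraMap k K)) : (minpoly k x).natDegree = 3 := by
  haveI : FiniteDimensional k K := FiniteDimensional.of_finrank_pos (by omega)
  rw [← adjoin.finrank (Algebra.IsIntegral.isIntegral (R := k) x),
    adjoin_eq_top_of_finrank_three h3 hx, finrank_top', h3]

theorem eq_zero_of_quadratic (h3 : Module.finrank k K = 3) {x : K}
    (hx : x ∉ Set.range (algebraMap k K)) {a b c : k}
    (h : algebraMap k K a * x ^ 2 + algebraMap k K b * x + algebraMap k K c = 0) :
    a = 0 ∧ b = 0 ∧ c = 0 := by
  have hp : aeval x (C a * X ^ 2 + C b * X + C c) = 0 := by simpa using h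
  have h0 : C a * X ^ 2 + C b * X + C c = 0 := by
    by_contra hne
    have h1 := natDegree_le_of_dvd (minpoly.dvd k x hp) hne
    rw [natDegree_minpoly_of_finrank_three h3 hx] at h1
    have h2 : (C a * X ^ 2 + C b * X + C c).natDegree ≤ 2 := by compute_degree
    omega
  refine ⟨?_, ?_, ?_⟩
  · simpa using congrArg (fun p => p.coeff 2) h0
  · simpa using congrArg (fun p => p.coeff 1) h0
  · simpa using congrArg (fun p => p.coeff 0) h0

theorem minpoly_eq_of_finrank_three (h3 : Module.finrank k K = 3) {x : K}
    (hx : x ∉ Set.range (algebraMap k K)) {a b c : k}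
    (h : x ^ 3 + algebraMap k K a * x ^ 2 + algebraMap k K b * x + algebraMap k K c = 0) :
    minpoly k x = X ^ 3 + C a * X ^ 2 + C b * X + C c := by
  have hp : aeval x (X ^ 3 + C a * X ^ 2 + C b * X + C c) = 0 := by simpa using h
  have hd := natDegree_minpoly_of_finrank_three h3 hx
  have hintegral : IsIntegral k x := by
    by_contra hn
    rw [minpoly.eq_zero hn] at hd; simp at hd
  have hdeg : (X ^ 3 + C a * X ^ 2 + C b * X + C c).natDegree = 3 := by compute_degree!
  symm
  refine eq_of_monic_of_dvd_of_natDegree_le (minpoly.monic hintegral) (by monicity!)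
    (minpoly.dvd k x hp) (by rw [hdeg, hd])

theorem exists_depressed [CharZero k] (h3 : Module.finrank k K = 3) :
    ∃ (x : K) (p q : k), x ∉ Set.range (algebraMap k K) ∧
      x ^ 3 + algebraMap k K p * x + algebraMap k K q = 0 := by
  haveI : CharZero K := charZero_of_injective_algebraMap (algebraMap k K).injective
  obtain ⟨y, hy⟩ : ∃ y : K, y ∉ Set.range (algebraMap k K) := by
    by_contra hn
    push Not at hn
    have : (⊥ : IntermediateField k K) = ⊤ := by
      rw [eq_top_iff]; intro z _; rw [mem_bot]; exact hn z
    have h1 : Module.finrank k (⊥ : IntermediateField k K) = 1 := IntermediateField.finrank_bot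
    rw [this, finrank_top', h3] at h1
    omega
  have hd := natDegree_minpoly_of_finrank_three h3 hy
  have hintegral : IsIntegral k y := by
    by_contra hn
    rw [minpoly.eq_zero hn] at hd; simp at hd
  have h1 := minpoly.aeval k y
  have h2 : (minpoly k y).coeff 3 = 1 := by
    have := minpoly.monic hintegral
    rwa [Monic, leadingCoeff, hd] at this
  rw [aeval_eq_sum_range, hd] at h1
  simp only [Finset.sum_range_succ, Finset.sum_range_zero, h2, Algebra.smul_def, map_one] at h1
  obtain ⟨a, ha⟩ : ∃ a, a = (minpoly k y).coeff 2 := ⟨_, rfl⟩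
  obtain ⟨b, hb⟩ : ∃ a, a = (minpoly k y).coeff 1 := ⟨_, rfl⟩
  obtain ⟨c, hc⟩ : ∃ a, a = (minpoly k y).coeff 0 := ⟨_, rfl⟩
  rw [← ha, ← hb, ← hc] at h1
  refine ⟨y + algebraMap k K (a / 3), b - a ^ 2 / 3, c - a * b / 3 + 2 * a ^ 3 / 27, ?_, ?_⟩
  · rintro ⟨z, hz⟩
    exact hy ⟨z - a / 3, by rw [map_sub, hz]; ring⟩
  · simp only [map_add, map_sub, map_div₀, map_mul, map_pow, map_ofNat]
    linear_combination h1

theorem exists_depressed_ne_zero [CharZero k] (h3 : Module.finrank k K = 3) :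
    ∃ (x : K) (p q : k), x ∉ Set.range (algebraMap k K) ∧ p ≠ 0 ∧
      x ^ 3 + algebraMap k K p * x + algebraMap k K q = 0 := by
  obtain ⟨x, p, q, hx, h⟩ := exists_depressed h3
  by_cases hp : p = 0
  · subst hp
    rw [map_zero, zero_mul, add_zero] at h
    have hq : q ≠ 0 := by
      rintro rfl
      rw [map_zero, add_zero] at h
      exact hx ⟨0, by rw [pow_eq_zero_iff three_ne_zero |>.1 h, map_zero]⟩
    refine ⟨x + x ^ 2, 3 * q, q - q ^ 2, ?_, mul_ne_zero three_ne_zero hq, ?_⟩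
    · rintro ⟨z, hz⟩
      have := eq_zero_of_quadratic h3 hx (a := 1) (b := 1) (c := -z)
        (by rw [map_neg, hz, map_one]; ring)
      exact one_ne_zero this.1
    · simp only [map_sub, map_mul, map_pow, map_ofNat]
      linear_combination (1 + 3 * x + 3 * x ^ 2 + (x ^ 3 - algebraMap k K q)) * h
  · exact ⟨x, p, q, hx, hp, h⟩

theorem exists_cubic_form [CharZero k] (h3 : Module.finrank k K = 3) :
    ∃ (w : K) (s : k), w ∉ Set.range (algebraMap k K) ∧ s ^ 2 - 1 ≠ 0 ∧
      w ^ 3 - 3 * w = 2 * algebraMap k K s := by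
  haveI : CharZero K := charZero_of_injective_algebraMap (algebraMap k K).injective
  obtain ⟨x, p, q, hx, hp, h⟩ := exists_depressed_ne_zero h3
  have hp' : algebraMap k K p ≠ 0 := by rwa [_root_.map_ne_zero]
  have hw : -3 * x ^ 2 / algebraMap k K p - 2 ∉ Set.range (algebraMap k K) := by
    rintro ⟨z, hz⟩
    have := eq_zero_of_quadratic h3 hx (a := -3) (b := 0) (c := -(p * (z + 2))) (by
      rw [map_neg, map_neg, map_mul, map_add, hz, map_zero, map_ofNat, map_ofNat]
      field_simp
      ring)
    have h4 := this.1
    norm_num at h4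
  have hw3 : (-3 * x ^ 2 / algebraMap k K p - 2) ^ 3 - 3 * (-3 * x ^ 2 / algebraMap k K p - 2)
      = 2 * algebraMap k K (-27 * q ^ 2 / (2 * p ^ 3) - 1) := by
    simp only [map_sub, map_div₀, map_mul, map_pow, map_neg, map_ofNat, map_one]
    field_simp
    linear_combination (-27) * (x ^ 3 + algebraMap k K p * x - algebraMap k K q) * h
  refine ⟨_, _, hw, ?_, hw3⟩
  intro hs
  obtain ⟨W, hW⟩ : ∃ W, W = -3 * x ^ 2 / algebraMap k K p - 2 := ⟨_, rfl⟩
  obtain ⟨S, hS⟩ : ∃ S, S = -27 * q ^ 2 / (2 * p ^ 3) - 1 := ⟨_, rfl⟩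
  rw [← hW, ← hS] at hw3
  rw [← hS] at hs
  rw [← hW] at hw
  have h1 : (S - 1) * (S + 1) = 0 := by linear_combination hs
  rcases mul_eq_zero.1 h1 with h2 | h2
  · have h2' : S = 1 := by linear_combination h2
    rw [h2', map_one] at hw3
    have h4 : (W + 1) ^ 2 * (W - 2) = 0 := by linear_combination hw3
    rcases mul_eq_zero.1 h4 with h5 | h5
    · have h5 := pow_eq_zero_iff two_ne_zero |>.1 h5
      exact hw ⟨-1, by rw [map_neg, map_one]; linear_combination -h5⟩
    · exact hw ⟨2, by rw [map_ofNat]; linear_combination -h5⟩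
  · have h2' : S = -1 := by linear_combination h2
    rw [h2', map_neg, map_one] at hw3
    have h4 : (W - 1) ^ 2 * (W + 2) = 0 := by linear_combination hw3
    rcases mul_eq_zero.1 h4 with h5 | h5
    · have h5 := pow_eq_zero_iff two_ne_zero |>.1 h5
      exact hw ⟨1, by rw [map_one]; linear_combination -h5⟩
    · exact hw ⟨-2, by rw [map_neg, map_ofNat]; linear_combination -h5⟩

theorem trace_eq_zero_of_cubic_form (h3 : Module.finrank k K = 3) {w : K} {s : k}
    (hw : w ∉ Set.range (algebraMap k K)) (h : w ^ 3 - 3 * w = 2 * algebraMap k K s) :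
    Algebra.trace k K w = 0 := by
  haveI : FiniteDimensional k K := FiniteDimensional.of_finrank_pos (by omega)
  have h1 := minpoly_eq_of_finrank_three h3 hw (a := 0) (b := -3) (c := -(2 * s)) (by
    simp only [map_neg, map_mul, map_ofNat, map_zero]; linear_combination h)
  have hd := natDegree_minpoly_of_finrank_three h3 hw
  rw [trace_eq_finrank_mul_minpoly_nextCoeff, nextCoeff_of_natDegree_pos (by omega), hd, h1]
  simp

end CubicForm

section CubicDatum
open IntermediateField Polynomial

universe u v
variable {k : Type u} {Ω : Type v} [Field k] [CharZero k] [Field Ω] [Algebra k Ω]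

/-- The Cardano resolvent data of a cubic field `K = k(w)`, where `w³ - 3w = 2s`. -/
structure IsCubicDatum (K : IntermediateField k Ω) (d : k) (r : Ω) (s t : k) (w u : Ω) : Prop where
  finrank : Module.finrank k K = 3
  sq_eq : r ^ 2 = algebraMap k Ω d
  t_ne : t ≠ 0
  d_ne : d ≠ 0
  rel : d * t ^ 2 = s ^ 2 - 1
  mem : w ∈ K
  notMem : w ∉ Set.range (algebraMap k Ω)
  eqn : w ^ 3 - 3 * w = 2 * algebraMap k Ω s
  u_ne : u ≠ 0
  u_add : u + u⁻¹ = w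
  u_cube : u ^ 3 = algebraMap k Ω s + algebraMap k Ω t * r

theorem exists_add_inv_eq [IsAlgClosed Ω] {d : k} {r : Ω} {s t : k} {w : Ω}
    (hr : r ^ 2 = algebraMap k Ω d) (hrel : d * t ^ 2 = s ^ 2 - 1)
    (hw : w ^ 3 - 3 * w = 2 * algebraMap k Ω s) :
    ∃ u : Ω, u ≠ 0 ∧ u + u⁻¹ = w ∧ u ^ 3 = algebraMap k Ω s + algebraMap k Ω t * r := by
  have hdeg : (X ^ 2 - C w * X + 1 : Polynomial Ω).degree = 2 := by compute_degree!
  obtain ⟨u, hu⟩ := IsAlgClosed.exists_root (X ^ 2 - C w * X + 1 : Polynomial Ω) (by rw [hdeg]; norm_num)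
  have hu1 : u ^ 2 - w * u + 1 = 0 := by simpa [IsRoot] using hu
  have hu0 : u ≠ 0 := by rintro rfl; simp at hu1
  have hwu : w = u + u⁻¹ := by field_simp; linear_combination -hu1
  have hrel' : algebraMap k Ω d * algebraMap k Ω t ^ 2 = algebraMap k Ω s ^ 2 - 1 := by
    rw [← map_pow, ← map_mul, hrel]; simp
  have h2 : u ^ 6 - 2 * algebraMap k Ω s * u ^ 3 + 1 = 0 := by
    rw [← hw, hwu]; field_simp; ring
  have h3 : (u ^ 3 - (algebraMap k Ω s + algebraMap k Ω t * r)) *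
      (u ^ 3 - (algebraMap k Ω s - algebraMap k Ω t * r)) = 0 := by
    linear_combination h2 - hrel' - algebraMap k Ω t ^ 2 * hr
  rcases mul_eq_zero.1 h3 with h | h
  · exact ⟨u, hu0, hwu.symm, sub_eq_zero.1 h⟩
  · refine ⟨u⁻¹, inv_ne_zero hu0, by rw [inv_inv, add_comm]; exact hwu.symm, ?_⟩
    have h4 : u ^ 3 = algebraMap k Ω s - algebraMap k Ω t * r := sub_eq_zero.1 h
    rw [inv_pow]
    refine inv_eq_of_mul_eq_one_right ?_
    rw [h4]
    linear_combination -hrel' - algebraMap k Ω t ^ 2 * hr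

theorem mem_adjoin_sqrt {d : k} {r : Ω} (hr : r ^ 2 = algebraMap k Ω d) {z : Ω} (hz : z ∈ k⟮r⟯) :
    ∃ a b : k, z = algebraMap k Ω a + algebraMap k Ω b * r := by
  have hintegral : IsIntegral k r := by
    refine IsIntegral.of_pow two_pos ?_
    rw [hr]; exact isIntegral_algebraMap
  have h1 : z ∈ Algebra.adjoin k {r} := by
    rw [← adjoin_simple_toSubalgebra_of_isAlgebraic hintegral.isAlgebraic]; exact hz
  clear hz
  induction h1 using Algebra.adjoin_induction with
  | mem x hx => rw [Set.mem_singleton_iff.1 hx]; exact ⟨0, 1, by simp⟩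
  | algebraMap a => exact ⟨a, 0, by simp⟩
  | add x y hx hy ihx ihy =>
    obtain ⟨a, b, rfl⟩ := ihx
    obtain ⟨a', b', rfl⟩ := ihy
    exact ⟨a + a', b + b', by simp only [map_add]; ring⟩
  | mul x y hx hy ihx ihy =>
    obtain ⟨a, b, rfl⟩ := ihx
    obtain ⟨a', b', rfl⟩ := ihy
    refine ⟨a * a' + b * b' * d, a * b' + a' * b, ?_⟩
    simp only [map_add, map_mul, ← hr]
    ring

namespace IsCubicDatum

variable {K K' : IntermediateField k Ω} {d : k} {r : Ω} {s t s' t' : k} {w u w' u' : Ω}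

theorem algebraMap_rel (h : IsCubicDatum K d r s t w u) :
    algebraMap k Ω d * algebraMap k Ω t ^ 2 = algebraMap k Ω s ^ 2 - 1 := by
  rw [← map_pow, ← map_mul, h.rel]; simp

theorem u_cube_inv (h : IsCubicDatum K d r s t w u) :
    (u⁻¹) ^ 3 = algebraMap k Ω s - algebraMap k Ω t * r := by
  rw [inv_pow, h.u_cube]
  refine inv_eq_of_mul_eq_one_right ?_
  linear_combination -h.algebraMap_rel - algebraMap k Ω t ^ 2 * h.sq_eq

theorem minpoly_eq (h : IsCubicDatum K d r s t w u) :
    minpoly k w = X ^ 3 + C 0 * X ^ 2 + C (-3) * X + C (-(2 * s)) := by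
  have h1 := minpoly_eq_of_finrank_three h.finrank (x := (⟨w, h.mem⟩ : K)) (a := 0) (b := -3)
    (c := -(2 * s)) ?_ ?_
  · rw [← h1]
    exact (IntermediateField.minpoly_eq (⟨w, h.mem⟩ : K)).symm
  · rintro ⟨z, hz⟩
    exact h.notMem ⟨z, congrArg Subtype.val hz⟩
  · apply Subtype.ext
    have := h.eqn
    have h2 : w ^ 3 + algebraMap k Ω 0 * w ^ 2 + algebraMap k Ω (-3) * w +
        algebraMap k Ω (-(2 * s)) = 0 := by
      simp only [map_zero, map_neg, map_mul, map_ofNat]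
      linear_combination this
    exact h2

theorem adjoin_eq (h : IsCubicDatum K d r s t w u) : k⟮w⟯ = K := by
  haveI : FiniteDimensional k K := FiniteDimensional.of_finrank_pos (by rw [h.finrank]; omega)
  have hintegral : IsIntegral k w := isIntegral_iff.1 (Algebra.IsIntegral.isIntegral (⟨w, h.mem⟩ : K))
  refine IntermediateField.eq_of_le_of_finrank_eq (adjoin_simple_le_iff.2 h.mem) ?_
  rw [adjoin.finrank hintegral, h.finrank, h.minpoly_eq]
  compute_degree!

theorem diff_mul_mem (h : IsCubicDatum K d r s t w u) : (u - u⁻¹) * r ∈ K := by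
  have h1 : (u - u⁻¹) * r = (w ^ 2 - 4) * (w ^ 2 - 1) / (2 * algebraMap k Ω t) := by
    haveI : CharZero Ω := charZero_of_injective_algebraMap (algebraMap k Ω).injective
    have ht : algebraMap k Ω t ≠ 0 := by rw [_root_.map_ne_zero]; exact h.t_ne
    rw [eq_div_iff (mul_ne_zero two_ne_zero ht)]
    have h2 := h.u_cube
    have h3 := h.u_cube_inv
    have h4 : u * u⁻¹ = 1 := mul_inv_cancel₀ h.u_ne
    have h5 : 2 * algebraMap k Ω t * r = u ^ 3 - (u⁻¹) ^ 3 := by rw [h2, h3]; ring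
    have h6 : (u - u⁻¹) * r * (2 * algebraMap k Ω t) = (u - u⁻¹) * (u ^ 3 - (u⁻¹) ^ 3) := by
      rw [← h5]; ring
    rw [h6, ← h.u_add]
    generalize u⁻¹ = y at *
    linear_combination (-5 * (u ^ 2 + y ^ 2) - 6 * u * y + 4) * h4
  rw [h1]
  exact div_mem (mul_mem (sub_mem (pow_mem h.mem 2) (ofNat_mem K 4))
    (sub_mem (pow_mem h.mem 2) (one_mem K))) (mul_mem (ofNat_mem K 2) (IntermediateField.algebraMap_mem K t))

theorem nonempty_algEquiv_of_mem (h : IsCubicDatum K d r s t w u)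
    (h' : IsCubicDatum K' d r s' t' w' u') {v : Ω} (hv : v ^ 3 = u ^ 3)
    (hmem : v + v⁻¹ ∈ K') : Nonempty (K ≃ₐ[k] K') := by
  have hv0 : v ≠ 0 := by
    rintro rfl
    rw [zero_pow three_ne_zero] at hv
    exact h.u_ne (pow_eq_zero_iff three_ne_zero |>.1 hv.symm)
  have hv' : (v⁻¹) ^ 3 = (u⁻¹) ^ 3 := by rw [inv_pow, hv, inv_pow]
  have h1 : v * v⁻¹ = 1 := mul_inv_cancel₀ hv0
  have heq : (v + v⁻¹) ^ 3 - 3 * (v + v⁻¹) = 2 * algebraMap k Ω s := by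
    have h2 := h.u_cube
    have h3 := h.u_cube_inv
    have : (v + v⁻¹) ^ 3 - 3 * (v + v⁻¹) = v ^ 3 + (v⁻¹) ^ 3 := by
      linear_combination 3 * (v + v⁻¹) * h1
    rw [this, hv, hv', h2, h3]; ring
  have hroot : aeval (v + v⁻¹) (minpoly k w) = 0 := by
    rw [h.minpoly_eq]
    simp only [map_add, map_mul, map_pow, aeval_X, aeval_C, map_neg, map_zero, map_ofNat]
    linear_combination heq
  have hintegral : IsIntegral k w := by
    by_contra hn
    have h4 := minpoly.eq_zero hn
    rw [h.minpoly_eq] at h4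
    have h5 := congrArg (fun p => p.coeff 3) h4
    simp [coeff_X, coeff_C] at h5
  have hmp : minpoly k w = minpoly k (v + v⁻¹) :=
    minpoly.eq_of_irreducible_of_monic (minpoly.irreducible hintegral) hroot (minpoly.monic hintegral)
  have hle : k⟮v + v⁻¹⟯ ≤ K' := adjoin_simple_le_iff.2 hmem
  have hintegral' : IsIntegral k (v + v⁻¹) := by
    refine ⟨minpoly k w, minpoly.monic hintegral, hroot⟩
  have e1 : Module.finrank k k⟮v + v⁻¹⟯ = Module.finrank k K' := by
    rw [adjoin.finrank hintegral', ← hmp, ← adjoin.finrank hintegral, h.adjoin_eq, h.finrank, h'.finrank]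
  haveI : FiniteDimensional k K' := FiniteDimensional.of_finrank_pos (by rw [h'.finrank]; omega)
  have e2 : k⟮v + v⁻¹⟯ = K' := IntermediateField.eq_of_le_of_finrank_eq hle e1
  have e3 := minpoly.algEquiv hintegral.isAlgebraic hmp
  rw [h.adjoin_eq, e2] at e3
  exact ⟨e3⟩

theorem nonempty_algEquiv (h : IsCubicDatum K d r s t w u)
    (h' : IsCubicDatum K' d r s' t' w' u') {γ : Ω} (hγ : γ ∈ k⟮r⟯)
    (he : u ^ 3 = u' ^ 3 * γ ^ 3) : Nonempty (K ≃ₐ[k] K') := by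
  haveI : CharZero Ω := charZero_of_injective_algebraMap (algebraMap k Ω).injective
  have hr0 : r ≠ 0 := by
    rintro rfl
    have := h.sq_eq
    rw [zero_pow two_ne_zero, eq_comm, map_eq_zero] at this
    exact h.d_ne this
  have hγ0 : γ ≠ 0 := by
    rintro rfl
    rw [zero_pow three_ne_zero, mul_zero] at he
    exact h.u_ne (pow_eq_zero_iff three_ne_zero |>.1 he)
  have hdiff := h'.diff_mul_mem
  have hw' := h'.mem
  have key : ∀ γ' : Ω, γ' ≠ 0 → γ' ^ 3 = γ ^ 3 → (γ' + γ'⁻¹) ∈ K' → (γ' - γ'⁻¹) / r ∈ K' →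
      Nonempty (K ≃ₐ[k] K') := by
    intro γ' h0 h3 hp hm
    refine h.nonempty_algEquiv_of_mem h' (v := u' * γ') (by rw [mul_pow, h3, he]) ?_
    have e : u' * γ' + (u' * γ')⁻¹ = (w' * (γ' + γ'⁻¹) + ((u' - u'⁻¹) * r) * ((γ' - γ'⁻¹) / r)) / 2 := by
      rw [← h'.u_add, mul_inv]
      field_simp
      ring
    rw [e]
    exact div_mem (add_mem (mul_mem hw' hp) (mul_mem hdiff hm)) (ofNat_mem K' 2)
  by_cases hrk : r ∈ Set.range (algebraMap k Ω)
  · obtain ⟨ρ, rfl⟩ := hrk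
    have hle : k⟮algebraMap k Ω ρ⟯ ≤ K' := adjoin_simple_le_iff.2 (IntermediateField.algebraMap_mem K' ρ)
    have hm := hle hγ
    exact key γ hγ0 rfl (add_mem hm (inv_mem hm))
      (div_mem (sub_mem hm (inv_mem hm)) (IntermediateField.algebraMap_mem K' ρ))
  · obtain ⟨σ, τ, rfl⟩ := mem_adjoin_sqrt h.sq_eq hγ
    have hind : ∀ a b a' b' : k, algebraMap k Ω a + algebraMap k Ω b * r =
        algebraMap k Ω a' + algebraMap k Ω b' * r → a = a' ∧ b = b' := by
      intro a b a' b' hab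
      have hb : b = b' := by
        by_contra hne
        have hne' : algebraMap k Ω (b - b') ≠ 0 := by
          rw [_root_.map_ne_zero]; exact sub_ne_zero.2 hne
        refine hrk ⟨(a' - a) / (b - b'), ?_⟩
        rw [map_div₀, div_eq_iff hne', map_sub, map_sub]
        linear_combination -hab
      subst hb
      exact ⟨(algebraMap k Ω).injective (by linear_combination hab), rfl⟩
    have hA := hind s t (s' * (σ ^ 3 + 3 * σ * τ ^ 2 * d) + t' * d * (3 * σ ^ 2 * τ + τ ^ 3 * d))
      (s' * (3 * σ ^ 2 * τ + τ ^ 3 * d) + t' * (σ ^ 3 + 3 * σ * τ ^ 2 * d)) (by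
        have h1 := h.u_cube
        have h2 := h'.u_cube
        rw [h1, h2] at he
        rw [he]
        have hd := h.sq_eq
        simp only [map_add, map_mul, map_pow, map_ofNat]
        rw [← hd]
        ring)
    obtain ⟨N, hN⟩ : ∃ N, N = σ ^ 2 - τ ^ 2 * d := ⟨_, rfl⟩
    have hN3 : N ^ 3 = 1 := by
      have h1 := h.rel
      have h2 := h'.rel
      have e : s ^ 2 - d * t ^ 2 = (s' ^ 2 - d * t' ^ 2) * N ^ 3 := by
        rw [hA.1, hA.2, hN]; ring
      have e1 : s ^ 2 - d * t ^ 2 = 1 := by linear_combination -h1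
      have e2 : s' ^ 2 - d * t' ^ 2 = 1 := by linear_combination -h2
      rw [e1, e2, one_mul] at e
      exact e.symm
    have hN' : algebraMap k Ω N ^ 3 = 1 := by rw [← map_pow, hN3, map_one]
    have hNe : algebraMap k Ω N = algebraMap k Ω σ ^ 2 - algebraMap k Ω τ ^ 2 * r ^ 2 := by
      rw [hN, h.sq_eq]; simp
    have hN0 : algebraMap k Ω N ≠ 0 := by
      intro h0; rw [h0] at hN'; simp at hN'
    have hinv : (algebraMap k Ω N * (algebraMap k Ω σ + algebraMap k Ω τ * r))⁻¹ =
        algebraMap k Ω N * (algebraMap k Ω σ - algebraMap k Ω τ * r) := by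
      refine inv_eq_of_mul_eq_one_right ?_
      linear_combination hN' - algebraMap k Ω N ^ 2 * hNe
    refine key (algebraMap k Ω N * (algebraMap k Ω σ + algebraMap k Ω τ * r))
      (mul_ne_zero hN0 hγ0) (by rw [mul_pow, hN', one_mul]) ?_ ?_
    · rw [hinv]
      have : algebraMap k Ω N * (algebraMap k Ω σ + algebraMap k Ω τ * r) +
        algebraMap k Ω N * (algebraMap k Ω σ - algebraMap k Ω τ * r) =
        algebraMap k Ω (2 * N * σ) := by
        simp only [map_mul, map_ofNat]; ring
      rw [this]; exact IntermediateField.algebraMap_mem K' _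
    · rw [hinv]
      have : (algebraMap k Ω N * (algebraMap k Ω σ + algebraMap k Ω τ * r) -
        algebraMap k Ω N * (algebraMap k Ω σ - algebraMap k Ω τ * r)) / r =
        algebraMap k Ω (2 * N * τ) := by
        simp only [map_mul, map_ofNat]; field_simp; ring
      rw [this]; exact IntermediateField.algebraMap_mem K' _

end IsCubicDatum

end CubicDatum

section CubicRamification
open IntermediateField Polynomial IsDedekindDomain

universe u v

theorem finrank_le_natDegree_of_adjoin_eq_top {F L : Type*} [Field F] [Field L] [Algebra F L]
    [FiniteDimensional F L] {x : L} {p : Polynomial F} (hp : p.Monic) (hx : aeval x p = 0)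
    (ht : Algebra.adjoin F {x} = ⊤) : Module.finrank F L ≤ p.natDegree := by
  have hintegral : IsIntegral F x := Algebra.IsIntegral.isIntegral x
  have h1 : F⟮x⟯ = ⊤ := by
    rw [← toSubalgebra_inj, adjoin_simple_toSubalgebra_of_isAlgebraic hintegral.isAlgebraic, ht,
      top_toSubalgebra]
  have h2 := adjoin.finrank hintegral
  rw [h1, finrank_top'] at h2
  rw [h2]
  exact natDegree_le_of_degree_le ((minpoly.min F x hp hx).trans degree_le_natDegree)

theorem adjoin_eq_top_of_tower {k F L : Type*} [Field k] [Field F] [Field L] [Algebra k F]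
    [Algebra k L] [Algebra F L] [IsScalarTower k F L] {x : L} (h : Algebra.adjoin k {x} = ⊤) :
    Algebra.adjoin F {x} = ⊤ := by
  refine Algebra.eq_top_iff.2 fun y => ?_
  have h1 : y ∈ Algebra.adjoin k {x} := by rw [h]; exact Algebra.mem_top
  have h2 : Algebra.adjoin k {x} ≤ (Algebra.adjoin F {x}).restrictScalars k :=
    Algebra.adjoin_le (Set.singleton_subset_iff.2 (Algebra.self_mem_adjoin_singleton F x))
  exact h2 h1

theorem adjoin_gen_eq_top {k Ω : Type*} [Field k] [Field Ω] [Algebra k Ω] {x : Ω}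
    (hx : IsIntegral k x) : Algebra.adjoin k {AdjoinSimple.gen k x} = ⊤ := by
  rw [← adjoin.powerBasis_gen hx]
  exact (adjoin.powerBasis hx).adjoin_gen_eq_top

variable {k : Type u} {Ω : Type v} [Field k] [NumberField k] [Field Ω] [Algebra k Ω]

namespace IsCubicDatum

variable {K : IntermediateField k Ω} {d : k} {r : Ω} {s t : k} {w u : Ω}

theorem isIntegral_r (h : IsCubicDatum K d r s t w u) : IsIntegral k r := by
  refine IsIntegral.of_pow two_pos ?_
  rw [h.sq_eq]; exact isIntegral_algebraMap

theorem isIntegral_u (h : IsCubicDatum K d r s t w u) : IsIntegral k u := by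
  refine IsIntegral.of_pow three_pos ?_
  rw [h.u_cube]
  exact isIntegral_algebraMap.add (isIntegral_algebraMap.mul h.isIntegral_r)

theorem le_adjoin_u (h : IsCubicDatum K d r s t w u) : K ≤ k⟮u⟯ := by
  rw [← h.adjoin_eq, adjoin_simple_le_iff, ← h.u_add]
  exact add_mem (mem_adjoin_simple_self k u) (inv_mem (mem_adjoin_simple_self k u))

theorem adjoin_r_le (h : IsCubicDatum K d r s t w u) : k⟮r⟯ ≤ k⟮u⟯ := by
  rw [adjoin_simple_le_iff]
  have ht : algebraMap k Ω t ≠ 0 := by rw [_root_.map_ne_zero]; exact h.t_ne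
  have e : r = (u ^ 3 - algebraMap k Ω s) / algebraMap k Ω t := by
    rw [eq_div_iff ht, h.u_cube]; ring
  rw [e]
  exact div_mem (sub_mem (pow_mem (mem_adjoin_simple_self k u) 3)
    (IntermediateField.algebraMap_mem _ s)) (IntermediateField.algebraMap_mem _ t)

/-- The compositum `k(u)` as a tower over both `K` and `k(r)`. -/
theorem exists_tower (h : IsCubicDatum K d r s t w u) [NumberField K] [NumberField k⟮r⟯]
    {P : Prop}
    (H : ∀ [NumberField k⟮u⟯] [Algebra K k⟮u⟯] [Algebra k⟮r⟯ k⟮u⟯] [IsScalarTower k K k⟮u⟯]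
      [IsScalarTower k k⟮r⟯ k⟮u⟯] (δ : k⟮r⟯) (u' : k⟮u⟯),
      (δ : Ω) = algebraMap k Ω s + algebraMap k Ω t * r → u' ^ 3 = algebraMap k⟮r⟯ k⟮u⟯ δ →
      Module.finrank K k⟮u⟯ ≤ 2 → Module.finrank k⟮r⟯ k⟮u⟯ ≤ 3 →
      Algebra.adjoin k⟮r⟯ {u'} = ⊤ → P) : P := by
  haveI : FiniteDimensional k k⟮u⟯ := adjoin.finiteDimensional h.isIntegral_u
  haveI : NumberField k⟮u⟯ := numberField_of_finiteDimensional k k⟮u⟯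
  letI : Algebra K k⟮u⟯ := (inclusion h.le_adjoin_u).toRingHom.toAlgebra
  letI : Algebra k⟮r⟯ k⟮u⟯ := (inclusion h.adjoin_r_le).toRingHom.toAlgebra
  haveI : IsScalarTower k K k⟮u⟯ := IsScalarTower.of_algebraMap_eq fun x => rfl
  haveI : IsScalarTower k k⟮r⟯ k⟮u⟯ := IsScalarTower.of_algebraMap_eq fun x => rfl
  haveI : FiniteDimensional K k⟮u⟯ := Module.Finite.of_restrictScalars_finite k _ _
  haveI : FiniteDimensional k⟮r⟯ k⟮u⟯ := Module.Finite.of_restrictScalars_finite k _ _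
  have hgen := adjoin_gen_eq_top h.isIntegral_u
  obtain ⟨δ, hδ⟩ : ∃ δ : k⟮r⟯, (δ : Ω) = algebraMap k Ω s + algebraMap k Ω t * r :=
    ⟨⟨_, add_mem (IntermediateField.algebraMap_mem _ s)
      (mul_mem (IntermediateField.algebraMap_mem _ t) (mem_adjoin_simple_self k r))⟩, rfl⟩
  have hu3 : (AdjoinSimple.gen k u) ^ 3 = algebraMap k⟮r⟯ k⟮u⟯ δ := by
    apply Subtype.ext
    change u ^ 3 = (δ : Ω)
    rw [hδ, h.u_cube]
  refine H δ (AdjoinSimple.gen k u) hδ hu3 ?_ ?_ (adjoin_eq_top_of_tower hgen)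
  · have hm : (X ^ 2 - C (⟨w, h.mem⟩ : K) * X + 1 : Polynomial K).Monic := by monicity!
    refine (finrank_le_natDegree_of_adjoin_eq_top hm ?_ (adjoin_eq_top_of_tower hgen)).trans
      (by compute_degree!)
    apply Subtype.ext
    simp only [map_add, map_sub, map_mul, map_pow, aeval_X, aeval_C, map_one]
    change u ^ 2 - w * u + 1 = 0
    rw [← h.u_add]
    have := h.u_ne
    field_simp
    ring
  · have hm : (X ^ 3 - C δ : Polynomial k⟮r⟯).Monic := by monicity!
    refine (finrank_le_natDegree_of_adjoin_eq_top hm ?_ (adjoin_eq_top_of_tower hgen)).trans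
      (by compute_degree!)
    simp [hu3]

theorem exists_ramIdx_eq_three (h : IsCubicDatum K d r s t w u) [NumberField K]
    [NumberField k⟮r⟯] (p : HeightOneSpectrum (𝓞 k)) (v : HeightOneSpectrum (𝓞 k⟮r⟯))
    [v.asIdeal.LiesOver p.asIdeal] {δ : k⟮r⟯}
    (hδ : (δ : Ω) = algebraMap k Ω s + algebraMap k Ω t * r) (h3 : ¬ (3 : ℤ) ∣ vord v δ) :
    ∃ P : HeightOneSpectrum (𝓞 K), P.asIdeal.LiesOver p.asIdeal ∧ ramIdx p P = 3 := by
  refine h.exists_tower ?_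
  intro _ _ _ _ _ δ' u' hδ' hu h2 _ _
  obtain rfl : δ' = δ := Subtype.ext (hδ'.trans hδ.symm)
  exact _root_.exists_ramIdx_eq_three h.finrank h2 p v hu h3

theorem not_two_dvd_vord (h : IsCubicDatum K d r s t w u) [NumberField K]
    [NumberField k⟮r⟯] (p : HeightOneSpectrum (𝓞 k)) (h2 : (2 : 𝓞 k) ∉ p.asIdeal)
    (h3 : (3 : 𝓞 k) ∉ p.asIdeal) (P : HeightOneSpectrum (𝓞 K)) [P.asIdeal.LiesOver p.asIdeal]
    (hP : ramIdx p P = 2) : ¬ (2 : ℤ) ∣ vord p d := by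
  refine h.exists_tower ?_
  intro _ _ _ _ _ δ u' hδ hu _ hM3 hM
  have hr : (AdjoinSimple.gen k r) ^ 2 = algebraMap k k⟮r⟯ d := Subtype.ext h.sq_eq
  have hδ0 : δ ≠ 0 := by
    rintro rfl
    rw [← h.u_cube] at hδ
    exact h.u_ne (pow_eq_zero_iff three_ne_zero |>.1 hδ.symm)
  exact not_two_dvd_vord_of_ramIdx_eq_two p h2 h3 P hP h.d_ne hr
    (adjoin_gen_eq_top h.isIntegral_r) hδ0 hu hM hM3

theorem exists_two_dvd_ramIdx (h : IsCubicDatum K d r s t w u) [NumberField K]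
    (p : HeightOneSpectrum (𝓞 k)) (h2 : (2 : 𝓞 k) ∉ p.asIdeal) (h3 : (3 : 𝓞 k) ∉ p.asIdeal)
    (hd : ¬ (2 : ℤ) ∣ vord p d) :
    ∃ P : HeightOneSpectrum (𝓞 K), P.asIdeal.LiesOver p.asIdeal ∧ 2 ∣ ramIdx p P := by
  have hw : (⟨w, h.mem⟩ : K) ^ 3 - 3 * ⟨w, h.mem⟩ = 2 * algebraMap k K s := Subtype.ext h.eqn
  have hw' : (⟨w, h.mem⟩ : K) ∉ Set.range (algebraMap k K) := by
    rintro ⟨z, hz⟩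
    exact h.notMem ⟨z, congrArg Subtype.val hz⟩
  refine _root_.exists_two_dvd_ramIdx h.finrank p h2 h3 hw
    (trace_eq_zero_of_cubic_form h.finrank hw' hw) ?_
  rw [← h.rel, vord_mul p h.d_ne (pow_ne_zero 2 h.t_ne), vord_pow]
  rw [← even_iff_two_dvd, Int.not_even_iff_odd] at hd
  exact hd.add_even ⟨vord p t, by push_cast; ring⟩

end IsCubicDatum
end CubicRamification

section VOrdFactorization
open IsDedekindDomain

variable {K : Type*} [Field K] [NumberField K]

theorem vord_int_eq_count (v : HeightOneSpectrum (𝓞 K)) {x : 𝓞 K} (hx : x ≠ 0) :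
    vord v (x : K) = (Associates.mk v.asIdeal).count (Associates.mk (Ideal.span {x})).factors := by
  unfold vord
  rw [HeightOneSpectrum.valuation_of_algebraMap, v.intValuation_if_neg hx, WithZero.log_exp,
    neg_neg]

theorem vord_eq_count (v : HeightOneSpectrum (𝓞 K)) {x : K} (hx : x ≠ 0) :
    vord v x = FractionalIdeal.count K v
      (FractionalIdeal.spanSingleton (nonZeroDivisors (𝓞 K)) x) := by
  obtain ⟨a, b, hb, rfl⟩ := IsFractionRing.div_surjective (A := 𝓞 K) x
  have hb0 : b ≠ 0 := nonZeroDivisors.ne_zero hb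
  have ha0 : a ≠ 0 := by rintro rfl; simp at hx
  rw [FractionalIdeal.count_well_defined K v (a := b) (J := Ideal.span {a})
    (FractionalIdeal.spanSingleton_ne_zero_iff.2 hx),
    vord_div v (by simpa using ha0) (by simpa using hb0), vord_int_eq_count v ha0,
    vord_int_eq_count v hb0]
  rw [FractionalIdeal.coeIdeal_span_singleton, FractionalIdeal.spanSingleton_mul_spanSingleton,
    div_eq_inv_mul]

theorem exists_pow_eq_of_dvd_vord {x : K} (hx : x ≠ 0) {n : ℕ} (hn : n ≠ 0)
    (h : ∀ v : HeightOneSpectrum (𝓞 K), (n : ℤ) ∣ vord v x) :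
    ∃ I : (FractionalIdeal (nonZeroDivisors (𝓞 K)) K)ˣ,
      FractionalIdeal.spanSingleton (nonZeroDivisors (𝓞 K)) x = I.1 ^ n := by
  have hne : FractionalIdeal.spanSingleton (nonZeroDivisors (𝓞 K)) x ≠ 0 :=
    FractionalIdeal.spanSingleton_ne_zero_iff.2 hx
  have h1 := FractionalIdeal.finprod_heightOneSpectrum_factorization' K hne
  have hfin := FractionalIdeal.finite_factors
    (FractionalIdeal.spanSingleton (nonZeroDivisors (𝓞 K)) x)
  choose f hf using h
  have hf0 : ∀ v, FractionalIdeal.count K v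
      (FractionalIdeal.spanSingleton (nonZeroDivisors (𝓞 K)) x) = 0 → f v = 0 := by
    intro v hv
    rw [← vord_eq_count v hx, hf v] at hv
    exact (mul_eq_zero.1 hv).resolve_left (by exact_mod_cast hn)
  have h2 : (∏ᶠ v : HeightOneSpectrum (𝓞 K),
      (v.asIdeal : FractionalIdeal (nonZeroDivisors (𝓞 K)) K) ^ f v) ^ n =
      FractionalIdeal.spanSingleton (nonZeroDivisors (𝓞 K)) x := by
    rw [finprod_pow, ← h1]
    · refine finprod_congr fun v => ?_
      rw [← vord_eq_count v hx, hf v, mul_comm, zpow_mul, zpow_natCast]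
    · refine Set.Finite.subset hfin ?_
      intro v hv h0
      refine hv ?_
      simp only [hf0 v h0, zpow_zero]
  have h3 : (∏ᶠ v : HeightOneSpectrum (𝓞 K),
      (v.asIdeal : FractionalIdeal (nonZeroDivisors (𝓞 K)) K) ^ f v) ≠ 0 := by
    intro h0
    rw [h0, zero_pow hn] at h2
    exact hne h2.symm
  exact ⟨Units.mk0 _ h3, h2.symm⟩

end VOrdFactorization

section PrimesAbove
open IsDedekindDomain

variable {k E : Type*} [Field k] [NumberField k] [Field E] [NumberField E] [Algebra k E]

theorem card_le_finrank_of_liesOver (p : HeightOneSpectrum (𝓞 k))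
    (A : Finset (HeightOneSpectrum (𝓞 E))) (hA : ∀ v ∈ A, v.asIdeal.LiesOver p.asIdeal) :
    A.card ≤ Module.finrank k E := by
  haveI := p.isMaximal
  rw [← Ideal.sum_ramification_inertia (𝓞 E) k E (p := p.asIdeal) p.ne_bot]
  have h1 : A.image (·.asIdeal) ⊆ IsDedekindDomain.primesOverFinset p.asIdeal (𝓞 E) := by
    intro I hI
    obtain ⟨v, hv, rfl⟩ := Finset.mem_image.1 hI
    exact (IsDedekindDomain.mem_primesOverFinset_iff p.ne_bot _).mpr ⟨v.isPrime, hA v hv⟩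
  rw [← Finset.card_image_of_injective A (f := (·.asIdeal))
    (fun v w h => HeightOneSpectrum.ext h), Finset.card_eq_sum_ones]
  refine (Finset.sum_le_sum_of_subset h1).trans (Finset.sum_le_sum fun P hP => ?_)
  obtain ⟨hP1, hP2⟩ := (IsDedekindDomain.mem_primesOverFinset_iff p.ne_bot _).mp hP
  exact Nat.one_le_iff_ne_zero.2 (mul_ne_zero
    (Ideal.IsDedekindDomain.ramificationIdx'_ne_zero_of_liesOver P p.ne_bot)
    (Ideal.inertiaDeg'_ne_zero p.asIdeal P))

/-- The primes of `E` above a finite set of primes of `k`. -/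
theorem exists_finset_primesAbove (f : Finset (HeightOneSpectrum (𝓞 k))) :
    ∃ A : Finset (HeightOneSpectrum (𝓞 E)), A.card ≤ f.card * Module.finrank k E ∧
      ∀ p ∈ f, ∀ v : HeightOneSpectrum (𝓞 E), v.asIdeal.LiesOver p.asIdeal → v ∈ A := by
  have hfin : ∀ p : HeightOneSpectrum (𝓞 k),
      {v : HeightOneSpectrum (𝓞 E) | v.asIdeal.LiesOver p.asIdeal}.Finite := by
    intro p
    by_contra hinf
    obtain ⟨A, hA, hc⟩ := Set.Infinite.exists_subset_card_eq hinf (Module.finrank k E + 1)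
    have := card_le_finrank_of_liesOver p A fun v hv => hA hv
    omega
  refine ⟨f.biUnion fun p => (hfin p).toFinset, ?_, fun p hp v hv => Finset.mem_biUnion.2
    ⟨p, hp, (hfin p).mem_toFinset.2 hv⟩⟩
  refine (Finset.card_biUnion_le).trans ?_
  rw [← smul_eq_mul, ← Finset.sum_const]
  exact Finset.sum_le_sum fun p _ => card_le_finrank_of_liesOver p _ fun v hv =>
    (hfin p).mem_toFinset.1 hv

/-- Among finitely many elements whose orders are divisible by `n` away from `A`, a proportion
`n ^ (-#A)` have the same orders modulo `n`. -/
theorem exists_subset_dvd_vord_sub {ι : Type*} (S : Finset ι) (g : ι → E)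
    (A : Finset (HeightOneSpectrum (𝓞 E))) {n : ℕ} (hn : n ≠ 0)
    (hA : ∀ i ∈ S, ∀ v, v ∉ A → (n : ℤ) ∣ vord v (g i)) :
    ∃ T ⊆ S, S.card ≤ n ^ A.card * T.card ∧
      ∀ i ∈ T, ∀ j ∈ T, ∀ v, (n : ℤ) ∣ vord v (g i) - vord v (g j) := by
  haveI : NeZero n := ⟨hn⟩
  let σ : ι → (A → ZMod n) := fun i v => ((vord v.1 (g i) : ℤ) : ZMod n)
  rcases S.eq_empty_or_nonempty with rfl | hS
  · exact ⟨∅, Finset.Subset.refl _, by simp, by simp⟩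
  obtain ⟨s, -, hs⟩ := Finset.exists_max_image (Finset.univ : Finset (A → ZMod n))
    (fun s => (S.filter fun i => σ i = s).card) Finset.univ_nonempty
  refine ⟨S.filter fun i => σ i = s, Finset.filter_subset _ _, ?_, ?_⟩
  · rw [Finset.card_eq_sum_card_fiberwise (f := σ) (t := Finset.univ) (fun _ _ => Finset.mem_univ _)]
    refine (Finset.sum_le_card_nsmul _ _ _ hs).trans ?_
    rw [smul_eq_mul, Finset.card_univ, Fintype.card_fun, ZMod.card, Fintype.card_coe]
  · intro i hi j hj v
    obtain ⟨hi1, hi2⟩ := Finset.mem_filter.1 hi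
    obtain ⟨hj1, hj2⟩ := Finset.mem_filter.1 hj
    by_cases hv : v ∈ A
    · have := congrFun (hi2.trans hj2.symm) ⟨v, hv⟩
      rw [← ZMod.intCast_zmod_eq_zero_iff_dvd, Int.cast_sub, sub_eq_zero]
      exact this
    · exact dvd_sub (hA i hi1 v hv) (hA j hj1 v hv)

end PrimesAbove

section Signature
open IsDedekindDomain IntermediateField Polynomial

universe u v
variable {k : Type u} {Ω : Type v} [Field k] [NumberField k] [Field Ω] [Algebra k Ω]

theorem finrank_adjoin_sqrt_le {d : k} {r : Ω} (hr : r ^ 2 = algebraMap k Ω d) :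
    Module.finrank k k⟮r⟯ ≤ 2 := by
  have hm : (X ^ 2 - C d : Polynomial k).Monic := by monicity!
  have hr0 : aeval r (X ^ 2 - C d : Polynomial k) = 0 := by simp [hr]
  rw [adjoin.finrank ⟨_, hm, hr0⟩]
  refine (natDegree_le_of_degree_le ((minpoly.min k r hm hr0).trans degree_le_natDegree)).trans ?_
  compute_degree!

theorem IsCubicDatum.delta_ne_zero {K : IntermediateField k Ω} {d : k} {r : Ω} {s t : k} {w u : Ω}
    (h : IsCubicDatum K d r s t w u) : algebraMap k Ω s + algebraMap k Ω t * r ≠ 0 := by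
  rw [← h.u_cube]; exact pow_ne_zero 3 h.u_ne

theorem IsCubicDatum.delta_mul {K : IntermediateField k Ω} {d : k} {r : Ω} {s t : k} {w u : Ω}
    (h : IsCubicDatum K d r s t w u) : (algebraMap k Ω s + algebraMap k Ω t * r) *
      (algebraMap k Ω s - algebraMap k Ω t * r) = 1 := by
  linear_combination -h.algebraMap_rel - algebraMap k Ω t ^ 2 * h.sq_eq

/-- Grouping cubic fields with the same resolvent `k(r)` by the cube class of the ideal of `u³`. -/
theorem exists_subset_ideal_cube {d : k} {r : Ω} (T : Finset (IntermediateField k Ω))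
    (s t : IntermediateField k Ω → k) (w u : IntermediateField k Ω → Ω)
    (hr : r ^ 2 = algebraMap k Ω d)
    (hT : ∀ K ∈ T, IsCubicDatum K d r (s K) (t K) (w K) (u K))
    (f : Finset (HeightOneSpectrum (𝓞 k)))
    (hf : ∀ K ∈ T, ∀ [NumberField K], ∀ p : HeightOneSpectrum (𝓞 k),
      (∃ P : HeightOneSpectrum (𝓞 K), P.asIdeal.LiesOver p.asIdeal ∧ ramIdx p P = 3) → p ∈ f) :
    ∃ T' ⊆ T, T.card ≤ 9 ^ f.card * T'.card ∧ ∀ K ∈ T', ∀ J ∈ T', ∀ [NumberField k⟮r⟯],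
      ∃ g : k⟮r⟯, (g : Ω) = (algebraMap k Ω (s K) + algebraMap k Ω (t K) * r) *
        (algebraMap k Ω (s J) - algebraMap k Ω (t J) * r) ∧
        ∃ I : (FractionalIdeal (nonZeroDivisors (𝓞 k⟮r⟯)) k⟮r⟯)ˣ,
          FractionalIdeal.spanSingleton (nonZeroDivisors (𝓞 k⟮r⟯)) g = I.1 ^ 3 := by
  have hintegral : IsIntegral k r := by
    refine IsIntegral.of_pow two_pos ?_
    rw [hr]; exact isIntegral_algebraMap
  haveI : FiniteDimensional k k⟮r⟯ := adjoin.finiteDimensional hintegral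
  haveI : NumberField k⟮r⟯ := numberField_of_finiteDimensional k k⟮r⟯
  obtain ⟨A, hAc, hA⟩ := exists_finset_primesAbove (E := k⟮r⟯) f
  have hmem : ∀ a b : k, algebraMap k Ω a + algebraMap k Ω b * r ∈ k⟮r⟯ := fun a b =>
    add_mem (IntermediateField.algebraMap_mem _ a)
      (mul_mem (IntermediateField.algebraMap_mem _ b) (mem_adjoin_simple_self k r))
  let δ : IntermediateField k Ω → k⟮r⟯ := fun K => ⟨_, hmem (s K) (t K)⟩
  obtain ⟨T', hT', hc, hdvd⟩ := exists_subset_dvd_vord_sub T δ A three_ne_zero (by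
    intro K hK v hv
    by_contra hn
    haveI : FiniteDimensional k K := FiniteDimensional.of_finrank_pos (by
      rw [(hT K hK).finrank]; omega)
    haveI : NumberField K := numberField_of_finiteDimensional k K
    obtain ⟨p, hp⟩ := exists_primeBelow k v
    exact hv (hA p (hf K hK p ((hT K hK).exists_ramIdx_eq_three p v rfl hn)) v hp))
  refine ⟨T', hT', hc.trans (Nat.mul_le_mul_right _ ?_), ?_⟩
  · calc 3 ^ A.card ≤ 3 ^ (f.card * 2) := Nat.pow_le_pow_right (by norm_num)
          (hAc.trans (Nat.mul_le_mul_left _ (finrank_adjoin_sqrt_le hr)))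
      _ = 9 ^ f.card := by rw [mul_comm, pow_mul]; norm_num
  · intro K hK J hJ _
    have hKd := hT K (hT' hK)
    have hJd := hT J (hT' hJ)
    have hK0 : δ K ≠ 0 := fun h0 => hKd.delta_ne_zero (congrArg Subtype.val h0)
    have hJ0 : δ J ≠ 0 := fun h0 => hJd.delta_ne_zero (congrArg Subtype.val h0)
    refine ⟨δ K / δ J, ?_, exists_pow_eq_of_dvd_vord (div_ne_zero hK0 hJ0) three_ne_zero ?_⟩
    · change (algebraMap k Ω (s K) + algebraMap k Ω (t K) * r) /
        (algebraMap k Ω (s J) + algebraMap k Ω (t J) * r) = _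
      rw [div_eq_mul_inv, inv_eq_of_mul_eq_one_right hJd.delta_mul]
    · intro v
      rw [vord_div v hK0 hJ0]
      exact hdvd K hK J hJ v

end Signature

section ResolventSystem
open IsDedekindDomain IntermediateField

universe u v

/-- A square-class representative `d` with `(d) = 𝔰𝔠²` whose conjugates are balanced. -/
structure IsBalanced {k : Type u} [Field k] [NumberField k] (C : ℝ) (d : 𝓞 k)
    (s c : Ideal (𝓞 k)) : Prop where
  squarefree : Squarefree s
  span_eq : Ideal.span {d} = s * c ^ 2
  norm_le : (Ideal.absNorm c : ℝ) ≤ C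
  bound_le : ∀ φ : k →+* ℂ, ‖φ d‖ ^ Module.finrank ℚ k ≤ C * Ideal.absNorm s
  le_bound : ∀ φ : k →+* ℂ, (Ideal.absNorm s : ℝ) ≤ C * ‖φ d‖ ^ Module.finrank ℚ k

theorem exists_resolvent_system (k : Type u) (Ω : Type v) [Field k] [NumberField k] [Field Ω]
    [Algebra k Ω] [IsAlgClosed Ω] : ∃ C : ℝ, 1 ≤ C ∧ ∃ (G : Set (𝓞 k)) (r : 𝓞 k → Ω)
      (s c : 𝓞 k → Ideal (𝓞 k)),
      (∀ e ∈ G, e ≠ 0 ∧ r e ^ 2 = algebraMap k Ω e ∧ IsBalanced C e (s e) (c e)) ∧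
      (∀ e ∈ G, ∀ e' ∈ G, ∀ z : k, z ≠ 0 → (e : k) = e' * z ^ 2 → e = e') ∧
      ∀ d₀ : k, d₀ ≠ 0 → ∃ e ∈ G, ∃ z : k, z ≠ 0 ∧ (e : k) = d₀ * z ^ 2 := by
  obtain ⟨C, hC, hbal⟩ := exists_balanced k
  let R : Setoid k :=
    { r := fun a b => ∃ z : k, z ≠ 0 ∧ a = b * z ^ 2
      iseqv :=
        ⟨fun a => ⟨1, one_ne_zero, by ring⟩,
         fun {a b} ⟨z, hz, h⟩ => ⟨z⁻¹, inv_ne_zero hz, by rw [h]; field_simp⟩,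
         fun {a b c} ⟨z, hz, h⟩ ⟨y, hy, h'⟩ => ⟨z * y, mul_ne_zero hz hy, by rw [h, h']; ring⟩⟩ }
  have hex : ∀ x : Quotient R, ∃ d : 𝓞 k, ∃ (s c : Ideal (𝓞 k)), x.out ≠ 0 →
      (∃ z : k, z ≠ 0 ∧ (d : k) = x.out * z ^ 2) ∧ IsBalanced C d s c := by
    intro x
    by_cases hx : x.out = 0
    · exact ⟨0, ⊥, ⊥, fun h => absurd hx h⟩
    · obtain ⟨z, d, s, c, hz, h1, h2, h3, h4, h5, h6⟩ := hbal x.out hx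
      exact ⟨d, s, c, fun _ => ⟨⟨z, hz, h1⟩, ⟨h2, h3, h4, h5, h6⟩⟩⟩
  choose D hD using hex
  have hsq : ∀ e : 𝓞 k, ∃ ρ : Ω, ρ ^ 2 = algebraMap k Ω e := fun e =>
    IsAlgClosed.exists_pow_nat_eq _ two_pos
  choose r hr using hsq
  let G : Set (𝓞 k) := {e | ∃ x : Quotient R, x.out ≠ 0 ∧ D x = e}
  have hG : ∀ e ∈ G, ∃ s c : Ideal (𝓞 k), IsBalanced C e s c := by
    rintro e ⟨x, hx, rfl⟩
    obtain ⟨s, c, h⟩ := hD x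
    exact ⟨s, c, (h hx).2⟩
  have hrel : ∀ x : Quotient R, x.out ≠ 0 → ∃ z : k, z ≠ 0 ∧ (D x : k) = x.out * z ^ 2 := by
    intro x hx
    obtain ⟨s, c, h⟩ := hD x
    exact (h hx).1
  have hout : ∀ x : Quotient R, x.out ≠ 0 → Quotient.mk R (D x : k) = x := by
    intro x hx
    conv_rhs => rw [← x.out_eq]
    exact Quotient.sound (hrel x hx)
  have hG' : ∀ e : 𝓞 k, ∃ s c : Ideal (𝓞 k), e ∈ G → IsBalanced C e s c := by
    intro e
    by_cases he : e ∈ G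
    · obtain ⟨s, c, h⟩ := hG e he
      exact ⟨s, c, fun _ => h⟩
    · exact ⟨⊥, ⊥, fun h => absurd h he⟩
  choose s c hsc using hG'
  refine ⟨C, hC, G, r, s, c, ?_, ?_, ?_⟩
  · intro e he
    refine ⟨?_, hr e, hsc e he⟩
    obtain ⟨x, hx, rfl⟩ := he
    obtain ⟨z, hz, h⟩ := hrel x hx
    intro h0
    rw [h0] at h
    exact mul_ne_zero hx (pow_ne_zero 2 hz) (by rw [← h]; simp)
  · rintro e ⟨x, hx, rfl⟩ e' ⟨x', hx', rfl⟩ z hz h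
    have h1 : Quotient.mk R (D x : k) = Quotient.mk R (D x' : k) := Quotient.sound ⟨z, hz, h⟩
    rw [hout x hx, hout x' hx'] at h1
    rw [h1]
  · intro d₀ hd₀
    obtain ⟨z, hz, h⟩ : ∃ z : k, z ≠ 0 ∧ (Quotient.mk R d₀).out = d₀ * z ^ 2 :=
      Quotient.exact (s := R) (Quotient.out_eq (Quotient.mk R d₀))
    have hx : (Quotient.mk R d₀).out ≠ 0 := by rw [h]; exact mul_ne_zero hd₀ (pow_ne_zero 2 hz)
    obtain ⟨y, hy, h'⟩ := hrel _ hx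
    exact ⟨_, ⟨_, hx, rfl⟩, z * y, mul_ne_zero hz hy, by rw [h', h]; ring⟩

theorem exists_isCubicDatum {k : Type u} {Ω : Type v} [Field k] [NumberField k] [Field Ω]
    [Algebra k Ω] [IsAlgClosed Ω] {G : Set (𝓞 k)} {r : 𝓞 k → Ω}
    (hr : ∀ e ∈ G, r e ^ 2 = algebraMap k Ω e)
    (hG : ∀ d₀ : k, d₀ ≠ 0 → ∃ e ∈ G, ∃ z : k, z ≠ 0 ∧ (e : k) = d₀ * z ^ 2)
    (K : IntermediateField k Ω) (hK : Module.finrank k K = 3) :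
    ∃ e ∈ G, ∃ (s t : k) (w u : Ω), IsCubicDatum K (e : k) (r e) s t w u := by
  obtain ⟨w, s, hw, hs, h⟩ := exists_cubic_form hK
  obtain ⟨e, he, z, hz, hez⟩ := hG _ hs
  have hrel : (e : k) * (z⁻¹) ^ 2 = s ^ 2 - 1 := by rw [hez]; field_simp
  have heqn : (w : Ω) ^ 3 - 3 * w = 2 * algebraMap k Ω s := congrArg Subtype.val h
  obtain ⟨u, hu0, hu1, hu2⟩ := exists_add_inv_eq (hr e he) hrel heqn
  refine ⟨e, he, s, z⁻¹, w, u, hK, hr e he, inv_ne_zero hz, ?_, hrel, w.2, ?_, heqn, hu0, hu1, hu2⟩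
  · rw [hez]; exact mul_ne_zero hs (pow_ne_zero 2 hz)
  · rintro ⟨y, hy⟩
    exact hw ⟨y, Subtype.ext hy⟩

theorem exists_sq_of_adjoin_eq {k : Type u} {Ω : Type v} [Field k] [CharZero k] [Field Ω]
    [Algebra k Ω] {d d' : k} {r r' : Ω} (hr : r ^ 2 = algebraMap k Ω d)
    (hr' : r' ^ 2 = algebraMap k Ω d') (h : r ∉ Set.range (algebraMap k Ω))
    (h' : r' ∉ Set.range (algebraMap k Ω)) (he : k⟮r⟯ = k⟮r'⟯) : ∃ z : k, z ≠ 0 ∧ d = d' * z ^ 2 := by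
  have hmem : r ∈ k⟮r'⟯ := he ▸ mem_adjoin_simple_self k r
  obtain ⟨a, b, hab⟩ := mem_adjoin_sqrt hr' hmem
  have hb : b ≠ 0 := by
    rintro rfl
    exact h ⟨a, by rw [hab]; simp⟩
  have h2 : algebraMap k Ω (2 * a * b) * r' = algebraMap k Ω (d - a ^ 2 - b ^ 2 * d') := by
    simp only [map_mul, map_sub, map_pow, map_ofNat, ← hr, ← hr']
    rw [hab]; ring
  have ha : a = 0 := by
    by_contra ha
    have hne : algebraMap k Ω (2 * a * b) ≠ 0 := by
      rw [_root_.map_ne_zero]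
      exact mul_ne_zero (mul_ne_zero two_ne_zero ha) hb
    refine h' ⟨(d - a ^ 2 - b ^ 2 * d') / (2 * a * b), ?_⟩
    rw [map_div₀, ← h2, mul_div_cancel_left₀ _ hne]
  refine ⟨b, hb, ?_⟩
  rw [ha] at h2
  have h3 : algebraMap k Ω (d - 0 ^ 2 - b ^ 2 * d') = 0 := by rw [← h2]; simp
  rw [map_eq_zero] at h3
  linear_combination h3

end ResolventSystem

section CubicFamily
open IsDedekindDomain IntermediateField

universe u v
variable {k : Type u} {Ω : Type v} [Field k] [NumberField k] [Field Ω] [Algebra k Ω]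

theorem IsCubicDatum.nonempty_algEquiv_of_ratio {K K' J : IntermediateField k Ω} {d : k} {r : Ω}
    {s t s' t' a b : k} {w u w' u' w₀ u₀ : Ω} (h : IsCubicDatum K d r s t w u)
    (h' : IsCubicDatum K' d r s' t' w' u') (hJ : IsCubicDatum J d r a b w₀ u₀) {z : Ω}
    (hz : z ∈ k⟮r⟯)
    (he : (algebraMap k Ω s + algebraMap k Ω t * r) * (algebraMap k Ω a - algebraMap k Ω b * r) =
      (algebraMap k Ω s' + algebraMap k Ω t' * r) * (algebraMap k Ω a - algebraMap k Ω b * r) *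
        z ^ 3) : Nonempty (K ≃ₐ[k] K') := by
  refine h.nonempty_algEquiv h' hz ?_
  have h1 := hJ.delta_mul
  rw [h.u_cube, h'.u_cube]
  linear_combination (algebraMap k Ω a + algebraMap k Ω b * r) * he -
    (algebraMap k Ω s + algebraMap k Ω t * r -
      (algebraMap k Ω s' + algebraMap k Ω t' * r) * z ^ 3) * h1

theorem exists_ratio_family (T : Finset (IntermediateField k Ω)) (r : 𝓞 k → Ω)
    (e : IntermediateField k Ω → 𝓞 k) (s t : IntermediateField k Ω → k)
    (w u : IntermediateField k Ω → Ω)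
    (hT : ∀ K ∈ T, IsCubicDatum K (e K : k) (r (e K)) (s K) (t K) (w K) (u K))
    (hiso : ∀ K ∈ T, ∀ J ∈ T, Nonempty (K ≃ₐ[k] J) → K = J)
    (f : Finset (HeightOneSpectrum (𝓞 k)))
    (hf : ∀ K ∈ T, ∀ [NumberField K], ∀ p : HeightOneSpectrum (𝓞 k),
      (∃ P : HeightOneSpectrum (𝓞 K), P.asIdeal.LiesOver p.asIdeal ∧ ramIdx p P = 3) → p ∈ f) :
    ∃ U ⊆ T, ∃ x y : IntermediateField k Ω → k, T.card ≤ 9 ^ f.card * U.card ∧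
      (∀ K ∈ U, x K ^ 2 - y K ^ 2 * e K = 1 ∧ ∀ [NumberField k⟮r (e K)⟯], ∃ g : k⟮r (e K)⟯,
        (g : Ω) = algebraMap k Ω (x K) + algebraMap k Ω (y K) * r (e K) ∧
        ∃ I : (FractionalIdeal (nonZeroDivisors (𝓞 k⟮r (e K)⟯)) k⟮r (e K)⟯)ˣ,
          FractionalIdeal.spanSingleton (nonZeroDivisors (𝓞 k⟮r (e K)⟯)) g = I.1 ^ 3) ∧
      ∀ K ∈ U, ∀ K' ∈ U, e K = e K' → ∀ z ∈ k⟮r (e K)⟯,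
        algebraMap k Ω (x K) + algebraMap k Ω (y K) * r (e K) =
          (algebraMap k Ω (x K') + algebraMap k Ω (y K') * r (e K')) * z ^ 3 → K = K' := by
  have hfib : ∀ e₀ : 𝓞 k, ∃ T' ⊆ T.filter (fun K => e K = e₀),
      (T.filter fun K => e K = e₀).card ≤ 9 ^ f.card * T'.card ∧
      ∀ K ∈ T', ∀ J ∈ T', ∀ [NumberField k⟮r e₀⟯], ∃ g : k⟮r e₀⟯,
        (g : Ω) = (algebraMap k Ω (s K) + algebraMap k Ω (t K) * r e₀) *
        (algebraMap k Ω (s J) - algebraMap k Ω (t J) * r e₀) ∧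
        ∃ I : (FractionalIdeal (nonZeroDivisors (𝓞 k⟮r e₀⟯)) k⟮r e₀⟯)ˣ,
          FractionalIdeal.spanSingleton (nonZeroDivisors (𝓞 k⟮r e₀⟯)) g = I.1 ^ 3 := by
    intro e₀
    rcases (T.filter fun K => e K = e₀).eq_empty_or_nonempty with h0 | ⟨K₀, hK₀⟩
    · exact ⟨∅, Finset.empty_subset _, by simp [h0], by simp⟩
    · have hd : ∀ K ∈ T.filter (fun K => e K = e₀),
          IsCubicDatum K (e₀ : k) (r e₀) (s K) (t K) (w K) (u K) := by
        intro K hK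
        obtain ⟨h1, rfl⟩ := Finset.mem_filter.1 hK
        exact hT K h1
      exact exists_subset_ideal_cube _ s t w u (hd K₀ hK₀).sq_eq hd f
        fun K hK => hf K (Finset.mem_filter.1 hK).1
  choose T' hT'1 hT'2 hT'3 using hfib
  have hJ : ∀ e₀ : 𝓞 k, ∃ J : IntermediateField k Ω, (T' e₀).Nonempty → J ∈ T' e₀ := by
    intro e₀
    by_cases h : (T' e₀).Nonempty
    · exact ⟨h.choose, fun _ => h.choose_spec⟩
    · exact ⟨⊥, fun h' => absurd h' h⟩
  choose J hJ using hJ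
  have hU : ∀ K ∈ T.filter (fun K => K ∈ T' (e K)), K ∈ T ∧ K ∈ T' (e K) ∧ J (e K) ∈ T' (e K) ∧
      J (e K) ∈ T ∧ e (J (e K)) = e K := by
    intro K hK
    obtain ⟨h1, h2⟩ := Finset.mem_filter.1 hK
    have h3 := hJ (e K) ⟨K, h2⟩
    have h4 := Finset.mem_filter.1 (hT'1 _ h3)
    exact ⟨h1, h2, h3, h4.1, h4.2⟩
  have hdat : ∀ K ∈ T.filter (fun K => K ∈ T' (e K)), IsCubicDatum (J (e K)) (e K : k) (r (e K))
      (s (J (e K))) (t (J (e K))) (w (J (e K))) (u (J (e K))) := by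
    intro K hK
    obtain ⟨-, -, -, h4, h5⟩ := hU K hK
    have := hT _ h4
    rwa [h5] at this
  have hexp : ∀ K ∈ T, ∀ J', algebraMap k Ω (s K * s J' - t K * t J' * e K) +
      algebraMap k Ω (t K * s J' - s K * t J') * r (e K) =
      (algebraMap k Ω (s K) + algebraMap k Ω (t K) * r (e K)) *
        (algebraMap k Ω (s J') - algebraMap k Ω (t J') * r (e K)) := by
    intro K hK J'
    have hsq := (hT K hK).sq_eq
    simp only [map_sub, map_mul]
    linear_combination algebraMap k Ω (t K) * algebraMap k Ω (t J') * hsq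
  refine ⟨T.filter fun K => K ∈ T' (e K), Finset.filter_subset _ _,
    fun K => s K * s (J (e K)) - t K * t (J (e K)) * e K,
    fun K => t K * s (J (e K)) - s K * t (J (e K)), ?_, ?_, ?_⟩
  · rw [Finset.card_eq_sum_card_image e T,
      Finset.card_eq_sum_card_fiberwise (f := e) (s := T.filter fun K => K ∈ T' (e K))
        (t := T.image e) (fun K hK => Finset.mem_image_of_mem e (Finset.mem_filter.1 hK).1),
      Finset.mul_sum]
    refine Finset.sum_le_sum fun e₀ _ => (hT'2 e₀).trans (Nat.mul_le_mul_left _ ?_)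
    refine Finset.card_le_card fun K hK => ?_
    obtain ⟨h1, h2⟩ := Finset.mem_filter.1 (hT'1 e₀ hK)
    exact Finset.mem_filter.2 ⟨Finset.mem_filter.2 ⟨h1, by rw [h2]; exact hK⟩, h2⟩
  · intro K hK
    obtain ⟨h1, h2, h3, h4, h5⟩ := hU K hK
    constructor
    · have e1 := (hT K h1).rel
      have e2 := (hdat K hK).rel
      linear_combination (s (J (e K)) ^ 2 - t (J (e K)) ^ 2 * e K) * (-e1) - e2
    · intro _
      rw [hexp K h1]
      exact hT'3 (e K) K h2 _ h3
  · intro K hK K' hK' hee z hz h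
    obtain ⟨h1, -⟩ := hU K hK
    obtain ⟨h1', -⟩ := hU K' hK'
    rw [hexp K h1, hexp K' h1'] at h
    refine hiso K h1 K' h1' ?_
    have hd' := hT K' h1'
    rw [← hee] at hd' h
    exact (hT K h1).nonempty_algEquiv_of_ratio hd' (hdat K hK) hz h

end CubicFamily

section CubicCount
open IsDedekindDomain IntermediateField

universe u v

theorem card_le_of_ideal_cube_bot (k : Type u) (Ω : Type v) [Field k] [NumberField k] [Field Ω]
    [Algebra k Ω] : ∃ C : ℝ, 1 ≤ C ∧ ∀ E : IntermediateField k Ω, E = ⊥ → ∀ [NumberField E]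
      (S : Finset E), (∀ γ ∈ S, γ ≠ 0 ∧ ∃ I : (FractionalIdeal (nonZeroDivisors (𝓞 E)) E)ˣ,
      FractionalIdeal.spanSingleton (nonZeroDivisors (𝓞 E)) γ = I.1 ^ 3) →
      (∀ γ ∈ S, ∀ γ' ∈ S, ∀ z, γ = γ' * z ^ 3 → γ = γ') → (S.card : ℝ) ≤ C := by
  have : NumberField (⊥ : IntermediateField k Ω) := numberField_of_finiteDimensional k _
  obtain ⟨C, hC, h⟩ := card_le_of_ideal_cube (⊥ : IntermediateField k Ω)
  refine ⟨C, hC, ?_⟩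
  rintro E rfl _ S h1 h2
  exact h S h1 h2

theorem card_le_of_isBalanced {k : Type u} [Field k] [NumberField k] {C₁ Y : ℝ} (hC₁ : 1 ≤ C₁)
    (hY : 0 ≤ Y) {s c : 𝓞 k → Ideal (𝓞 k)} (S : Finset (𝓞 k))
    (hS : ∀ e ∈ S, IsBalanced C₁ e (s e) (c e)) (hSY : ∀ e ∈ S, (Ideal.absNorm (s e) : ℝ) ≤ Y)
    (P : Finset (Ideal (𝓞 k))) (hP : ∀ p ∈ P, p.IsPrime ∧ p ≠ ⊥) (hSP : ∀ e ∈ S, ∀ p ∈ P, s e ≤ p) :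
    (S.card : ℝ) ≤ 64 ^ Module.finrank ℚ k * (C₁ * Y / Ideal.absNorm (∏ p ∈ P, p) + 1) := by
  have hn : Module.finrank ℚ k ≠ 0 := Module.finrank_pos.ne'
  have hCY : 0 ≤ C₁ * Y := by positivity
  have hpow : ((C₁ * Y) ^ ((Module.finrank ℚ k : ℝ)⁻¹)) ^ Module.finrank ℚ k = C₁ * Y :=
    Real.rpow_inv_natCast_pow hCY hn
  have hmem : ∀ e ∈ S, e ∈ ∏ p ∈ P, p := by
    intro e he
    refine prod_le_of_forall_mem P hP fun p hp => ?_
    have h1 : e ∈ s e * c e ^ 2 := by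
      rw [← (hS e he).span_eq]; exact Ideal.mem_span_singleton_self e
    exact hSP e he p hp ((Ideal.mul_le_left : s e * c e ^ 2 ≤ s e) h1)
  have hbot : ∏ p ∈ P, p ≠ ⊥ := Finset.prod_ne_zero_iff.mpr fun p hp => (hP p hp).2
  have h := card_le_of_box hbot (Real.rpow_nonneg hCY ((Module.finrank ℚ k : ℝ)⁻¹)) S ?_ ?_
  · rwa [hpow] at h
  · intro e he φ
    refine (pow_le_pow_iff_left₀ (norm_nonneg _) (Real.rpow_nonneg hCY _) hn).1 ?_
    rw [hpow]
    refine ((hS e he).bound_le φ).trans ?_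
    exact mul_le_mul_of_nonneg_left (hSY e he) (by linarith)
  · exact fun x hx y hy => Ideal.sub_mem _ (hmem x hx) (hmem y hy)

set_option maxHeartbeats 1000000 in
theorem card_le_of_isCubicDatum (k : Type u) (Ω : Type v) [Field k] [NumberField k] [Field Ω]
    [Algebra k Ω] (C₁ : ℝ) (hC₁ : 1 ≤ C₁) (M : ℕ) (hM0 : M ≠ 0) : ∃ C : ℝ, 1 ≤ C ∧
    ∀ (G : Set (𝓞 k)) (r : 𝓞 k → Ω) (sf c : 𝓞 k → Ideal (𝓞 k)),
    (∀ e ∈ G, e ≠ 0 ∧ r e ^ 2 = algebraMap k Ω e ∧ IsBalanced C₁ e (sf e) (c e)) →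
    (∀ e ∈ G, Ideal.absNorm (c e) ∣ M) →
    (∀ e ∈ G, ∀ e' ∈ G, ∀ z : k, z ≠ 0 → (e : k) = e' * z ^ 2 → e = e') →
    ∀ (T : Finset (IntermediateField k Ω)) (e : IntermediateField k Ω → 𝓞 k)
    (s t : IntermediateField k Ω → k) (w u : IntermediateField k Ω → Ω)
    (f : Finset (HeightOneSpectrum (𝓞 k))) (P : Finset (Ideal (𝓞 k))) (Y : ℝ), 0 ≤ Y →
    (∀ K ∈ T, e K ∈ G ∧ IsCubicDatum K (e K : k) (r (e K)) (s K) (t K) (w K) (u K)) →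
    (∀ K ∈ T, ∀ J ∈ T, Nonempty (K ≃ₐ[k] J) → K = J) →
    (∀ K ∈ T, ∀ [NumberField K], ∀ p : HeightOneSpectrum (𝓞 k),
      (∃ P : HeightOneSpectrum (𝓞 K), P.asIdeal.LiesOver p.asIdeal ∧ ramIdx p P = 3) → p ∈ f) →
    (∀ K ∈ T, (Ideal.absNorm (sf (e K)) : ℝ) ≤ Y) →
    (∀ p ∈ P, p.IsPrime ∧ p ≠ ⊥ ∧ (M : 𝓞 k) ∉ p) → (∀ K ∈ T, ∀ p ∈ P, sf (e K) ≤ p) →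
    (T.card : ℝ) ≤ C * 9 ^ f.card * (4 ^ P.card *
      (Y / Ideal.absNorm (∏ p ∈ P, p) + Y ^ ((3 : ℝ) / 4) + 1)) := by
  obtain ⟨A, hA, hform⟩ := card_le_of_isFormDatum k Ω C₁ hC₁ M hM0
  obtain ⟨B, hB, hbot⟩ := card_le_of_ideal_cube_bot k Ω
  obtain ⟨D, hD⟩ : ∃ D : ℝ, D = 64 ^ Module.finrank ℚ k := ⟨_, rfl⟩
  have hD1 : 1 ≤ D := hD ▸ one_le_pow₀ (by norm_num)
  refine ⟨A + B + D * C₁, by nlinarith, ?_⟩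
  intro G r sf c hG hGM huniq T e s t w u f P Y hY hT hiso hf hTY hP hTP
  obtain ⟨U, hUT, x, y, hcard, hU, hsep⟩ :=
    exists_ratio_family T r e s t w u (fun K hK => (hT K hK).2) hiso f hf
  have hne : ∀ K ∈ U, algebraMap k Ω (x K) + algebraMap k Ω (y K) * r (e K) ≠ 0 := by
    intro K hK h0
    have h1 := congrArg (algebraMap k Ω) (hU K hK).1
    have h2 := (hG _ (hT K (hUT hK)).1).2.1
    simp only [map_sub, map_mul, map_pow, map_one] at h1
    apply one_ne_zero (α := Ω)
    rw [← h1]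
    linear_combination (algebraMap k Ω (x K) - algebraMap k Ω (y K) * r (e K)) * h0 +
      algebraMap k Ω (y K) ^ 2 * h2
  obtain ⟨S₀, hS₀⟩ : ∃ S, S = U.filter fun K => r (e K) ∈ Set.range (algebraMap k Ω) := ⟨_, rfl⟩
  obtain ⟨S₂, hS₂⟩ : ∃ S, S = U.filter fun K => ∃ z ∈ k⟮r (e K)⟯,
    algebraMap k Ω (x K) + algebraMap k Ω (y K) * r (e K) = z ^ 3 := ⟨_, rfl⟩
  obtain ⟨S₁, hS₁⟩ : ∃ S, S = U.filter fun K => r (e K) ∉ Set.range (algebraMap k Ω) ∧ ∀ z ∈ k⟮r (e K)⟯,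
    algebraMap k Ω (x K) + algebraMap k Ω (y K) * r (e K) ≠ z ^ 3 := ⟨_, rfl⟩
  have hsub : U ⊆ S₁ ∪ (S₀ ∪ S₂) := by
    intro K hK
    simp only [hS₀, hS₁, hS₂, Finset.mem_union, Finset.mem_filter, hK, true_and]
    by_cases h1 : r (e K) ∈ Set.range (algebraMap k Ω)
    · exact Or.inr (Or.inl h1)
    · by_cases h2 : ∃ z ∈ k⟮r (e K)⟯,
        algebraMap k Ω (x K) + algebraMap k Ω (y K) * r (e K) = z ^ 3
      · exact Or.inr (Or.inr h2)
      · exact Or.inl ⟨h1, fun z hz h => h2 ⟨z, hz, h⟩⟩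
  have hUc : U.card ≤ S₁.card + (S₀.card + S₂.card) :=
    (Finset.card_le_card hsub).trans ((Finset.card_union_le _ _).trans
      (Nat.add_le_add_left (Finset.card_union_le _ _) _))
  have hsU₀ : S₀ ⊆ U := hS₀ ▸ Finset.filter_subset _ _
  have hsU₁ : S₁ ⊆ U := hS₁ ▸ Finset.filter_subset _ _
  have hsU₂ : S₂ ⊆ U := hS₂ ▸ Finset.filter_subset _ _
  have hg1 := one_le_absNorm_prod P fun p hp => ⟨(hP p hp).1, (hP p hp).2.1⟩
  obtain ⟨g, hg⟩ : ∃ g : ℝ, g = Ideal.absNorm (∏ p ∈ P, p) := ⟨_, rfl⟩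
  rw [← hg] at hg1 ⊢
  have h1 : (S₁.card : ℝ) ≤ A * 4 ^ P.card * (Y / g + Y ^ ((3 : ℝ) / 4)) := by
    rw [hg]
    refine hform S₁ (fun K => r (e K)) e (fun K => sf (e K)) (fun K => c (e K)) x y Y P hY ?_
      (fun K hK => hTY K (hUT (hsU₁ hK))) hP (fun K hK => hTP K (hUT (hsU₁ hK))) ?_ ?_
    · intro K hK
      have hKU := hsU₁ hK
      rw [hS₁, Finset.mem_filter] at hK
      obtain ⟨-, h2, h3⟩ := hG _ (hT K (hUT hKU)).1
      exact ⟨h2, hK.2.1, h3.squarefree, h3.span_eq, h3.norm_le, hGM _ (hT K (hUT hKU)).1,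
        h3.le_bound, (hU K hKU).1, hK.2.2, (hU K hKU).2⟩
    · intro K hK J hJ h
      have hKG := (hT K (hUT (hsU₁ hK))).1
      have hJG := (hT J (hUT (hsU₁ hJ))).1
      rw [hS₁, Finset.mem_filter] at hK hJ
      obtain ⟨z, hz, h⟩ := exists_sq_of_adjoin_eq (hG _ hKG).2.1 (hG _ hJG).2.1 hK.2.1 hJ.2.1 h
      have := huniq _ hKG _ hJG z hz h
      simp only [this]
    · intro K hK J hJ h z hz hzz
      refine hsep K (hsU₁ hK) J (hsU₁ hJ) ?_ z hz hzz
      have hKG := (hT K (hUT (hsU₁ hK))).1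
      have hJG := (hT J (hUT (hsU₁ hJ))).1
      have h4 : algebraMap k Ω (e K : k) = algebraMap k Ω (e J : k) := by
        rw [← (hG _ hKG).2.1, ← (hG _ hJG).2.1, h]
      exact NumberField.RingOfIntegers.ext ((algebraMap k Ω).injective h4)
  have h2 : (S₂.card : ℝ) ≤ D * (C₁ * Y / g + 1) := by
    have hinj : Set.InjOn e S₂ := by
      intro K hK J hJ h
      have hK' := hK
      have hJ' := hJ
      rw [Finset.mem_coe, hS₂, Finset.mem_filter] at hK hJ
      obtain ⟨-, z, hz, hzK⟩ := hK
      obtain ⟨-, z', hz', hzJ⟩ := hJ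
      have hz'0 : z' ≠ 0 := by
        rintro rfl
        exact hne J (hsU₂ hJ') (by rw [hzJ]; simp)
      refine hsep K (hsU₂ hK') J (hsU₂ hJ') h (z / z') (div_mem hz (by rwa [h])) ?_
      rw [hzK, hzJ]; field_simp
    rw [← Finset.card_image_of_injOn hinj, hD, hg]
    refine card_le_of_isBalanced hC₁ hY (s := sf) (c := c) _ ?_ ?_ P
      (fun p hp => ⟨(hP p hp).1, (hP p hp).2.1⟩) ?_
    all_goals
      intro e' he'
      obtain ⟨K, hK, rfl⟩ := Finset.mem_image.1 he'
    · exact (hG _ (hT K (hUT (hsU₂ hK))).1).2.2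
    · exact hTY K (hUT (hsU₂ hK))
    · exact hTP K (hUT (hsU₂ hK))
  have h0 : (S₀.card : ℝ) ≤ B := by
    rcases S₀.eq_empty_or_nonempty with h0 | ⟨K₀, hK₀⟩
    · rw [h0]; simp; linarith
    have he : ∀ K ∈ S₀, e K = e K₀ := by
      intro K hK
      have hKG := (hT K (hUT (hsU₀ hK))).1
      have hJG := (hT K₀ (hUT (hsU₀ hK₀))).1
      have hK' := hK
      have hJ' := hK₀
      rw [hS₀, Finset.mem_filter] at hK' hJ'
      obtain ⟨-, a, ha⟩ := hK'
      obtain ⟨-, b, hb⟩ := hJ'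
      have hae : a ^ 2 = (e K : k) := (algebraMap k Ω).injective (by
        rw [map_pow, ha]; exact (hG _ hKG).2.1)
      have hbe : b ^ 2 = (e K₀ : k) := (algebraMap k Ω).injective (by
        rw [map_pow, hb]; exact (hG _ hJG).2.1)
      have ha0 : a ≠ 0 := by
        rintro rfl
        exact (hT K (hUT (hsU₀ hK))).2.d_ne (by rw [← hae]; simp)
      have hb0 : b ≠ 0 := by
        rintro rfl
        exact (hT K₀ (hUT (hsU₀ hK₀))).2.d_ne (by rw [← hbe]; simp)
      refine huniq _ hKG _ hJG (a / b) (div_ne_zero ha0 hb0) ?_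
      rw [← hae, ← hbe]; field_simp
    obtain ⟨e₀, he₀⟩ : ∃ e₀, e₀ = e K₀ := ⟨_, rfl⟩
    rw [← he₀] at he
    have hE : k⟮r e₀⟯ = ⊥ := by
      have h3 := hK₀
      rw [hS₀, Finset.mem_filter, ← he₀] at h3
      rw [IntermediateField.adjoin_simple_eq_bot_iff, IntermediateField.mem_bot]
      exact h3.2
    have : FiniteDimensional k k⟮r e₀⟯ := by rw [hE]; infer_instance
    have : NumberField k⟮r e₀⟯ := numberField_of_finiteDimensional k _
    have hgen : ∀ K ∈ S₀, ∃ g : k⟮r e₀⟯,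
        (g : Ω) = algebraMap k Ω (x K) + algebraMap k Ω (y K) * r e₀ ∧
        ∃ I : (FractionalIdeal (nonZeroDivisors (𝓞 k⟮r e₀⟯)) k⟮r e₀⟯)ˣ,
          FractionalIdeal.spanSingleton (nonZeroDivisors (𝓞 k⟮r e₀⟯)) g = I.1 ^ 3 := by
      intro K hK
      have h3 := @(hU K (hsU₀ hK)).2
      rw [he K hK] at h3
      exact h3
    choose! γ hγ hγI using hgen
    have key : ∀ K ∈ S₀, ∀ J ∈ S₀, ∀ z, γ K = γ J * z ^ 3 → K = J := by
      intro K hK J hJ z hz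
      refine hsep K (hsU₀ hK) J (hsU₀ hJ) (by rw [he K hK, he J hJ]) z (by rw [he K hK]; exact z.2) ?_
      rw [he K hK, he J hJ, ← hγ K hK, ← hγ J hJ, hz]; simp
    have hinj : Set.InjOn γ S₀ := fun K hK J hJ h => key K hK J hJ 1 (by rw [h]; simp)
    rw [← Finset.card_image_of_injOn hinj]
    refine hbot _ hE _ ?_ ?_
    · intro a ha
      obtain ⟨K, hK, rfl⟩ := Finset.mem_image.1 ha
      refine ⟨fun h => hne K (hsU₀ hK) ?_, hγI K hK⟩
      rw [he K hK, ← hγ K hK, h]; simp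
    · intro a ha b hb z hz
      obtain ⟨K, hK, rfl⟩ := Finset.mem_image.1 ha
      obtain ⟨J, hJ, rfl⟩ := Finset.mem_image.1 hb
      rw [key K hK J hJ z hz]
  have hUr : (U.card : ℝ) ≤ S₁.card + (S₀.card + S₂.card) := by exact_mod_cast hUc
  have hTr : (T.card : ℝ) ≤ 9 ^ f.card * U.card := by exact_mod_cast hcard
  have hQ : (1 : ℝ) ≤ 4 ^ P.card := one_le_pow₀ (by norm_num)
  have hYg : 0 ≤ Y / g := by positivity
  have hY3 : 0 ≤ Y ^ ((3 : ℝ) / 4) := by positivity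
  generalize Y ^ ((3 : ℝ) / 4) = Z at *
  generalize (4 : ℝ) ^ P.card = Q at *
  rw [mul_div_assoc] at h2
  generalize Y / g = W at *
  have hC0 : 0 ≤ C₁ := by linarith
  have hD0 : 0 ≤ D := by linarith
  have h5 : (U.card : ℝ) ≤ (A + B + D * C₁) * (Q * (W + Z + 1)) := by
    have e1 : A * Q * (W + Z) ≤ A * (Q * (W + Z + 1)) := by
      rw [mul_assoc]
      exact mul_le_mul_of_nonneg_left
        (mul_le_mul_of_nonneg_left (by linarith) (by linarith)) (by linarith)
    have e3 : 1 ≤ Q * (W + Z + 1) := by nlinarith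
    have e2 : D * (C₁ * W + 1) ≤ D * C₁ * (Q * (W + Z + 1)) := by
      rw [mul_assoc]
      gcongr
      have : W + 1 ≤ Q * (W + Z + 1) := by nlinarith
      nlinarith
    nlinarith
  refine hTr.trans ?_
  calc (9 : ℝ) ^ f.card * U.card ≤ 9 ^ f.card * ((A + B + D * C₁) * (Q * (W + Z + 1))) := by gcongr
    _ = _ := by ring

end CubicCount

section SquarefreeIdeal
open IsDedekindDomain
variable {k : Type*} [Field k] [NumberField k]

theorem exists_finset_prod_eq_of_squarefree {I : Ideal (𝓞 k)} (hI : Squarefree I) :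
    ∃ S : Finset (HeightOneSpectrum (𝓞 k)), (∀ v, v ∈ S ↔ I ≤ v.asIdeal) ∧
      I = ∏ v ∈ S, v.asIdeal := by
  have hI0 : I ≠ 0 := hI.ne_zero
  obtain ⟨S, hS⟩ : ∃ S, S = (Ideal.finite_factors hI0).toFinset := ⟨_, rfl⟩
  have hmem : ∀ v, v ∈ S ↔ I ≤ v.asIdeal := by
    intro v
    rw [hS, Set.Finite.mem_toFinset, Set.mem_ofPred_eq, Ideal.dvd_iff_le]
  refine ⟨S, hmem, ?_⟩
  have hdvd : ∏ v ∈ S, v.asIdeal ∣ I := by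
    have hinj : Set.InjOn HeightOneSpectrum.asIdeal (S : Set (HeightOneSpectrum (𝓞 k))) :=
      fun v _ w _ h => HeightOneSpectrum.ext h
    rw [show ∏ v ∈ S, v.asIdeal = ∏ p ∈ S.image HeightOneSpectrum.asIdeal, p from
      (Finset.prod_image (f := fun p : Ideal (𝓞 k) => p) hinj).symm]
    refine Finset.prod_primes_dvd _ ?_ ?_
    all_goals
      intro p hp
      obtain ⟨v, hv, rfl⟩ := Finset.mem_image.1 hp
    · exact v.prime
    · exact Ideal.dvd_iff_le.2 ((hmem v).1 hv)
  obtain ⟨J, hJ⟩ := hdvd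
  have hJ0 : J ≠ ⊥ := by
    rintro rfl
    exact hI0 (by rw [hJ, Ideal.mul_bot]; rfl)
  have hJ1 : J = ⊤ := by
    by_contra hJ1
    obtain ⟨P, hP, hJP⟩ := Ideal.exists_le_maximal J hJ1
    obtain ⟨v, hv⟩ : ∃ v : HeightOneSpectrum (𝓞 k), v.asIdeal = P :=
      ⟨⟨P, hP.isPrime, fun h => hJ0 (le_bot_iff.1 (h ▸ hJP))⟩, rfl⟩
    have hvJ : v.asIdeal ∣ J := Ideal.dvd_iff_le.2 (hv ▸ hJP)
    have hvS : v ∈ S := (hmem v).2 (Ideal.dvd_iff_le.1 (hvJ.trans ⟨_, by rw [mul_comm]; exact hJ⟩))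
    have hvv : v.asIdeal * v.asIdeal ∣ I := by
      rw [hJ]
      exact mul_dvd_mul (Finset.dvd_prod_of_mem (fun v : HeightOneSpectrum (𝓞 k) => v.asIdeal) hvS) hvJ
    exact v.prime.not_isUnit (hI _ hvv)
  rw [hJ1, Ideal.mul_top] at hJ
  exact hJ

theorem not_two_dvd_vord_of_squarefree {e : 𝓞 k} (he : e ≠ 0) {s c : Ideal (𝓞 k)}
    (hs : Squarefree s) (h : Ideal.span {e} = s * c ^ 2) (v : HeightOneSpectrum (𝓞 k))
    (hv : s ≤ v.asIdeal) : ¬ (2 : ℤ) ∣ vord v (e : k) := by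
  have hI : Irreducible (Associates.mk v.asIdeal) := v.associates_irreducible
  have hs0 : s ≠ 0 := hs.ne_zero
  have hc0 : c ≠ 0 := by
    rintro rfl
    refine he (Ideal.span_singleton_eq_bot.1 ?_)
    rw [h]; simp
  have h1 : (Associates.mk v.asIdeal).count (Associates.mk s).factors = 1 := by
    refine le_antisymm ?_ ?_
    · by_contra h2
      have h3 := (Associates.prime_pow_dvd_iff_le (Associates.mk_ne_zero.2 hs0) hI).2
        (show 2 ≤ _ from Nat.lt_of_not_le h2)
      rw [← Associates.mk_pow, Associates.mk_le_mk_iff_dvd, sq] at h3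
      exact v.prime.not_isUnit (hs _ h3)
    · refine (Associates.prime_pow_dvd_iff_le (Associates.mk_ne_zero.2 hs0) hI).1 ?_
      rw [pow_one, Associates.mk_le_mk_iff_dvd]
      exact Ideal.dvd_iff_le.2 hv
  rw [vord_int_eq_count v he, h, ← Associates.mk_mul_mk, Associates.mk_pow,
    Associates.count_mul (Associates.mk_ne_zero.2 hs0)
      (pow_ne_zero 2 (Associates.mk_ne_zero.2 hc0)) hI, h1,
    Associates.count_pow (Associates.mk_ne_zero.2 hc0) hI]
  push_cast
  omega

theorem le_of_mem_of_span_eq {e : 𝓞 k} {s c : Ideal (𝓞 k)} {M : ℕ}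
    (h : Ideal.span {e} = s * c ^ 2) (hc : Ideal.absNorm c ∣ M) {p : Ideal (𝓞 k)}
    (hp : p.IsPrime) (hM : (M : 𝓞 k) ∉ p) (he : e ∈ p) : s ≤ p := by
  have h1 : s * c ^ 2 ≤ p := by rwa [← h, Ideal.span_singleton_le_iff_mem]
  rcases hp.mul_le.1 h1 with h2 | h2
  · exact h2
  · have h3 : c ≤ p := hp.le_of_pow_le h2
    obtain ⟨m, rfl⟩ := hc
    refine absurd ?_ hM
    rw [Nat.cast_mul]
    exact Ideal.mul_mem_right _ _ (h3 (Ideal.absNorm_mem c))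

theorem one_le_absNorm_asIdeal (v : HeightOneSpectrum (𝓞 k)) : 1 ≤ Ideal.absNorm v.asIdeal :=
  Nat.one_le_iff_ne_zero.2 (Ideal.absNorm_eq_zero_iff.not.2 v.ne_bot)

end SquarefreeIdeal

section RamifiedCount
open IsDedekindDomain IntermediateField

universe u v

theorem IsCubicDatum.absNorm_mul_prod_sq_le {k : Type u} {Ω : Type v} [Field k] [NumberField k]
    [Field Ω] [Algebra k Ω] {K : IntermediateField k Ω} [NumberField K] {e : 𝓞 k} {r : Ω} {s t : k}
    {w u : Ω} (h : IsCubicDatum K (e : k) r s t w u) {sf c : Ideal (𝓞 k)} (hsf : Squarefree sf)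
    (hspan : Ideal.span {e} = sf * c ^ 2) (f B : Finset (HeightOneSpectrum (𝓞 k)))
    (hB : ∀ p ∉ B, (2 : 𝓞 k) ∉ p.asIdeal ∧ (3 : 𝓞 k) ∉ p.asIdeal)
    (hf : ∀ p ∈ f, ∃ P : HeightOneSpectrum (𝓞 K), P.asIdeal.LiesOver p.asIdeal ∧ ramIdx p P = 3) :
    Ideal.absNorm sf * (∏ p ∈ f, Ideal.absNorm p.asIdeal) ^ 2 ≤
      (∏ p ∈ B, Ideal.absNorm p.asIdeal) * (NumberField.discr K).natAbs := by
  obtain ⟨S, hS, hprod⟩ := exists_finset_prod_eq_of_squarefree hsf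
  have he : e ≠ 0 := by rintro rfl; exact h.d_ne (by simp)
  have hA : ∀ p ∈ S \ B, ∃ P : HeightOneSpectrum (𝓞 K), P.asIdeal.LiesOver p.asIdeal ∧
      2 ∣ ramIdx p P := by
    intro p hp
    rw [Finset.mem_sdiff] at hp
    exact h.exists_two_dvd_ramIdx p (hB p hp.2).1 (hB p hp.2).2
      (not_two_dvd_vord_of_squarefree he hsf hspan p ((hS p).1 hp.1))
  have hdisj : Disjoint (S \ B) f := by
    rw [Finset.disjoint_left]
    intro p hp hpf
    obtain ⟨P, hP, h2⟩ := hA p hp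
    obtain ⟨Q, hQ, h3⟩ := hf p hpf
    have h4 := ramIdx_eq_three_of_map_eq Q.isPrime
      (map_eq_pow_three_of_ramIdx_eq h.finrank p Q h3) P
    omega
  have hdisc := prod_absNorm_pow_le_discr (K := K) ((S \ B) ∪ f) (fun p => if p ∈ f then 2 else 1) (by
    intro p hp
    by_cases hpf : p ∈ f
    · obtain ⟨Q, hQ, h3⟩ := hf p hpf
      exact ⟨Q, hQ, by simp [hpf, h3]⟩
    · obtain ⟨P, hP, h2⟩ := hA p ((Finset.mem_union.1 hp).resolve_right hpf)
      have := ramIdx_pos p P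
      refine ⟨P, hP, ?_⟩
      simp only [hpf, if_false]
      omega)
  rw [Finset.prod_union hdisj] at hdisc
  have e1 : ∏ p ∈ S \ B, Ideal.absNorm p.asIdeal ^ (if p ∈ f then 2 else 1) =
      ∏ p ∈ S \ B, Ideal.absNorm p.asIdeal :=
    Finset.prod_congr rfl fun p hp => by
      rw [if_neg (Finset.disjoint_left.1 hdisj hp), pow_one]
  have e2 : ∏ p ∈ f, Ideal.absNorm p.asIdeal ^ (if p ∈ f then 2 else 1) =
      (∏ p ∈ f, Ideal.absNorm p.asIdeal) ^ 2 := by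
    rw [← Finset.prod_pow]
    exact Finset.prod_congr rfl fun p hp => by rw [if_pos hp]
  rw [e1, e2] at hdisc
  have e3 : Ideal.absNorm sf ≤
      (∏ p ∈ B, Ideal.absNorm p.asIdeal) * ∏ p ∈ S \ B, Ideal.absNorm p.asIdeal := by
    rw [hprod, map_prod, ← Finset.prod_union Finset.disjoint_sdiff, Finset.union_sdiff_self_eq_union]
    exact Finset.prod_le_prod_of_subset_of_one_le' Finset.subset_union_right
      fun p _ _ => one_le_absNorm_asIdeal p
  calc _ ≤ ((∏ p ∈ B, Ideal.absNorm p.asIdeal) * ∏ p ∈ S \ B, Ideal.absNorm p.asIdeal) *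
        (∏ p ∈ f, Ideal.absNorm p.asIdeal) ^ 2 := Nat.mul_le_mul_right _ e3
    _ ≤ _ := by rw [mul_assoc]; exact Nat.mul_le_mul_left _ hdisc

theorem rpow_bound_of_le {g Y : ℝ} (hg : 1 ≤ g) (hgY : g ≤ Y) :
    Y / g + Y ^ ((3 : ℝ) / 4) + 1 ≤ 3 * (Y * g ^ (-(1 / 4) : ℝ)) := by
  have hg0 : 0 < g := by linarith
  have hY0 : 0 < Y := by linarith
  have h1 : Y / g ≤ Y * g ^ (-(1 / 4) : ℝ) := by
    rw [div_eq_mul_inv, ← Real.rpow_neg_one]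
    exact mul_le_mul_of_nonneg_left (Real.rpow_le_rpow_of_exponent_le hg (by norm_num)) hY0.le
  have h2 : Y ^ ((3 : ℝ) / 4) ≤ Y * g ^ (-(1 / 4) : ℝ) := by
    have : Y ^ ((3 : ℝ) / 4) = Y * Y ^ (-(1 / 4) : ℝ) := by
      nth_rewrite 2 [← Real.rpow_one Y]
      rw [← Real.rpow_add hY0]; norm_num
    rw [this]
    exact mul_le_mul_of_nonneg_left (Real.rpow_le_rpow_of_nonpos hg0 hgY (by norm_num)) hY0.le
  have h3 : 1 ≤ Y ^ ((3 : ℝ) / 4) := Real.one_le_rpow (by linarith) (by norm_num)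
  linarith

set_option maxHeartbeats 1000000 in
theorem card_le_of_ramified (k : Type u) (Ω : Type v) [Field k] [NumberField k] [Field Ω]
    [Algebra k Ω] [IsAlgClosed Ω] : ∃ C : ℝ, 1 ≤ C ∧ ∃ B : Finset (HeightOneSpectrum (𝓞 k)),
    ∀ (T : Finset (IntermediateField k Ω)) (f P : Finset (HeightOneSpectrum (𝓞 k))) (X : ℝ),
    (∀ K ∈ T, Module.finrank k K = 3) →
    (∀ K ∈ T, ∀ J ∈ T, Nonempty (K ≃ₐ[k] J) → K = J) →
    (∀ K ∈ T, ∀ [NumberField K], ((NumberField.discr K).natAbs : ℝ) ≤ X) →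
    (∀ K ∈ T, ∀ [NumberField K], ∀ p, p ∈ f ↔
      ∃ w : HeightOneSpectrum (𝓞 K), w.asIdeal.LiesOver p.asIdeal ∧ ramIdx p w = 3) →
    (∀ K ∈ T, ∀ [NumberField K], ∀ p ∈ P,
      ∃ w : HeightOneSpectrum (𝓞 K), w.asIdeal.LiesOver p.asIdeal ∧ ramIdx p w = 2) →
    (∀ p ∈ P, p ∉ B) → 0 ≤ X →
    (T.card : ℝ) ≤ C * (9 ^ f.card * 4 ^ P.card *
      (X / (∏ p ∈ f, (Ideal.absNorm p.asIdeal : ℝ)) ^ 2 *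
        (∏ p ∈ P, (Ideal.absNorm p.asIdeal : ℝ)) ^ (-(1 / 4) : ℝ))) := by
  obtain ⟨C₁, hC₁, G, r, sf, c, hG, huniq, hex⟩ := exists_resolvent_system k Ω
  obtain ⟨M, hM⟩ : ∃ M, M = 6 * (⌊C₁⌋₊).factorial := ⟨_, rfl⟩
  have hM0 : M ≠ 0 := by rw [hM]; positivity
  obtain ⟨A, hA, hcount⟩ := card_le_of_isCubicDatum k Ω C₁ hC₁ M hM0
  have hMk : (M : 𝓞 k) ≠ 0 := Nat.cast_ne_zero.2 hM0
  have hspan : Ideal.span {(M : 𝓞 k)} ≠ 0 := by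
    rw [Ne, Ideal.zero_eq_bot, Ideal.span_singleton_eq_bot]; exact hMk
  obtain ⟨B, hB⟩ : ∃ B, B = (Ideal.finite_factors hspan).toFinset := ⟨_, rfl⟩
  have hBmem : ∀ p, p ∈ B ↔ (M : 𝓞 k) ∈ p.asIdeal := by
    intro p
    rw [hB, Set.Finite.mem_toFinset, Set.mem_ofPred_eq, Ideal.dvd_iff_le,
      Ideal.span_singleton_le_iff_mem]
  have hB23 : ∀ p ∉ B, (2 : 𝓞 k) ∉ p.asIdeal ∧ (3 : 𝓞 k) ∉ p.asIdeal := by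
    intro p hp
    rw [hBmem, hM] at hp
    constructor
    · intro h2
      refine hp ?_
      rw [show 6 * (⌊C₁⌋₊).factorial = 2 * (3 * (⌊C₁⌋₊).factorial) by ring, Nat.cast_mul]
      exact Ideal.mul_mem_right _ _ (by exact_mod_cast h2)
    · intro h2
      refine hp ?_
      rw [show 6 * (⌊C₁⌋₊).factorial = 3 * (2 * (⌊C₁⌋₊).factorial) by ring, Nat.cast_mul]
      exact Ideal.mul_mem_right _ _ (by exact_mod_cast h2)
  have hGM : ∀ e ∈ G, Ideal.absNorm (c e) ∣ M := by
    intro e he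
    obtain ⟨he0, -, hb⟩ := hG e he
    have hc0 : 0 < Ideal.absNorm (c e) := by
      refine Nat.pos_of_ne_zero fun h => he0 ?_
      rw [Ideal.absNorm_eq_zero_iff] at h
      rw [← Ideal.span_singleton_eq_bot, hb.span_eq, h]
      simp
    rw [hM]
    exact Dvd.dvd.mul_left (Nat.dvd_factorial hc0 (Nat.le_floor hb.norm_le)) _
  obtain ⟨N, hN⟩ : ∃ N : ℝ, N = ∏ p ∈ B, (Ideal.absNorm p.asIdeal : ℝ) := ⟨_, rfl⟩
  have hone : ∀ S : Finset (HeightOneSpectrum (𝓞 k)),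
      (1 : ℝ) ≤ ∏ p ∈ S, (Ideal.absNorm p.asIdeal : ℝ) := fun S => by
    exact_mod_cast Finset.one_le_prod' fun p (_ : p ∈ S) => one_le_absNorm_asIdeal p
  have hN1 : 1 ≤ N := hN ▸ hone B
  refine ⟨3 * A * N, by nlinarith, B, ?_⟩
  intro T f P X hfin hiso hdisc hf hP hPB hX
  have hnf : ∀ K ∈ T, NumberField K := by
    intro K hK
    have : FiniteDimensional k K := Module.finite_of_finrank_pos (by rw [hfin K hK]; norm_num)
    exact numberField_of_finiteDimensional k K
  have hdat : ∀ K ∈ T, ∃ (e : 𝓞 k) (s t : k) (w u : Ω), e ∈ G ∧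
      IsCubicDatum K (e : k) (r e) s t w u := by
    intro K hK
    obtain ⟨e, he, s, t, w, u, h⟩ := exists_isCubicDatum (fun e he => (hG e he).2.1) hex K (hfin K hK)
    exact ⟨e, s, t, w, u, he, h⟩
  choose! e s t w u hT using hdat
  obtain ⟨F, hF⟩ : ∃ F : ℝ, F = ∏ p ∈ f, (Ideal.absNorm p.asIdeal : ℝ) := ⟨_, rfl⟩
  have hF1 : 1 ≤ F := hF ▸ hone f
  obtain ⟨g, hg⟩ : ∃ g : ℝ, g = ∏ p ∈ P, (Ideal.absNorm p.asIdeal : ℝ) := ⟨_, rfl⟩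
  have hg1 : 1 ≤ g := hg ▸ hone P
  rw [← hF, ← hg]
  have hY0 : 0 ≤ N * X / F ^ 2 := by positivity
  have hTY : ∀ K ∈ T, (Ideal.absNorm (sf (e K)) : ℝ) ≤ N * X / F ^ 2 := by
    intro K hK
    have := hnf K hK
    obtain ⟨-, -, hb⟩ := hG _ (hT K hK).1
    have h1 := (hT K hK).2.absNorm_mul_prod_sq_le hb.squarefree hb.span_eq f B hB23
      fun p hp => (hf K hK p).1 hp
    have h2 : (Ideal.absNorm (sf (e K)) : ℝ) * F ^ 2 ≤ N * ((NumberField.discr K).natAbs : ℝ) := by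
      rw [hF, hN]; exact_mod_cast h1
    rw [le_div_iff₀ (by positivity)]
    exact h2.trans (mul_le_mul_of_nonneg_left (hdisc K hK) (by linarith))
  have hinj : Set.InjOn HeightOneSpectrum.asIdeal (P : Set (HeightOneSpectrum (𝓞 k))) :=
    fun v _ w _ h => HeightOneSpectrum.ext h
  have hPp : ∀ p ∈ P.image HeightOneSpectrum.asIdeal, p.IsPrime ∧ p ≠ ⊥ ∧ (M : 𝓞 k) ∉ p := by
    intro p hp
    obtain ⟨v, hv, rfl⟩ := Finset.mem_image.1 hp
    exact ⟨v.isPrime, v.ne_bot, fun h => hPB v hv ((hBmem v).2 h)⟩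
  have hTP : ∀ K ∈ T, ∀ p ∈ P.image HeightOneSpectrum.asIdeal, sf (e K) ≤ p := by
    intro K hK p hp
    obtain ⟨v, hv, rfl⟩ := Finset.mem_image.1 hp
    have := hnf K hK
    obtain ⟨he0, -, hb⟩ := hG _ (hT K hK).1
    refine le_of_mem_of_span_eq hb.span_eq (hGM _ (hT K hK).1) v.isPrime
      (fun h => hPB v hv ((hBmem v).2 h)) ?_
    have : FiniteDimensional k k⟮r (e K)⟯ :=
      IntermediateField.adjoin.finiteDimensional (hT K hK).2.isIntegral_r
    have : NumberField k⟮r (e K)⟯ := numberField_of_finiteDimensional k _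
    obtain ⟨Q, hQ, hram⟩ := hP K hK v hv
    have hodd := (hT K hK).2.not_two_dvd_vord v (hB23 v (hPB v hv)).1 (hB23 v (hPB v hv)).2 Q hram
    refine (vord_int_pos_iff v he0).1 (lt_of_le_of_ne (vord_int_nonneg v _) fun h => hodd ?_)
    exact h ▸ dvd_zero _
  have hnorm : (Ideal.absNorm (∏ p ∈ P.image HeightOneSpectrum.asIdeal, p) : ℝ) = g := by
    rw [Finset.prod_image (f := fun p : Ideal (𝓞 k) => p) hinj, map_prod, hg]
    push_cast; rfl
  have hmain := hcount G r sf c hG hGM huniq T e s t w u f (P.image HeightOneSpectrum.asIdeal)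
    (N * X / F ^ 2) hY0 hT hiso (fun K hK _ p hp => (hf K hK p).2 hp) hTY hPp hTP
  rw [hnorm, Finset.card_image_of_injOn hinj] at hmain
  rcases T.eq_empty_or_nonempty with h0 | ⟨K, hK⟩
  · rw [h0]; simp only [Finset.card_empty, Nat.cast_zero]; positivity
  have hgY : g ≤ N * X / F ^ 2 := by
    refine le_trans ?_ (hTY K hK)
    rw [← hnorm]
    have hdvd : ∏ p ∈ P.image HeightOneSpectrum.asIdeal, p ∣ sf (e K) :=
      Finset.prod_primes_dvd _ (fun p hp => Ideal.prime_of_isPrime (hPp p hp).2.1 (hPp p hp).1)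
        fun p hp => Ideal.dvd_iff_le.2 (hTP K hK p hp)
    have hs0 : Ideal.absNorm (sf (e K)) ≠ 0 :=
      Ideal.absNorm_eq_zero_iff.not.2 (hG _ (hT K hK).1).2.2.squarefree.ne_zero
    exact_mod_cast Nat.le_of_dvd (Nat.pos_of_ne_zero hs0) (map_dvd Ideal.absNorm hdvd)
  have h5 := rpow_bound_of_le hg1 hgY
  calc (T.card : ℝ) ≤ _ := hmain
    _ ≤ A * 9 ^ f.card * (4 ^ P.card * (3 * (N * X / F ^ 2 * g ^ (-(1 / 4) : ℝ)))) := by gcongr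
    _ = _ := by ring

end RamifiedCount

section PrimeSums
open IsDedekindDomain
variable (k : Type*) [Field k] [NumberField k]

theorem finite_setOf_absNorm_asIdeal_le (m : ℕ) :
    {v : HeightOneSpectrum (𝓞 k) | Ideal.absNorm v.asIdeal ≤ m}.Finite := by
  refine Set.Finite.of_finite_image ((Ideal.finite_setOfPred_absNorm_le (S := 𝓞 k) m).subset ?_)
    (f := HeightOneSpectrum.asIdeal) fun v _ w _ h => HeightOneSpectrum.ext h
  rintro _ ⟨v, hv, rfl⟩
  exact hv

theorem two_le_absNorm_asIdeal {k : Type*} [Field k] [NumberField k]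
    (v : HeightOneSpectrum (𝓞 k)) : 2 ≤ Ideal.absNorm v.asIdeal := by
  have h1 := one_le_absNorm_asIdeal v
  have h2 : Ideal.absNorm v.asIdeal ≠ 1 := fun h =>
    v.isPrime.ne_top (Ideal.absNorm_eq_one_iff.1 h)
  omega

theorem one_le_prod_absNorm {k : Type*} [Field k] [NumberField k]
    (S : Finset (HeightOneSpectrum (𝓞 k))) :
    (1 : ℝ) ≤ ∏ v ∈ S, (Ideal.absNorm v.asIdeal : ℝ) := by
  exact_mod_cast Finset.one_le_prod' fun p (_ : p ∈ S) => one_le_absNorm_asIdeal p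

theorem exists_pow_card_le {a η : ℝ} (ha : 1 ≤ a) (hη : 0 < η) : ∃ C : ℝ, 1 ≤ C ∧
    ∀ S : Finset (HeightOneSpectrum (𝓞 k)),
      a ^ S.card ≤ C * (∏ v ∈ S, (Ideal.absNorm v.asIdeal : ℝ)) ^ η := by
  obtain ⟨D, hD⟩ : ∃ D, D = (finite_setOf_absNorm_asIdeal_le k ⌊a ^ η⁻¹⌋₊).toFinset := ⟨_, rfl⟩
  have hlarge : ∀ v ∉ D, a ≤ (Ideal.absNorm v.asIdeal : ℝ) ^ η := by
    intro v hv
    rw [hD, Set.Finite.mem_toFinset, Set.mem_ofPred_eq, not_le] at hv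
    have h1 : a ^ η⁻¹ < Ideal.absNorm v.asIdeal := (Nat.floor_lt (by positivity)).1 hv
    have h2 := Real.rpow_le_rpow (by positivity) h1.le hη.le
    rwa [← Real.rpow_mul (by linarith), inv_mul_cancel₀ hη.ne', Real.rpow_one] at h2
  refine ⟨a ^ D.card, one_le_pow₀ ha, fun S => ?_⟩
  have h1 : ∀ v ∈ S, a ≤ (if v ∈ D then a else 1) * (Ideal.absNorm v.asIdeal : ℝ) ^ η := by
    intro v _
    split_ifs with hv
    · have : (1 : ℝ) ≤ (Ideal.absNorm v.asIdeal : ℝ) ^ η :=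
        Real.one_le_rpow (by exact_mod_cast one_le_absNorm_asIdeal v) hη.le
      nlinarith
    · rw [one_mul]; exact hlarge v hv
  calc a ^ S.card = ∏ _v ∈ S, a := by rw [Finset.prod_const]
    _ ≤ ∏ v ∈ S, ((if v ∈ D then a else 1) * (Ideal.absNorm v.asIdeal : ℝ) ^ η) :=
        Finset.prod_le_prod (fun _ _ => by linarith) h1
    _ = (∏ v ∈ S, if v ∈ D then a else 1) * (∏ v ∈ S, (Ideal.absNorm v.asIdeal : ℝ)) ^ η := by
        rw [Finset.prod_mul_distrib, Real.finsetProd_rpow _ _ fun v _ => by positivity]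
    _ ≤ _ := by
        refine mul_le_mul_of_nonneg_right ?_
          (Real.rpow_nonneg (by linarith [one_le_prod_absNorm S]) _)
        rw [← Finset.prod_filter, Finset.prod_const]
        exact pow_le_pow_right₀ ha
          (Finset.card_le_card fun v hv => (Finset.mem_filter.1 hv).2)

theorem card_le_finrank_of_absNorm_eq {k : Type*} [Field k] [NumberField k] {m : ℕ}
    (S : Finset (HeightOneSpectrum (𝓞 k))) (hS : ∀ v ∈ S, Ideal.absNorm v.asIdeal = m) :
    S.card ≤ Module.finrank ℚ k := by
  rcases S.eq_empty_or_nonempty with rfl | ⟨w, hw⟩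
  · simp
  have hm : 2 ≤ m := hS w hw ▸ two_le_absNorm_asIdeal w
  have hinj : Set.InjOn HeightOneSpectrum.asIdeal (S : Set (HeightOneSpectrum (𝓞 k))) :=
    fun v _ w _ h => HeightOneSpectrum.ext h
  have hdvd : ∏ p ∈ S.image HeightOneSpectrum.asIdeal, p ∣ Ideal.span {(m : 𝓞 k)} := by
    refine Finset.prod_primes_dvd _ ?_ ?_
    all_goals
      intro p hp
      obtain ⟨v, hv, rfl⟩ := Finset.mem_image.1 hp
    · exact v.prime
    · rw [Ideal.dvd_iff_le, Ideal.span_singleton_le_iff_mem, ← hS v hv]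
      exact Ideal.absNorm_mem _
  have h1 := map_dvd Ideal.absNorm hdvd
  rw [Finset.prod_image (f := fun p : Ideal (𝓞 k) => p) hinj, map_prod, Finset.prod_congr rfl hS,
    Finset.prod_const, Ideal.absNorm_span_natCast, NumberField.RingOfIntegers.rank] at h1
  exact (Nat.pow_dvd_pow_iff_le_right (by omega)).1 h1

theorem sum_comp_le_mul_tsum {ι : Type*} {g : ℕ → ℝ} (hg : ∀ m, 0 ≤ g m) (hsum : Summable g)
    (N : ι → ℕ) (n : ℕ) (S : Finset ι) (h : ∀ m, (S.filter fun v => N v = m).card ≤ n) :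
    ∑ v ∈ S, g (N v) ≤ n * ∑' m, g m := by
  calc ∑ v ∈ S, g (N v) = ∑ m ∈ S.image N, ∑ v ∈ S with N v = m, g (N v) :=
        (Finset.sum_fiberwise_of_maps_to (fun v hv => Finset.mem_image_of_mem _ hv) _).symm
    _ ≤ ∑ m ∈ S.image N, (n : ℝ) * g m := by
        refine Finset.sum_le_sum fun m _ => ?_
        have h1 : ∑ v ∈ S with N v = m, g (N v) = ∑ _v ∈ S with N _v = m, g m :=
          Finset.sum_congr rfl fun v hv => by rw [(Finset.mem_filter.1 hv).2]
        rw [h1, Finset.sum_const, nsmul_eq_mul]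
        exact mul_le_mul_of_nonneg_right (by exact_mod_cast h m) (hg m)
    _ ≤ _ := by
        rw [← Finset.mul_sum]
        exact mul_le_mul_of_nonneg_left (hsum.sum_le_tsum _ fun _ _ => hg _) (by positivity)

theorem exists_sum_absNorm_rpow_le : ∃ C : ℝ, ∀ S : Finset (HeightOneSpectrum (𝓞 k)),
    ∑ v ∈ S, (Ideal.absNorm v.asIdeal : ℝ) ^ (-(3 / 2) : ℝ) ≤ C :=
  ⟨_, fun S => sum_comp_le_mul_tsum (g := fun m : ℕ => (m : ℝ) ^ (-(3 / 2) : ℝ))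
    (fun m => by positivity) (Real.summable_nat_rpow.2 (by norm_num))
    (fun v : HeightOneSpectrum (𝓞 k) => Ideal.absNorm v.asIdeal) (Module.finrank ℚ k) S
    fun m => card_le_finrank_of_absNorm_eq _ fun v hv => (Finset.mem_filter.1 hv).2⟩

theorem exists_sum_prod_absNorm_rpow_le : ∃ C : ℝ, 1 ≤ C ∧
    ∀ F : Finset (Finset (HeightOneSpectrum (𝓞 k))),
      ∑ f ∈ F, (∏ v ∈ f, (Ideal.absNorm v.asIdeal : ℝ)) ^ (-(3 / 2) : ℝ) ≤ C := by
  obtain ⟨A, hA⟩ := exists_sum_absNorm_rpow_le k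
  have hA0 : 0 ≤ A := by simpa using hA ∅
  refine ⟨Real.exp A, Real.one_le_exp hA0, fun F => ?_⟩
  have hsub : F ⊆ (F.biUnion id).powerset := fun f hf =>
    Finset.mem_powerset.2 (Finset.subset_biUnion_of_mem id hf)
  have h0 : ∀ f : Finset (HeightOneSpectrum (𝓞 k)),
      (∏ v ∈ f, (Ideal.absNorm v.asIdeal : ℝ)) ^ (-(3 / 2) : ℝ) =
      ∏ v ∈ f, (Ideal.absNorm v.asIdeal : ℝ) ^ (-(3 / 2) : ℝ) := fun f =>
    (Real.finsetProd_rpow _ _ (fun v _ => by positivity) _).symm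
  simp only [h0]
  calc _ ≤ ∑ f ∈ (F.biUnion id).powerset,
        ∏ v ∈ f, (Ideal.absNorm v.asIdeal : ℝ) ^ (-(3 / 2) : ℝ) :=
        Finset.sum_le_sum_of_subset_of_nonneg hsub fun _ _ _ =>
          Finset.prod_nonneg fun _ _ => by positivity
    _ = ∏ v ∈ F.biUnion id, (1 + (Ideal.absNorm v.asIdeal : ℝ) ^ (-(3 / 2) : ℝ)) :=
        (Finset.prod_one_add _).symm
    _ ≤ ∏ v ∈ F.biUnion id, Real.exp ((Ideal.absNorm v.asIdeal : ℝ) ^ (-(3 / 2) : ℝ)) :=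
        Finset.prod_le_prod (fun _ _ => by positivity) fun v _ => by
          rw [add_comm]; exact Real.add_one_le_exp _
    _ = Real.exp (∑ v ∈ F.biUnion id, (Ideal.absNorm v.asIdeal : ℝ) ^ (-(3 / 2) : ℝ)) :=
        (Real.exp_sum _ _).symm
    _ ≤ _ := Real.exp_le_exp.2 (hA _)

end PrimeSums

section Uniformity
open IsDedekindDomain

universe u v

theorem exists_finset_totallyRamified {k : Type u} {Ω : Type v} [Field k] [NumberField k] [Field Ω]
    [Algebra k Ω] (K : IntermediateField k Ω) : ∃ f : Finset (HeightOneSpectrum (𝓞 k)),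
    ∀ [NumberField K], ∀ p, p ∈ f ↔
      ∃ w : HeightOneSpectrum (𝓞 K), w.asIdeal.LiesOver p.asIdeal ∧ ramIdx p w = 3 := by
  by_cases hK : NumberField K
  · have hfin : {p : HeightOneSpectrum (𝓞 k) | ∃ w : HeightOneSpectrum (𝓞 K),
        w.asIdeal.LiesOver p.asIdeal ∧ ramIdx p w = 3}.Finite := by
      refine (finite_setOf_absNorm_asIdeal_le k (NumberField.discr K).natAbs).subset ?_
      rintro p ⟨w, hw, h⟩
      have := prod_absNorm_pow_le_discr (K := K) {p} (fun _ => 1) (by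
        intro v hv
        rw [Finset.mem_singleton] at hv
        subst hv
        exact ⟨w, hw, by omega⟩)
      simpa using this
    refine ⟨hfin.toFinset, fun p => ?_⟩
    rw [Set.Finite.mem_toFinset, Set.mem_ofPred_eq]
  · exact ⟨∅, fun p => absurd ‹_› hK⟩

theorem exists_sum_superset_le (k : Type*) [Field k] [NumberField k] : ∃ C : ℝ, 1 ≤ C ∧
    ∀ (η : ℝ) (R : Finset (HeightOneSpectrum (𝓞 k)))
      (F : Finset (Finset (HeightOneSpectrum (𝓞 k)))), η ≤ 1 / 2 → (∀ f ∈ F, R ⊆ f) →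
      ∑ f ∈ F, (∏ v ∈ f, (Ideal.absNorm v.asIdeal : ℝ)) ^ (η - 2) ≤
        C * (∏ v ∈ R, (Ideal.absNorm v.asIdeal : ℝ)) ^ (η - 2) := by
  obtain ⟨C, hC, h⟩ := exists_sum_prod_absNorm_rpow_le k
  refine ⟨C, hC, fun η R F hη hF => ?_⟩
  have hinj : Set.InjOn (fun f => f \ R) (F : Set (Finset (HeightOneSpectrum (𝓞 k)))) := by
    intro f hf g hg hfg
    rw [← Finset.sdiff_union_of_subset (hF f hf), ← Finset.sdiff_union_of_subset (hF g hg)]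
    exact congrArg (· ∪ R) hfg
  have hR := one_le_prod_absNorm R
  calc _ ≤ ∑ f ∈ F, (∏ v ∈ f \ R, (Ideal.absNorm v.asIdeal : ℝ)) ^ (-(3 / 2) : ℝ) *
        (∏ v ∈ R, (Ideal.absNorm v.asIdeal : ℝ)) ^ (η - 2) := by
        refine Finset.sum_le_sum fun f hf => ?_
        have h1 := one_le_prod_absNorm (f \ R)
        rw [← Finset.prod_sdiff (hF f hf), Real.mul_rpow (by linarith) (by linarith)]
        exact mul_le_mul_of_nonneg_right
          (Real.rpow_le_rpow_of_exponent_le h1 (by linarith)) (Real.rpow_nonneg (by linarith) _)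
    _ = (∑ f ∈ F.image (fun f => f \ R),
        (∏ v ∈ f, (Ideal.absNorm v.asIdeal : ℝ)) ^ (-(3 / 2) : ℝ)) *
        (∏ v ∈ R, (Ideal.absNorm v.asIdeal : ℝ)) ^ (η - 2) := by
        rw [Finset.sum_image hinj, Finset.sum_mul]
    _ ≤ _ := mul_le_mul_of_nonneg_right (h _) (Real.rpow_nonneg (by linarith) _)

theorem rpow_bound_of_le_mul {a b c ε : ℝ} (hb : 1 ≤ b) (hc : 1 ≤ c) (ha : 1 ≤ a) (h : a ≤ b * c)
    (hε : 0 < ε) : c ^ (-(1 / 6) : ℝ) ≤ b * a ^ (ε - 1 / 6) := by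
  have h1 : (b * c) ^ (-(1 / 6) : ℝ) ≤ a ^ (-(1 / 6) : ℝ) :=
    Real.rpow_le_rpow_of_nonpos (by linarith) h (by norm_num)
  have h2 : a ^ (-(1 / 6) : ℝ) ≤ a ^ (ε - 1 / 6) :=
    Real.rpow_le_rpow_of_exponent_le ha (by linarith)
  have h3 : c ^ (-(1 / 6) : ℝ) = b ^ ((1 : ℝ) / 6) * (b * c) ^ (-(1 / 6) : ℝ) := by
    rw [Real.mul_rpow (by linarith) (by linarith), ← mul_assoc, ← Real.rpow_add (by linarith)]
    norm_num
  have h4 : b ^ ((1 : ℝ) / 6) ≤ b := by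
    calc b ^ ((1 : ℝ) / 6) ≤ b ^ (1 : ℝ) := Real.rpow_le_rpow_of_exponent_le hb (by norm_num)
      _ = b := Real.rpow_one b
  rw [h3]
  exact mul_le_mul h4 (h1.trans h2) (Real.rpow_nonneg (by nlinarith) _) (by linarith)

set_option maxHeartbeats 1000000 in
theorem card_le_of_ramified_at (k : Type u) (Ω : Type v) [Field k] [NumberField k] [Field Ω]
    [Algebra k Ω] [IsAlgClosed Ω] {ε : ℝ} (hε : 0 < ε) : ∃ C : ℝ, 1 ≤ C ∧
    ∀ (q r : Ideal (𝓞 k)) (X : ℝ) (T : Finset (IntermediateField k Ω)),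
    Squarefree q → Squarefree r → 0 ≤ X →
    (∀ K ∈ T, Module.finrank k K = 3) →
    (∀ K ∈ T, ∀ J ∈ T, Nonempty (K ≃ₐ[k] J) → K = J) →
    (∀ K ∈ T, ∀ [NumberField K], ((NumberField.discr K).natAbs : ℝ) ≤ X) →
    (∀ K ∈ T, ∀ [NumberField K], ∀ p : HeightOneSpectrum (𝓞 k), q ≤ p.asIdeal →
      ∃ w : HeightOneSpectrum (𝓞 K), w.asIdeal.LiesOver p.asIdeal ∧ ramIdx p w = 2) →
    (∀ K ∈ T, ∀ [NumberField K], ∀ p : HeightOneSpectrum (𝓞 k), r ≤ p.asIdeal →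
      ∃ w : HeightOneSpectrum (𝓞 K), w.asIdeal.LiesOver p.asIdeal ∧ ramIdx p w = 3) →
    (T.card : ℝ) ≤ C * X * ((Ideal.absNorm q : ℝ) ^ (ε - 1 / 6) *
      (Ideal.absNorm r : ℝ) ^ (ε - 2)) := by
  obtain ⟨C₀, hC₀, B, hcount⟩ := card_le_of_ramified k Ω
  obtain ⟨η, hη0, hηε, hη⟩ : ∃ η : ℝ, 0 < η ∧ η ≤ ε ∧ η ≤ 1 / 2 :=
    ⟨min ε (1 / 2), lt_min hε (by norm_num), min_le_left _ _, min_le_right _ _⟩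
  obtain ⟨C₁, hC₁, h9⟩ := exists_pow_card_le k (a := 9) (by norm_num) hη0
  obtain ⟨C₂, hC₂, h4⟩ := exists_pow_card_le k (a := 4) (η := 1 / 12) (by norm_num) (by norm_num)
  obtain ⟨C₃, hC₃, hsum⟩ := exists_sum_superset_le k
  have hB := one_le_prod_absNorm B
  obtain ⟨b, hb⟩ : ∃ b : ℝ, b = ∏ v ∈ B, (Ideal.absNorm v.asIdeal : ℝ) := ⟨_, rfl⟩
  rw [← hb] at hB
  have hC01 : 1 ≤ C₀ * C₁ * C₂ * C₃ * b :=
    one_le_mul_of_one_le_of_one_le (one_le_mul_of_one_le_of_one_le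
      (one_le_mul_of_one_le_of_one_le (one_le_mul_of_one_le_of_one_le hC₀ hC₁) hC₂) hC₃) hB
  refine ⟨C₀ * C₁ * C₂ * C₃ * b, hC01, ?_⟩
  intro q r X T hq hr hX hfin hiso hdisc hpart htot
  obtain ⟨Q, hQ, hqQ⟩ := exists_finset_prod_eq_of_squarefree hq
  obtain ⟨R, hR, hrR⟩ := exists_finset_prod_eq_of_squarefree hr
  have hnf : ∀ K ∈ T, NumberField K := by
    intro K hK
    have : FiniteDimensional k K := Module.finite_of_finrank_pos (by rw [hfin K hK]; norm_num)
    exact numberField_of_finiteDimensional k K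
  choose tot htotm using fun K : IntermediateField k Ω => exists_finset_totallyRamified K
  obtain ⟨g, hg⟩ : ∃ g : ℝ, g = ∏ v ∈ Q \ B, (Ideal.absNorm v.asIdeal : ℝ) := ⟨_, rfl⟩
  have hg1 : 1 ≤ g := hg ▸ one_le_prod_absNorm _
  have hNq : (Ideal.absNorm q : ℝ) = ∏ v ∈ Q, (Ideal.absNorm v.asIdeal : ℝ) := by
    rw [hqQ, map_prod]; push_cast; rfl
  have hNr : (Ideal.absNorm r : ℝ) = ∏ v ∈ R, (Ideal.absNorm v.asIdeal : ℝ) := by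
    rw [hrR, map_prod]; push_cast; rfl
  have hNq1 : (1 : ℝ) ≤ Ideal.absNorm q := hNq ▸ one_le_prod_absNorm _
  have hNr1 : (1 : ℝ) ≤ Ideal.absNorm r := hNr ▸ one_le_prod_absNorm _
  have hqb : (Ideal.absNorm q : ℝ) ≤ b * g := by
    rw [hNq, hb, hg, ← Finset.prod_union Finset.disjoint_sdiff, Finset.union_sdiff_self_eq_union]
    exact_mod_cast Finset.prod_le_prod_of_subset_of_one_le'
      (f := fun v : HeightOneSpectrum (𝓞 k) => Ideal.absNorm v.asIdeal)
      Finset.subset_union_right fun p _ _ => one_le_absNorm_asIdeal p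
  obtain ⟨W, hW⟩ : ∃ W : ℝ, W = b * (Ideal.absNorm q : ℝ) ^ (ε - 1 / 6) := ⟨_, rfl⟩
  have hW0 : 0 ≤ W := by rw [hW]; positivity
  have hgW : (4 : ℝ) ^ (Q \ B).card * g ^ (-(1 / 4) : ℝ) ≤ C₂ * W := by
    calc (4 : ℝ) ^ (Q \ B).card * g ^ (-(1 / 4) : ℝ) ≤
          C₂ * g ^ ((1 : ℝ) / 12) * g ^ (-(1 / 4) : ℝ) :=
          mul_le_mul_of_nonneg_right (hg ▸ h4 (Q \ B)) (Real.rpow_nonneg (by linarith) _)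
      _ = C₂ * g ^ (-(1 / 6) : ℝ) := by
          rw [mul_assoc, ← Real.rpow_add (by linarith)]; norm_num
      _ ≤ C₂ * W := mul_le_mul_of_nonneg_left
          (hW ▸ rpow_bound_of_le_mul hB hg1 hNq1 hqb hε) (by linarith)
  have hfib : ∀ f ∈ T.image tot, (((T.filter fun K => tot K = f).card : ℕ) : ℝ) ≤
      C₀ * C₁ * C₂ * X * W * (∏ v ∈ f, (Ideal.absNorm v.asIdeal : ℝ)) ^ (η - 2) := by
    intro f _
    have hmem : ∀ K ∈ T.filter (fun K => tot K = f), K ∈ T ∧ tot K = f := fun K hK =>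
      Finset.mem_filter.1 hK
    have h1 := hcount (T.filter fun K => tot K = f) f (Q \ B) X
      (fun K hK => hfin K (hmem K hK).1)
      (fun K hK J hJ => hiso K (hmem K hK).1 J (hmem J hJ).1)
      (fun K hK => hdisc K (hmem K hK).1)
      (fun K hK _ p => by rw [← (hmem K hK).2]; exact htotm K p)
      (fun K hK _ p hp => hpart K (hmem K hK).1 p ((hQ p).1 (Finset.mem_sdiff.1 hp).1))
      (fun p hp => (Finset.mem_sdiff.1 hp).2) hX
    have hf1 := one_le_prod_absNorm f
    have h9f := h9 f
    rw [← hg] at h1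
    generalize ∏ v ∈ f, (Ideal.absNorm v.asIdeal : ℝ) = n at *
    have hn0 : 0 < n := by linarith
    have hXn : 0 ≤ X / n ^ 2 := by positivity
    refine h1.trans ?_
    calc C₀ * (9 ^ f.card * 4 ^ (Q \ B).card * (X / n ^ 2 * g ^ (-(1 / 4) : ℝ)))
        = C₀ * (9 ^ f.card * (4 ^ (Q \ B).card * g ^ (-(1 / 4) : ℝ)) * (X / n ^ 2)) := by ring
      _ ≤ C₀ * (C₁ * n ^ η * (C₂ * W) * (X / n ^ 2)) := by
          have : 0 ≤ g ^ (-(1 / 4) : ℝ) := Real.rpow_nonneg (by linarith) _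
          have : 0 ≤ C₁ * n ^ η := by positivity
          gcongr
      _ = _ := by
          rw [Real.rpow_sub hn0, Real.rpow_two]; ring
  have hcard : (T.card : ℝ) = ∑ f ∈ T.image tot, (((T.filter fun K => tot K = f).card : ℕ) : ℝ) := by
    exact_mod_cast Finset.card_eq_sum_card_image tot T
  have hRF : ∀ f ∈ T.image tot, R ⊆ f := by
    intro f hf p hp
    obtain ⟨K, hK, rfl⟩ := Finset.mem_image.1 hf
    have := hnf K hK
    exact (htotm K p).2 (htot K hK p ((hR p).1 hp))
  have hA0 : 0 ≤ C₀ * C₁ * C₂ * X * W := by positivity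
  calc (T.card : ℝ) ≤ ∑ f ∈ T.image tot,
        C₀ * C₁ * C₂ * X * W * (∏ v ∈ f, (Ideal.absNorm v.asIdeal : ℝ)) ^ (η - 2) :=
        hcard ▸ Finset.sum_le_sum hfib
    _ ≤ C₀ * C₁ * C₂ * X * W * (C₃ * (Ideal.absNorm r : ℝ) ^ (η - 2)) := by
        rw [← Finset.mul_sum, hNr]
        exact mul_le_mul_of_nonneg_left (hsum η R _ hη hRF) hA0
    _ ≤ C₀ * C₁ * C₂ * X * W * (C₃ * (Ideal.absNorm r : ℝ) ^ (ε - 2)) := by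
        gcongr
    _ = _ := by rw [hW]; ring

end Uniformity

section CountClasses

theorem countClasses_le_of_forall_finset {k : Type*} [Field k] [NumberField k]
    {S : Set (IntermediateField k (AlgebraicClosure k))} {B : ℝ} (hB : 0 ≤ B)
    (h : ∀ T : Finset (IntermediateField k (AlgebraicClosure k)), (∀ K ∈ T, K ∈ S) →
      (∀ K ∈ T, ∀ J ∈ T, Nonempty (K ≃ₐ[k] J) → K = J) → (T.card : ℝ) ≤ B) :
    (countClasses k S : ℝ) ≤ B := by
  unfold countClasses
  set Q := Quotient (Setoid.comap (Subtype.val : S → _) (isoSetoid k)) with hQ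
  cases finite_or_infinite Q with
  | inr hinf => simpa using hB
  | inl hfin =>
    haveI := Fintype.ofFinite Q
    have hout : ∀ a b : Q, Nonempty (a.out.val ≃ₐ[k] b.out.val) → a = b := fun a b hab => by
      rw [← Quotient.out_eq a, ← Quotient.out_eq b]
      exact Quotient.sound hab
    have hinj : Function.Injective fun a : Q => a.out.val := fun a b hab =>
      hout a b (by
        have hab : a.out.val = b.out.val := hab
        rw [hab]
        exact ⟨AlgEquiv.refl⟩)
    have := h (Finset.univ.image fun a : Q => a.out.val) (by
      intro K hK
      obtain ⟨a, -, rfl⟩ := Finset.mem_image.1 hK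
      exact a.out.2) (by
      intro K hK J hJ hKJ
      obtain ⟨a, -, rfl⟩ := Finset.mem_image.1 hK
      obtain ⟨b, -, rfl⟩ := Finset.mem_image.1 hJ
      rw [hout a b hKJ])
    rwa [Finset.card_image_of_injective _ hinj, Finset.card_univ, ← Nat.card_eq_fintype_card]
      at this

theorem absDisc_eq_natAbs_discr {k : Type*} [Field k] [NumberField k]
    (K : IntermediateField k (AlgebraicClosure k)) [FiniteDimensional k K] [NumberField K] :
    absDisc k K = (NumberField.discr K).natAbs := by
  unfold absDisc
  rw [dif_pos ‹_›]

end CountClasses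

/-- **Uniformity estimate for partially and totally ramified `S3`-cubic extensions**
(Theorem 3.4).  For every `ε > 0` there is a constant `C` (depending only on `k` and
`ε`) such that for all coprime squarefree integral ideals `q`, `r` of `𝒪_k` and every
`X ≥ 1`, the number of `S3`-cubic extensions `K/k` (up to isomorphism) with
`Disc(K) ≤ X` that are partially ramified at every prime dividing `q` and totally
ramified at every prime dividing `r` is at most `C · X / (|q|^(1/6-ε) · |r|^(2-ε))`. -/
theorem uniformity_partially_totally_ramified (k : Type*) [Field k] [NumberField k]
    (ε : ℝ) (hε : 0 < ε) :
    ∃ C : ℝ, 0 < C ∧ ∀ q r : Ideal (𝓞 k), Squarefree q → Squarefree r →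
      IsCoprime q r → ∀ X : ℝ, 1 ≤ X →
      (countClasses k {K : IntermediateField k (AlgebraicClosure k) |
          IsSThreeCubic k K ∧ (absDisc k K : ℝ) ≤ X ∧
          (∀ p : Ideal (𝓞 k), p.IsPrime → p ∣ q → PartiallyRamified k K p) ∧
          (∀ p : Ideal (𝓞 k), p.IsPrime → p ∣ r → TotallyRamified k K p)} : ℝ)
        ≤ C * X / ((Ideal.absNorm q : ℝ) ^ ((1 : ℝ) / 6 - ε)
            * (Ideal.absNorm r : ℝ) ^ ((2 : ℝ) - ε)) := by
  obtain ⟨C, hC1, hC⟩ := card_le_of_ramified_at k (AlgebraicClosure k) hε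
  refine ⟨C, by linarith, fun q r hq hr _ X hX => ?_⟩
  refine countClasses_le_of_forall_finset (by positivity) fun T hTS hT => ?_
  refine (hC q r X T hq hr (by linarith) (fun K hK => (hTS K hK).1.1) hT ?_ ?_ ?_).trans_eq ?_
  · intro K hK _
    haveI : FiniteDimensional k K :=
      Module.finite_of_finrank_pos (by rw [(hTS K hK).1.1]; norm_num)
    rw [← absDisc_eq_natAbs_discr]
    exact (hTS K hK).2.1
  · intro K hK _ p hp
    obtain ⟨P, Q, hP, hQ, hPQ, h⟩ := (hTS K hK).2.2.1 p.asIdeal p.isPrime (Ideal.dvd_iff_le.2 hp)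
    exact exists_ramIdx_eq_two_of_map_eq hP hQ hPQ h
  · intro K hK _ p hp
    obtain ⟨P, hP, h⟩ := (hTS K hK).2.2.2 p.asIdeal p.isPrime (Ideal.dvd_iff_le.2 hp)
    obtain ⟨w, hw⟩ := exists_primeAbove K p
    exact ⟨w, hw, ramIdx_eq_three_of_map_eq hP h w⟩
  · rw [← neg_sub (1 / 6 : ℝ) ε, ← neg_sub (2 : ℝ) ε, Real.rpow_neg (Nat.cast_nonneg _),
      Real.rpow_neg (Nat.cast_nonneg _), ← mul_inv]
    exact (div_eq_mul_inv _ _).symm
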